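/- Fix T > 0 and α with 0 ≤ α < 1/7. There exist infinitely many pairwise distinct pairs (ρ_j, u_j), j ∈ ℕ, with ρ_j ∈ C^α([0,T]×𝕋³;ℝ) and u_j ∈ C^α([0,T]×𝕋³;ℝ³), such that: (i) ρ_j(t,x) > 0 for all (t,x); (ii) each (ρ_j,u_j) is a weak solution of the inhomogeneous incompressible Euler equations, i.e. there exists a continuous pressure p_j : [0,T]×𝕋³ → ℝ such that for every scalar test function φ ∈ C_c^∞((0,T)×𝕋³) and every vector test field Ψ ∈ C_c^∞((0,T)×𝕋³;ℝ³) one has ∫₀^T∫_{𝕋³}(ρ_j ∂_t φ + ρ_j u_j·∇φ) dx dt = 0, ∫₀^T∫_{𝕋³}(ρ_j u_j·∂_t Ψ + (ρ_j u_j ⊗ u_j) : ∇Ψ + p_j ∇·Ψ) dx dt = 0, and ∫₀^T∫_{𝕋³} u_j·∇φ dx dt = 0; (iii) all the pairs share the same initial data, i.e. ρ_j(0,·) = ρ_k(0,·) and u_j(0,·) = u_k(0,·) for all j, k; (iv) for j ≠ k the solutions differ, indeed sup_{t∈[0,T]} ‖u_j(t,·) − u_k(t,·)‖_{L²(𝕋³)}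 > 0. -/

import Mathlib

open MeasureTheory Real

noncomputable section

/-- Points of ℝ³; functions on the torus 𝕋³ = (ℝ/2πℤ)³ are 2π-periodic functions on ℝ³. -/
abbrev Pt := Fin 3 → ℝ
abbrev Vec := Fin 3 → ℝ

/-- 2π-periodicity in each space coordinate. -/
def SpacePeriodic {E : Type*} (f : ℝ → Pt → E) : Prop :=
  ∀ (t : ℝ) (l : Fin 3 → ℤ) (x : Pt), f t (x + fun i => 2 * π * (l i : ℝ)) = f t x

/-- Fundamental domain of the torus 𝕋³, identified with (-π,π]³. -/
def Box3 : Set Pt := Set.univ.pi fun _ => Set.Ioc (-π) π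

/-- Partial derivative in the i-th coordinate direction. -/
def pd {E : Type*} [NormedAddCommGroup E] [NormedSpace ℝ E]
    (i : Fin 3) (f : Pt → E) (x : Pt) : E :=
  fderiv ℝ f x (Pi.single i 1)

/-- Time derivative ∂_t of a time-dependent field. -/
def tD {E : Type*} [NormedAddCommGroup E] [NormedSpace ℝ E]
    (f : ℝ → Pt → E) : ℝ → Pt → E :=
  fun t x => deriv (fun s => f s x) t

/-- Smoothness (jointly in time and space). -/
def SmoothTS {E : Type*} [NormedAddCommGroup E] [NormedSpace ℝ E] (f : ℝ → Pt → E) : Prop :=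
  ∀ n : ℕ, ContDiff ℝ n (Function.uncurry f)

/-- Test functions: smooth, space-periodic, with temporal support compactly contained in (0,T). -/
def TestFun {E : Type*} [NormedAddCommGroup E] [NormedSpace ℝ E]
    (T : ℝ) (φ : ℝ → Pt → E) : Prop :=
  SmoothTS φ ∧ SpacePeriodic φ ∧
    ∃ a b : ℝ, 0 < a ∧ a ≤ b ∧ b < T ∧ ∀ t, t ∉ Set.Icc a b → ∀ x, φ t x = 0

namespace Euler2D

/-- The coordinate directions of space-time; index `0` is time, `1` and `2` are space. -/
def ev (v : Fin 3) : Pt := Pi.single v 1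

/-- Continuous bounded functions on space-time, `2π`-periodic in both space variables. -/
def BD0 (f : Pt → ℂ) : Prop :=
  Continuous f ∧ (∃ C, ∀ x, ‖f x‖ ≤ C) ∧
    ∀ v : Fin 3, v ≠ 0 → ∀ x, f (x + (2 * π) • ev v) = f x

/-- Periodic functions with `n` bounded derivatives. -/
def BD : ℕ → (Pt → ℂ) → Prop
  | 0, f => BD0 f
  | n + 1, f => BD0 f ∧ Differentiable ℝ f ∧ ∀ v, BD n (fun x => fderiv ℝ f x (ev v))

lemma BD.zero {n : ℕ} {f : Pt → ℂ} (h : BD n f) : BD0 f := by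
  cases n with
  | zero => exact h
  | succ n => exact h.1

lemma BD.pred {n : ℕ} {f : Pt → ℂ} (h : BD (n + 1) f) : BD n f := by
  induction n generalizing f with
  | zero => exact h.zero
  | succ n ih => exact ⟨h.1, h.2.1, fun v => ih (h.2.2 v)⟩

lemma BD0.const (c : ℂ) : BD0 (fun _ => c) :=
  ⟨continuous_const, ⟨‖c‖, fun _ => le_rfl⟩, fun _ _ _ => rfl⟩

lemma BD.const (n : ℕ) (c : ℂ) : BD n (fun _ => c) := by
  induction n generalizing c with
  | zero => exact BD0.const c
  | succ n ih =>
    refine ⟨BD0.const c, differentiable_const c, fun v => ?_⟩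
    simpa using ih 0

lemma BD0.add {f g : Pt → ℂ} (hf : BD0 f) (hg : BD0 g) : BD0 (fun x => f x + g x) := by
  obtain ⟨hf1, ⟨C, hC⟩, hf3⟩ := hf
  obtain ⟨hg1, ⟨K, hK⟩, hg3⟩ := hg
  refine ⟨hf1.add hg1, ⟨C + K, fun x => (norm_add_le _ _).trans (add_le_add (hC x) (hK x))⟩,
    fun v hv x => by simp only [hf3 v hv, hg3 v hv]⟩

lemma BD0.mul {f g : Pt → ℂ} (hf : BD0 f) (hg : BD0 g) : BD0 (fun x => f x * g x) := by
  obtain ⟨hf1, ⟨C, hC⟩, hf3⟩ := hf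
  obtain ⟨hg1, ⟨K, hK⟩, hg3⟩ := hg
  refine ⟨hf1.mul hg1, ⟨C * K, fun x => ?_⟩, fun v hv x => by simp only [hf3 v hv, hg3 v hv]⟩
  rw [norm_mul]
  exact mul_le_mul (hC x) (hK x) (norm_nonneg _) ((norm_nonneg _).trans (hC x))

lemma BD.add {n : ℕ} {f g : Pt → ℂ} (hf : BD n f) (hg : BD n g) :
    BD n (fun x => f x + g x) := by
  induction n generalizing f g with
  | zero => exact BD0.add hf hg
  | succ n ih =>
    refine ⟨hf.1.add hg.1, hf.2.1.add hg.2.1, fun v => ?_⟩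
    convert ih (hf.2.2 v) (hg.2.2 v) using 2 with x
    rw [fderiv_fun_add (hf.2.1 x) (hg.2.1 x)]
    rfl

lemma BD.mul {n : ℕ} {f g : Pt → ℂ} (hf : BD n f) (hg : BD n g) :
    BD n (fun x => f x * g x) := by
  induction n generalizing f g with
  | zero => exact BD0.mul hf hg
  | succ n ih =>
    refine ⟨hf.1.mul hg.1, hf.2.1.mul hg.2.1, fun v => ?_⟩
    convert (ih hf.pred (hg.2.2 v)).add (ih (hf.2.2 v) hg.pred) using 2 with x
    rw [fderiv_fun_mul (hf.2.1 x) (hg.2.1 x)]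
    simp [mul_comm]

/-- The algebra of smooth functions on space-time all of whose derivatives are bounded and
which are `2π`-periodic in the space variables. -/
def B : Subalgebra ℂ (Pt → ℂ) where
  carrier := {f | ∀ n, BD n f}
  mul_mem' hf hg n := (hf n).mul (hg n)
  add_mem' hf hg n := (hf n).add (hg n)
  algebraMap_mem' c n := BD.const n c

lemma B.differentiable (f : B) : Differentiable ℝ f.1 := (f.2 1).2.1

lemma B.continuous (f : B) : Continuous f.1 := (f.2 0).1

lemma B.bounded (f : B) : ∃ C, ∀ x, ‖f.1 x‖ ≤ C := (f.2 0).2.1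

lemma B.periodic (f : B) {v : Fin 3} (hv : v ≠ 0) (x : Pt) :
    f.1 (x + (2 * π) • ev v) = f.1 x := (f.2 0).2.2 v hv x

@[ext] lemma B.ext {f g : B} (h : ∀ x, f.1 x = g.1 x) : f = g := Subtype.ext (funext h)

@[simp] lemma B.add_val (f g : B) (x : Pt) : (f + g).1 x = f.1 x + g.1 x := rfl
@[simp] lemma B.sub_val (f g : B) (x : Pt) : (f - g).1 x = f.1 x - g.1 x := rfl
@[simp] lemma B.neg_val (f : B) (x : Pt) : (-f).1 x = -f.1 x := rfl
@[simp] lemma B.mul_val (f g : B) (x : Pt) : (f * g).1 x = f.1 x * g.1 x := rfl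
@[simp] lemma B.smul_val (c : ℂ) (f : B) (x : Pt) : (c • f).1 x = c * f.1 x := rfl
@[simp] lemma B.zero_val (x : Pt) : (0 : B).1 x = 0 := rfl
@[simp] lemma B.one_val (x : Pt) : (1 : B).1 x = 1 := rfl
@[simp] lemma B.pow_val (f : B) (n : ℕ) (x : Pt) : (f ^ n).1 x = f.1 x ^ n := rfl
@[simp] lemma B.sum_val {J : Type*} (s : Finset J) (f : J → B) (x : Pt) :
    (∑ j ∈ s, f j).1 x = ∑ j ∈ s, (f j).1 x := by
  rw [show (∑ j ∈ s, f j).1 = ∑ j ∈ s, (f j).1 from map_sum B.val f s, Finset.sum_apply]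

/-- Partial derivatives, as derivations of the algebra `B`. -/
def D (v : Fin 3) : Derivation ℂ B B :=
  Derivation.mk'
    { toFun := fun f => ⟨fun x => fderiv ℝ f.1 x (ev v), fun n => (f.2 (n + 1)).2.2 v⟩
      map_add' := fun f g => by
        ext x
        change fderiv ℝ (fun x => f.1 x + g.1 x) x (ev v) = _
        rw [fderiv_fun_add (B.differentiable f x) (B.differentiable g x)]
        rfl
      map_smul' := fun c f => by
        ext x
        change fderiv ℝ (fun x => c * f.1 x) x (ev v) = _
        rw [fderiv_const_mul (B.differentiable f x)]
        rfl }
    (fun f g => by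
      ext x
      change fderiv ℝ (fun x => f.1 x * g.1 x) x (ev v) = _
      rw [fderiv_fun_mul (B.differentiable f x) (B.differentiable g x)]
      rfl)

lemma D_val (v : Fin 3) (f : B) (x : Pt) : (D v f).1 x = fderiv ℝ f.1 x (ev v) := rfl

lemma fderiv_apply (f : B) (x h : Pt) : fderiv ℝ f.1 x h = ∑ v, (h v : ℂ) * (D v f).1 x := by
  have : h = ∑ v, h v • ev v := by
    ext i
    simp [ev, Finset.sum_apply, Pi.single_apply]
  conv_lhs => rw [this]
  simp [map_sum, D_val]

lemma fderiv_eq_sum (f : B) : (fun x => fderiv ℝ f.1 x) =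
    fun x => ∑ v : Fin 3, ((ContinuousLinearMap.proj v : Pt →L[ℝ] ℝ).smulRight ((D v f).1 x)) := by
  funext x
  ext h
  rw [fderiv_apply]
  simp

lemma B.differentiable_fderiv (f : B) : Differentiable ℝ (fun x => fderiv ℝ f.1 x) := by
  rw [fderiv_eq_sum]
  refine Differentiable.fun_sum fun v _ => ?_
  intro x
  exact ((ContinuousLinearMap.smulRightL ℝ Pt ℂ
    (ContinuousLinearMap.proj v : Pt →L[ℝ] ℝ)).differentiableAt).comp x
    (B.differentiable (D v f) x)

lemma D_comm (v w : Fin 3) (f : B) : D v (D w f) = D w (D v f) := by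
  have key : ∀ a b : Fin 3, ∀ x, (D a (D b f)).1 x
      = fderiv ℝ (fun x => fderiv ℝ f.1 x) x (ev a) (ev b) := by
    intro a b x
    rw [D_val]
    have h2 := (B.differentiable_fderiv f x).hasFDerivAt.clm_apply (hasFDerivAt_const (ev b) x)
    have : (D b f).1 = fun x => fderiv ℝ f.1 x (ev b) := rfl
    rw [this, h2.fderiv]
    simp
  ext x
  rw [key, key]
  exact second_derivative_symmetric (fun y => (B.differentiable f y).hasFDerivAt)
    (B.differentiable_fderiv f x).hasFDerivAt _ _

lemma BD.conj {n : ℕ} {f : Pt → ℂ} (hf : BD n f) : BD n (fun x => star (f x)) := by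
  induction n generalizing f with
  | zero =>
    obtain ⟨h1, ⟨C, hC⟩, h3⟩ := hf
    exact ⟨h1.star, ⟨C, fun x => by simpa using hC x⟩, fun v hv x => by simp only [h3 v hv]⟩
  | succ n ih =>
    obtain ⟨h0, h1, h2⟩ := hf
    refine ⟨ih (f := f) (BD.pred (n := n) ⟨h0, h1, h2⟩) |>.zero, h1.star, fun v => ?_⟩
    convert ih (h2 v) using 2 with x
    rw [fderiv_star]
    rfl

/-- Complex conjugation on `B`. -/
def cj : B →+* B where
  toFun f := ⟨fun x => star (f.1 x), fun n => (f.2 n).conj⟩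
  map_one' := by ext x; simp
  map_zero' := by ext x; simp
  map_add' f g := by ext x; simp
  map_mul' f g := by ext x; simp

@[simp] lemma cj_val (f : B) (x : Pt) : (cj f).1 x = star (f.1 x) := rfl

@[simp] lemma cj_cj (f : B) : cj (cj f) = f := by ext x; simp

lemma cj_smul (c : ℂ) (f : B) : cj (c • f) = star c • cj f := by ext x; simp

lemma cj_D (v : Fin 3) (f : B) : cj (D v f) = D v (cj f) := by
  ext x
  rw [cj_val, D_val, D_val]
  change _ = fderiv ℝ (fun x => star (f.1 x)) x (ev v)
  rw [fderiv_star]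
  rfl

section Averages

variable {Y : Type*} [MeasurableSpace Y] {ν : Measure Y} {w : Y → ℝ} {sh : Y → Pt}

lemma integrable_avg (hw : Integrable w ν) (hs : Measurable sh) (f : B) (x : Pt) :
    Integrable (fun y => (w y : ℂ) * f.1 (x + sh y)) ν := by
  obtain ⟨C, hC⟩ := B.bounded f
  refine (hw.ofReal).mul_bdd (c := C) ?_ (Filter.Eventually.of_forall fun y => hC _)
  exact (((B.continuous f).comp (continuous_const.add continuous_id)).measurable.comp
    hs).aestronglyMeasurable

lemma norm_avg_le (hw : Integrable w ν) (f : B) {C : ℝ} (hC : ∀ x, ‖f.1 x‖ ≤ C)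
    (x : Pt) : ‖∫ y, (w y : ℂ) * f.1 (x + sh y) ∂ν‖ ≤ (∫ y, |w y| ∂ν) * C := by
  rw [← integral_mul_const]
  refine norm_integral_le_of_norm_le (hw.abs.mul_const C) (Filter.Eventually.of_forall fun y => ?_)
  rw [norm_mul, Complex.norm_real, norm_eq_abs]
  exact mul_le_mul_of_nonneg_left (hC _) (abs_nonneg _)

lemma exists_bound_fderiv (f : B) : ∃ C, ∀ z, ‖fderiv ℝ f.1 z‖ ≤ C := by
  choose C hC using fun v => B.bounded (D v f)
  refine ⟨∑ v, C v, fun z => ContinuousLinearMap.opNorm_le_bound _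
    (Finset.sum_nonneg fun v _ => (norm_nonneg _).trans (hC v 0)) fun h => ?_⟩
  rw [fderiv_apply, Finset.sum_mul]
  refine norm_sum_le_of_le _ fun v _ => ?_
  rw [norm_mul, Complex.norm_real, mul_comm]
  exact mul_le_mul (hC v z) (norm_le_pi_norm h v) (norm_nonneg _)
    ((norm_nonneg _).trans (hC v 0))

lemma integrable_avg_fderiv (hw : Integrable w ν) (hs : Measurable sh) (f : B) (x : Pt) :
    Integrable (fun y => (w y : ℂ) • fderiv ℝ f.1 (x + sh y)) ν := by
  obtain ⟨C, hC⟩ := exists_bound_fderiv f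
  refine (hw.abs.mul_const C).mono' ?_ (Filter.Eventually.of_forall fun y => ?_)
  · refine (hw.ofReal (𝕜 := ℂ)).aestronglyMeasurable.smul ?_
    exact (((B.differentiable_fderiv f).continuous.comp
      (continuous_const.add continuous_id)).stronglyMeasurable.comp_measurable
      hs).aestronglyMeasurable
  · rw [norm_smul, Complex.norm_real, norm_eq_abs]
    exact mul_le_mul_of_nonneg_left (hC _) (abs_nonneg _)

lemma hasFDerivAt_avg (hw : Integrable w ν) (hs : Measurable sh) (f : B) (x : Pt) :
    HasFDerivAt (fun x => ∫ y, (w y : ℂ) * f.1 (x + sh y) ∂ν)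
      (∫ y, (w y : ℂ) • fderiv ℝ f.1 (x + sh y) ∂ν) x := by
  obtain ⟨C, hC⟩ := exists_bound_fderiv f
  refine (hasFDerivAt_integral_of_dominated_of_fderiv_le (𝕜 := ℝ) (s := Set.univ)
    (bound := fun y => |w y| * C)
    (F' := fun x y => (w y : ℂ) • fderiv ℝ f.1 (x + sh y)) Filter.univ_mem
    (Filter.Eventually.of_forall fun x => (integrable_avg hw hs f x).aestronglyMeasurable)
    (integrable_avg hw hs f x) (integrable_avg_fderiv hw hs f x).aestronglyMeasurable ?_
    (hw.abs.mul_const _) ?_)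
  · refine Filter.Eventually.of_forall fun y z _ => ?_
    rw [norm_smul, Complex.norm_real, norm_eq_abs]
    exact mul_le_mul_of_nonneg_left (hC _) (abs_nonneg _)
  · refine Filter.Eventually.of_forall fun y z _ => ?_
    have := (B.differentiable f (z + sh y)).hasFDerivAt.comp z
      ((hasFDerivAt_id z).add_const (sh y))
    simpa using this.const_mul (w y : ℂ)

lemma fderiv_avg (hw : Integrable w ν) (hs : Measurable sh) (f : B) (v : Fin 3) (x : Pt) :
    fderiv ℝ (fun x => ∫ y, (w y : ℂ) * f.1 (x + sh y) ∂ν) x (ev v) =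
      ∫ y, (w y : ℂ) * (D v f).1 (x + sh y) ∂ν := by
  rw [(hasFDerivAt_avg hw hs f x).fderiv,
    ContinuousLinearMap.integral_apply (integrable_avg_fderiv hw hs f x)]
  rfl

lemma BD_avg (hw : Integrable w ν) (hs : Measurable sh) (n : ℕ) (f : B) :
    BD n (fun x => ∫ y, (w y : ℂ) * f.1 (x + sh y) ∂ν) := by
  have h0 : ∀ f : B, BD0 (fun x => ∫ y, (w y : ℂ) * f.1 (x + sh y) ∂ν) := by
    intro f
    obtain ⟨C, hC⟩ := B.bounded f
    refine ⟨continuous_iff_continuousAt.2 fun x => (hasFDerivAt_avg hw hs f x).continuousAt,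
      ⟨_, norm_avg_le hw f hC⟩, fun v hv x => ?_⟩
    simp only [add_right_comm x, B.periodic f hv]
  induction n generalizing f with
  | zero => exact h0 f
  | succ n ih =>
    refine ⟨h0 f, fun x => (hasFDerivAt_avg hw hs f x).differentiableAt, fun v => ?_⟩
    simp only [fderiv_avg hw hs]
    exact ih (D v f)

/-- Weighted averages of translates. -/
def avg (hw : Integrable w ν) (hs : Measurable sh) : B →ₗ[ℂ] B where
  toFun f := ⟨_, fun n => BD_avg hw hs n f⟩
  map_add' f g := by
    ext x
    change ∫ y, (w y : ℂ) * (f.1 (x + sh y) + g.1 (x + sh y)) ∂ν = _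
    simp only [mul_add]
    exact integral_add (integrable_avg hw hs f x) (integrable_avg hw hs g x)
  map_smul' c f := by
    ext x
    change ∫ y, (w y : ℂ) * (c * f.1 (x + sh y)) ∂ν = c * ∫ y, (w y : ℂ) * f.1 (x + sh y) ∂ν
    rw [← integral_const_mul]
    congr 1
    funext y
    ring

lemma avg_val (hw : Integrable w ν) (hs : Measurable sh) (f : B) (x : Pt) :
    (avg hw hs f).1 x = ∫ y, (w y : ℂ) * f.1 (x + sh y) ∂ν := rfl

lemma D_avg (hw : Integrable w ν) (hs : Measurable sh) (f : B) (v : Fin 3) :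
    D v (avg hw hs f) = avg hw hs (D v f) := by
  ext x
  exact fderiv_avg hw hs f v x

lemma cj_avg (hw : Integrable w ν) (hs : Measurable sh) (f : B) :
    cj (avg hw hs f) = avg hw hs (cj f) := by
  ext x
  rw [cj_val, avg_val, avg_val]
  simp only [RCLike.star_def]
  rw [← integral_conj]
  simp

end Averages

/-! ### Periodic primitives in the space directions -/

lemma continuous_smul_ev (v : Fin 3) : Continuous fun s : ℝ => s • ev v :=
  continuous_id.smul continuous_const

/-- Periodic primitive in direction `v`. -/
def J (v : Fin 3) : B →ₗ[ℂ] B :=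
  avg (ν := volume.restrict (Set.Ioc 0 (2 * π))) (w := fun s => s / (2 * π))
    (sh := fun s => s • ev v)
    ((continuous_id.div_const _).integrableOn_Ioc)
    (continuous_smul_ev v).measurable

/-- Mean in direction `v`. -/
def Mn (v : Fin 3) : B →ₗ[ℂ] B :=
  avg (ν := volume.restrict (Set.Ioc 0 (2 * π))) (w := fun _ => 1 / (2 * π))
    (sh := fun s => s • ev v)
    (continuous_const.integrableOn_Ioc)
    (continuous_smul_ev v).measurable

lemma hasDerivAt_line (f : B) (v : Fin 3) (x : Pt) (s : ℝ) :
    HasDerivAt (fun s : ℝ => f.1 (x + s • ev v)) ((D v f).1 (x + s • ev v)) s := by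
  have h1 : HasDerivAt (fun s : ℝ => x + s • ev v) (ev v) s := by
    simpa using ((hasDerivAt_id s).smul_const (ev v)).const_add x
  exact (B.differentiable f (x + s • ev v)).hasFDerivAt.comp_hasDerivAt s h1

lemma continuous_line (f : B) (v : Fin 3) (x : Pt) :
    Continuous (fun s : ℝ => f.1 (x + s • ev v)) :=
  (B.continuous f).comp (continuous_const.add (continuous_smul_ev v))

lemma J_val (v : Fin 3) (f : B) (x : Pt) :
    (J v f).1 x = ∫ s in (0)..(2 * π), ((s / (2 * π) : ℝ) : ℂ) * f.1 (x + s • ev v) := by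
  rw [intervalIntegral.integral_of_le two_pi_pos.le]; rfl

lemma Mn_val (v : Fin 3) (f : B) (x : Pt) :
    (Mn v f).1 x = ∫ s in (0)..(2 * π), ((1 / (2 * π) : ℝ) : ℂ) * f.1 (x + s • ev v) := by
  rw [intervalIntegral.integral_of_le two_pi_pos.le]; rfl

lemma D_J (v w : Fin 3) (f : B) : D v (J w f) = J w (D v f) := D_avg _ _ _ _
lemma D_Mn (v w : Fin 3) (f : B) : D v (Mn w f) = Mn w (D v f) := D_avg _ _ _ _
lemma cj_J (w : Fin 3) (f : B) : cj (J w f) = J w (cj f) := cj_avg _ _ _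
lemma cj_Mn (w : Fin 3) (f : B) : cj (Mn w f) = Mn w (cj f) := cj_avg _ _ _

lemma J_D_self {v : Fin 3} (hv : v ≠ 0) (f : B) : J v (D v f) = f - Mn v f := by
  ext x
  have h1 : ∀ s : ℝ, HasDerivAt (fun s : ℝ => ((s / (2 * π) : ℝ) : ℂ)) ((1 / (2 * π) : ℝ) : ℂ) s :=
    fun s => ((hasDerivAt_id s).div_const (2 * π)).ofReal_comp
  rw [J_val, intervalIntegral.integral_mul_deriv_eq_deriv_mul (fun s _ => h1 s)
    (fun s _ => hasDerivAt_line f v x s) intervalIntegrable_const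
    ((continuous_line (D v f) v x).intervalIntegrable _ _), B.sub_val, Mn_val, B.periodic f hv]
  simp

lemma Mn_D_self {v : Fin 3} (hv : v ≠ 0) (f : B) : Mn v (D v f) = 0 := by
  ext x
  rw [Mn_val, intervalIntegral.integral_const_mul,
    intervalIntegral.integral_eq_sub_of_hasDerivAt (fun s _ => hasDerivAt_line f v x s)
    ((continuous_line (D v f) v x).intervalIntegrable _ _), B.periodic f hv]
  simp

end Euler2D

namespace Euler2D

open scoped ContDiff

/-! ### Quantitative bounds -/

/-- `f` is bounded by `A`, and each of the first `n` derivatives costs a factor `l`. -/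
def Bdd : ℕ → ℝ → ℝ → B → Prop
  | 0, A, _, f => ∀ x, ‖f.1 x‖ ≤ A
  | n + 1, A, l, f => (∀ x, ‖f.1 x‖ ≤ A) ∧ ∀ v, Bdd n (A * l) l (D v f)

namespace Bdd

variable {n m : ℕ} {A A' l l' : ℝ} {f g : B}

lemma sup (h : Bdd n A l f) (x : Pt) : ‖f.1 x‖ ≤ A := by
  cases n with
  | zero => exact h x
  | succ n => exact h.1 x

lemma nonneg (h : Bdd n A l f) : 0 ≤ A := (norm_nonneg _).trans (h.sup 0)

lemma deriv (h : Bdd (n + 1) A l f) (v : Fin 3) : Bdd n (A * l) l (D v f) := h.2 v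

lemma mono (h : Bdd n A l f) (hA : A ≤ A') (hl : 0 ≤ l) (hl' : l ≤ l') : Bdd n A' l' f := by
  induction n generalizing f A A' with
  | zero => exact fun x => (h x).trans hA
  | succ n ih =>
    refine ⟨fun x => (h.1 x).trans hA, fun v => ih (h.2 v) ?_⟩
    exact mul_le_mul hA hl' hl (h.nonneg.trans hA)

lemma pred (h : Bdd (n + 1) A l f) : Bdd n A l f := by
  induction n generalizing f A with
  | zero => exact h.1
  | succ n ih => exact ⟨h.1, fun v => ih (h.2 v)⟩

lemma add (hf : Bdd n A l f) (hg : Bdd n A' l g) : Bdd n (A + A') l (f + g) := by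
  induction n generalizing f g A A' with
  | zero => exact fun x => (norm_add_le _ _).trans (add_le_add (hf x) (hg x))
  | succ n ih =>
    refine ⟨fun x => (norm_add_le _ _).trans (add_le_add (hf.1 x) (hg.1 x)), fun v => ?_⟩
    rw [map_add, add_mul]
    exact ih (hf.2 v) (hg.2 v)

lemma zero (hA : 0 ≤ A) (hl : 0 ≤ l) : Bdd n A l 0 := by
  induction n generalizing A with
  | zero => exact fun x => by simpa using hA
  | succ n ih =>
    refine ⟨fun x => by simpa using hA, fun v => ?_⟩
    rw [map_zero]
    exact ih (mul_nonneg hA hl)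

lemma smul (c : ℂ) (hf : Bdd n A l f) : Bdd n (‖c‖ * A) l (c • f) := by
  have h0 : ∀ {f : B} {A : ℝ}, (∀ x, ‖f.1 x‖ ≤ A) → ∀ x, ‖(c • f).1 x‖ ≤ ‖c‖ * A := by
    intro f A h x
    rw [B.smul_val, norm_mul]
    exact mul_le_mul_of_nonneg_left (h x) (norm_nonneg _)
  induction n generalizing f A with
  | zero => exact h0 hf
  | succ n ih =>
    refine ⟨h0 hf.1, fun v => ?_⟩
    rw [Derivation.map_smul, mul_assoc]
    exact ih (hf.2 v)

lemma neg (hf : Bdd n A l f) : Bdd n A l (-f) := by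
  simpa using hf.smul (-1)

lemma sub (hf : Bdd n A l f) (hg : Bdd n A' l g) : Bdd n (A + A') l (f - g) := by
  rw [sub_eq_add_neg]
  exact hf.add hg.neg

lemma cj (hf : Bdd n A l f) : Bdd n A l (cj f) := by
  induction n generalizing f A with
  | zero => exact fun x => by simpa using hf x
  | succ n ih =>
    refine ⟨fun x => by simpa using hf.1 x, fun v => ?_⟩
    rw [← cj_D]
    exact ih (hf.2 v)

lemma mul (hl : 0 ≤ l) (hf : Bdd n A l f) (hg : Bdd n A' l g) :
    Bdd n (2 ^ n * (A * A')) l (f * g) := by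
  have h0 : ∀ {n : ℕ} {A A' : ℝ} {f g : B}, Bdd n A l f → Bdd n A' l g →
      ∀ x, ‖(f * g).1 x‖ ≤ A * A' := by
    intro n A A' f g hf hg x
    rw [B.mul_val, norm_mul]
    exact mul_le_mul (hf.sup x) (hg.sup x) (norm_nonneg _) hf.nonneg
  induction n generalizing f g A A' with
  | zero => simpa [Bdd] using h0 hf hg
  | succ n ih =>
    refine ⟨fun x => (h0 hf hg x).trans (le_mul_of_one_le_left
      (mul_nonneg hf.nonneg hg.nonneg) (one_le_pow₀ (by norm_num))), fun v => ?_⟩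
    rw [Derivation.leibniz, smul_eq_mul, smul_eq_mul]
    have h1 := ih hf.pred (hg.2 v)
    have h2 := ih hg.pred (hf.2 v)
    refine (h1.add h2).mono (le_of_eq ?_) hl le_rfl
    ring

lemma exists_const (n : ℕ) (f : B) : ∃ C, Bdd n C 1 f := by
  induction n generalizing f with
  | zero => exact B.bounded f
  | succ n ih =>
    obtain ⟨C, hC⟩ := ih f
    choose K hK using fun v => ih (D v f)
    have hC0 := hC.nonneg
    have hK0 : 0 ≤ ∑ v, K v := Finset.sum_nonneg fun v _ => (hK v).nonneg
    refine ⟨C + ∑ v, K v, fun x => (hC.sup x).trans (by linarith), fun v => (hK v).mono ?_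
      zero_le_one le_rfl⟩
    have := Finset.single_le_sum (fun v _ => (hK v).nonneg) (Finset.mem_univ v)
    linarith

section
variable {Y : Type*} [MeasurableSpace Y] {ν : Measure Y} {w : Y → ℝ} {sh : Y → Pt}

lemma avg (hw : Integrable w ν) (hs : Measurable sh) (hf : Bdd n A l f) :
    Bdd n ((∫ y, |w y| ∂ν) * A) l (avg hw hs f) := by
  induction n generalizing f A with
  | zero => exact norm_avg_le hw f hf
  | succ n ih =>
    refine ⟨norm_avg_le hw f hf.1, fun v => ?_⟩
    rw [D_avg, mul_assoc]
    exact ih (hf.2 v)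
end

end Bdd

/-- The ideal of functions vanishing before time `t`. -/
def Z (t : ℝ) : Ideal B where
  carrier := {f | ∀ x : Pt, x 0 < t → f.1 x = 0}
  add_mem' hf hg x hx := by simp [hf x hx, hg x hx]
  zero_mem' x _ := rfl
  smul_mem' c f hf x hx := by simp [hf x hx]

lemma mem_Z {t : ℝ} {f : B} : f ∈ Z t ↔ ∀ x : Pt, x 0 < t → f.1 x = 0 := Iff.rfl

lemma Z_anti {s t : ℝ} (h : s ≤ t) : Z t ≤ Z s := fun _ hf x hx => hf x (hx.trans_le h)

lemma csmul_mem_Z {t : ℝ} (c : ℂ) {f : B} (hf : f ∈ Z t) : c • f ∈ Z t :=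
  fun x hx => by simp [hf x hx]

lemma D_mem_Z {t : ℝ} (v : Fin 3) {f : B} (hf : f ∈ Z t) : D v f ∈ Z t := by
  intro x hx
  rw [D_val]
  have : f.1 =ᶠ[nhds x] fun _ => 0 :=
    Filter.eventually_of_mem ((isOpen_lt (continuous_apply 0) continuous_const).mem_nhds hx) hf
  rw [this.fderiv_eq]
  simp

lemma cj_mem_Z {t : ℝ} {f : B} (hf : f ∈ Z t) : cj f ∈ Z t := fun x hx => by simp [hf x hx]

lemma J_mem_Z {t : ℝ} {v : Fin 3} (hv : v ≠ 0) {f : B} (hf : f ∈ Z t) : J v f ∈ Z t := by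
  intro x hx
  rw [J_val]
  have : ∀ s : ℝ, f.1 (x + s • ev v) = 0 := fun s => hf _ (by simpa [ev, hv.symm] using hx)
  simp [this]

lemma Mn_mem_Z {t : ℝ} {v : Fin 3} (hv : v ≠ 0) {f : B} (hf : f ∈ Z t) : Mn v f ∈ Z t := by
  intro x hx
  rw [Mn_val]
  have : ∀ s : ℝ, f.1 (x + s • ev v) = 0 := fun s => hf _ (by simpa [ev, hv.symm] using hx)
  simp [this]

/-! ### Mollification -/

/-- Smooth compactly supported kernels. -/
def IsKer (k : Pt → ℝ) : Prop := ContDiff ℝ ∞ k ∧ HasCompactSupport k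

lemma IsKer.integrable {k : Pt → ℝ} (hk : IsKer k) : Integrable k :=
  hk.1.continuous.integrable_of_hasCompactSupport hk.2

lemma measurable_scale (a : ℝ) : Measurable fun y : Pt => -(a • y) :=
  (measurable_id.const_smul a).neg

/-- Convolution at scale `a`. -/
def mol {k : Pt → ℝ} (hk : IsKer k) (a : ℝ) : B →ₗ[ℂ] B :=
  avg hk.integrable (measurable_scale a)

lemma IsKer.deriv {k : Pt → ℝ} (hk : IsKer k) (v : Fin 3) :
    IsKer fun x => fderiv ℝ k x (ev v) :=
  ⟨(hk.1.fderiv_right (m := ∞) (by simp)).clm_apply contDiff_const,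
    hk.2.fderiv_apply (𝕜 := ℝ) (v := ev v)⟩

lemma D_mol {k : Pt → ℝ} (hk : IsKer k) (a : ℝ) (f : B) (v : Fin 3) :
    (a : ℂ) • D v (mol hk a f) = mol (hk.deriv v) a f := by
  ext x
  rw [B.smul_val, mol, mol, D_avg, avg_val, avg_val, ← integral_const_mul]
  have hg : ∀ y : Pt, HasFDerivAt (fun y : Pt => f.1 (x + -(a • y)))
      ((fderiv ℝ f.1 (x + -(a • y))).comp (-(a • ContinuousLinearMap.id ℝ Pt))) y := by
    intro y
    exact (B.differentiable f _).hasFDerivAt.comp y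
      ((((hasFDerivAt_id y).const_smul a).neg).const_add x)
  have hk1 : ∀ y, HasFDerivAt (fun y => (k y : ℂ)) (Complex.ofRealCLM.comp (fderiv ℝ k y)) y :=
    fun y => Complex.ofRealCLM.hasFDerivAt.comp y
      (hk.1.differentiable (by simp) y).hasFDerivAt
  have h := integral_bilinear_hasLineDerivAt_right_eq_neg_left_of_integrable
    (μ := (volume : Measure Pt)) (B := ContinuousLinearMap.mul ℝ ℂ) (v := ev v)
    (f := fun y => (k y : ℂ)) (f' := fun y => ((fderiv ℝ k y (ev v) : ℝ) : ℂ))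
    (g := fun y => f.1 (x + -(a • y))) (g' := fun y => -(a : ℂ) * (D v f).1 (x + -(a • y)))
    (integrable_avg (hk.deriv v).integrable (measurable_scale a) f x)
    (((integrable_avg hk.integrable (measurable_scale a) (D v f) x).const_mul (-(a : ℂ))).congr
      (Filter.Eventually.of_forall fun y => by simp; ring))
    (integrable_avg hk.integrable (measurable_scale a) f x)
    (fun y _ => (hk1 y).hasLineDerivAt (ev v))
    (fun y _ => by simpa [D_val] using (hg y).hasLineDerivAt (ev v))
  simp only [ContinuousLinearMap.mul_apply'] at h
  rw [← neg_eq_iff_eq_neg.2 h.symm.symm, ← integral_neg]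
  congr 1
  funext y
  ring

lemma mol_mem_Z {k : Pt → ℝ} (hk : IsKer k) {a t : ℝ} {f : B} (ha : 0 ≤ a) (hf : f ∈ Z t)
    (hk1 : ∀ y, 1 ≤ ‖y‖ → k y = 0) : mol hk a f ∈ Z (t - a) := by
  intro x hx
  rw [mol, avg_val]
  refine integral_eq_zero_of_ae (Filter.Eventually.of_forall fun y => ?_)
  by_cases hy : 1 ≤ ‖y‖
  · simp [hk1 y hy]
  · have h0 := (norm_le_pi_norm y 0).trans (not_le.1 hy).le
    rw [norm_eq_abs, abs_le] at h0
    have : f.1 (x + -(a • y)) = 0 := hf _ (by simp; nlinarith)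
    simp [this]

lemma mol_bdd {k : Pt → ℝ} (hk : IsKer k) (n : ℕ) : ∃ C, 0 ≤ C ∧ ∀ a A f, 0 < a →
    (∀ x, ‖f.1 x‖ ≤ A) → Bdd n (C * A) a⁻¹ (mol hk a f) := by
  induction n generalizing k with
  | zero => exact ⟨_, integral_nonneg fun _ => abs_nonneg _,
      fun a A f _ hf => norm_avg_le hk.integrable f hf⟩
  | succ n ih =>
    choose C hC0 hC using fun v => ih (hk.deriv v)
    have hI : 0 ≤ ∫ y, |k y| := integral_nonneg fun _ => abs_nonneg _
    have hS : 0 ≤ ∑ v, C v := Finset.sum_nonneg fun v _ => hC0 v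
    refine ⟨(∫ y, |k y|) + ∑ v, C v, by positivity, fun a A f ha hf => ?_⟩
    have hA : 0 ≤ A := (norm_nonneg _).trans (hf 0)
    refine ⟨fun x => (norm_avg_le hk.integrable f hf x).trans
      (mul_le_mul_of_nonneg_right (by linarith) hA), fun v => ?_⟩
    have h1 : D v (mol hk a f) = (a : ℂ)⁻¹ • mol (hk.deriv v) a f := by
      rw [← D_mol, smul_smul, inv_mul_cancel₀ (by exact_mod_cast ha.ne'), one_smul]
    rw [h1]
    refine ((hC v a A f ha hf).smul (a : ℂ)⁻¹).mono ?_ (by positivity) le_rfl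
    rw [norm_inv, Complex.norm_real, norm_of_nonneg ha.le, mul_comm]
    refine mul_le_mul_of_nonneg_right (mul_le_mul_of_nonneg_right ?_ hA) (by positivity)
    have := Finset.single_le_sum (fun v _ => hC0 v) (Finset.mem_univ v)
    linarith

/-- The standard bump. -/
def bump : ContDiffBump (0 : Pt) := ⟨1 / 2, 1, by norm_num, by norm_num⟩

/-- The standard mollifying kernel. -/
def eta : Pt → ℝ := bump.normed volume

lemma isKer_eta : IsKer eta := ⟨bump.contDiff_normed, bump.hasCompactSupport_normed⟩

lemma eta_nonneg (y : Pt) : 0 ≤ eta y := bump.nonneg_normed y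

lemma eta_integral : ∫ y, eta y = 1 := bump.integral_normed

lemma eta_zero (y : Pt) (hy : 1 ≤ ‖y‖) : eta y = 0 := by
  have h := bump.support_normed_eq (μ := (volume : Measure Pt))
  by_contra h1
  have : y ∈ Function.support (bump.normed volume) := h1
  rw [h] at this
  simp [bump] at this
  linarith

/-- Mollification at scale `a`. -/
def Mo (a : ℝ) : Module.End ℂ B := mol isKer_eta a

/-- Mollification error. -/
def Er (a : ℝ) : Module.End ℂ B := 1 - Mo a

/-- The order of the mollification, and of the time expansion of the phases. -/
def ord : ℕ := (⟨300, rfl⟩ : ∃ n : ℕ, n = 300).choose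

lemma ord_eq : ord = 300 := (⟨300, rfl⟩ : ∃ n : ℕ, n = 300).choose_spec

/-- High order mollification. -/
def Tm (a : ℝ) : Module.End ℂ B := 1 - Er a ^ ord

lemma Mo_bdd {n : ℕ} {a A l : ℝ} {f : B} (hf : Bdd n A l f) : Bdd n A l (Mo a f) := by
  have h := hf.avg isKer_eta.integrable (measurable_scale a)
  simp only [abs_of_nonneg (eta_nonneg _), eta_integral, one_mul] at h
  exact h

lemma D_Mo (a : ℝ) (v : Fin 3) (f : B) : D v (Mo a f) = Mo a (D v f) :=
  D_avg isKer_eta.integrable (measurable_scale a) f v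

lemma Er_apply (a : ℝ) (f : B) : Er a f = f - Mo a f := rfl

lemma D_Er (a : ℝ) (v : Fin 3) (f : B) : D v (Er a f) = Er a (D v f) := by
  rw [Er_apply, map_sub, D_Mo, Er_apply]

lemma D_Er_pow (a : ℝ) (v : Fin 3) (m : ℕ) (f : B) : D v ((Er a ^ m) f) = (Er a ^ m) (D v f) := by
  induction m with
  | zero => rfl
  | succ m ih => rw [pow_succ', Module.End.mul_apply, Module.End.mul_apply, D_Er, ih]

lemma Tm_apply (a : ℝ) (f : B) : Tm a f = f - (Er a ^ ord) f := rfl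

lemma D_Tm (a : ℝ) (v : Fin 3) (f : B) : D v (Tm a f) = Tm a (D v f) := by
  rw [Tm_apply, map_sub, D_Er_pow, Tm_apply]

lemma cj_Er_pow (a : ℝ) (m : ℕ) (f : B) : cj ((Er a ^ m) f) = (Er a ^ m) (cj f) := by
  induction m with
  | zero => rfl
  | succ m ih =>
    rw [pow_succ', Module.End.mul_apply, Module.End.mul_apply, Er_apply, map_sub, ih]
    congr 1
    rw [← ih]
    exact cj_avg isKer_eta.integrable (measurable_scale a) _

lemma cj_Tm (a : ℝ) (f : B) : cj (Tm a f) = Tm a (cj f) := by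
  rw [Tm_apply, map_sub, cj_Er_pow, Tm_apply]

lemma Er_pow_mem_Z {a t : ℝ} (ha : 0 ≤ a) (m : ℕ) {f : B} (hf : f ∈ Z t) :
    (Er a ^ m) f ∈ Z (t - m * a) := by
  induction m with
  | zero => simpa using hf
  | succ m ih =>
    rw [pow_succ', Module.End.mul_apply, Er_apply]
    refine Ideal.sub_mem _ (Z_anti ?_ ih) (Z_anti ?_ (mol_mem_Z _ ha ih eta_zero)) <;>
    · push_cast; nlinarith

lemma Tm_mem_Z {a t : ℝ} (ha : 0 ≤ a) {f : B} (hf : f ∈ Z t) : Tm a f ∈ Z (t - ord * a) := by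
  rw [Tm_apply]
  refine Ideal.sub_mem _ (Z_anti (by have : 0 ≤ (ord : ℝ) * a := by positivity
                                     linarith) hf) ?_
  simpa using Er_pow_mem_Z ha ord hf

lemma Bdd.translate {n : ℕ} {A l : ℝ} {f : B} (hf : Bdd (n + 1) A l f) (x h : Pt) :
    ‖f.1 (x + h) - f.1 x‖ ≤ 3 * (A * l) * ‖h‖ := by
  refine (Convex.norm_image_sub_le_of_norm_fderiv_le (𝕜 := ℝ) (s := Set.univ) (f := f.1)
    (C := 3 * (A * l))
    (fun z _ => B.differentiable f z) (fun z _ => ?_) convex_univ trivial trivial).trans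
    (by simp)
  refine ContinuousLinearMap.opNorm_le_bound _
    (by have := (hf.2 0).nonneg; positivity) fun h => ?_
  rw [fderiv_apply, show 3 * (A * l) * ‖h‖ = ∑ _v : Fin 3, ‖h‖ * (A * l) by simp; ring]
  refine norm_sum_le_of_le _ fun v _ => ?_
  rw [norm_mul, Complex.norm_real]
  exact mul_le_mul (norm_le_pi_norm h v) ((hf.2 v).sup z) (norm_nonneg _) (norm_nonneg _)

lemma Er_sup {n : ℕ} {a A l : ℝ} (ha : 0 ≤ a) {f : B} (hf : Bdd (n + 1) A l f) (x : Pt) :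
    ‖(Er a f).1 x‖ ≤ 3 * a * l * A := by
  have h1 : (Er a f).1 x = ∫ y, (eta y : ℂ) * (f.1 x - f.1 (x + -(a • y))) := by
    have h2 := integrable_avg isKer_eta.integrable (measurable_scale a) f x
    simp only [mul_sub]
    rw [integral_sub (f := fun y => (eta y : ℂ) * f.1 x)
      ((isKer_eta.integrable.ofReal (𝕜 := ℂ)).mul_const _) h2,
      integral_mul_const, show ∫ y, (eta y : ℂ) = 1 from
        (integral_ofReal (𝕜 := ℂ) (f := eta)).trans (by rw [eta_integral]; rfl), Er_apply, B.sub_val]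
    simp [Mo, mol, avg_val]
  have hl : 0 ≤ A * l := (hf.2 0).nonneg
  rw [h1]
  refine (norm_integral_le_of_norm_le (isKer_eta.integrable.mul_const (3 * a * l * A))
    (Filter.Eventually.of_forall fun y => ?_)).trans (by
      rw [integral_mul_const, eta_integral, one_mul])
  rw [norm_mul, Complex.norm_real, norm_of_nonneg (eta_nonneg y)]
  by_cases hy : 1 ≤ ‖y‖
  · simp [eta_zero y hy]
  · refine mul_le_mul_of_nonneg_left ?_ (eta_nonneg y)
    rw [norm_sub_rev]
    refine (hf.translate x _).trans ?_
    rw [norm_neg, norm_smul, norm_of_nonneg ha]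
    calc 3 * (A * l) * (a * ‖y‖) ≤ 3 * (A * l) * (a * 1) := by
          gcongr
          exact (not_le.1 hy).le
      _ = _ := by ring

lemma Er_bdd {n : ℕ} {a A l : ℝ} (ha : 0 ≤ a) {f : B} (hf : Bdd (n + 1) A l f) :
    Bdd n (3 * a * l * A) l (Er a f) := by
  induction n generalizing f A with
  | zero => exact Er_sup ha hf
  | succ n ih =>
    refine ⟨Er_sup ha hf, fun v => ?_⟩
    rw [D_Er]
    have := ih (hf.2 v)
    rwa [← mul_assoc] at this

lemma Er_pow_bdd {n : ℕ} {a A l : ℝ} (ha : 0 ≤ a) (m : ℕ) {f : B} (hf : Bdd (n + m) A l f) :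
    Bdd n ((3 * a * l) ^ m * A) l ((Er a ^ m) f) := by
  induction m generalizing n with
  | zero => simpa using hf
  | succ m ih =>
    rw [pow_succ' (3 * a * l), mul_assoc, pow_succ', Module.End.mul_apply]
    exact Er_bdd ha (ih (by rwa [Nat.add_right_comm]))

lemma Tm_bdd (n : ℕ) : ∃ C, 0 ≤ C ∧ ∀ a A f, 0 < a → (∀ x, ‖f.1 x‖ ≤ A) →
    Bdd n (C * A) a⁻¹ (Tm a f) := by
  obtain ⟨C, hC0, hC⟩ := mol_bdd isKer_eta n
  refine ⟨C * 2 ^ ord, by positivity, fun a A f ha hf => ?_⟩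
  have h1 : Tm a = Mo a * ∑ i ∈ Finset.range ord, Er a ^ i := by
    have := mul_neg_geom_sum (Er a) ord
    rw [Tm, ← this, show 1 - Er a = Mo a from LinearMap.ext fun g => by simp [Er]]
  have h2 : ∀ i, ∀ x, ‖((Er a ^ i) f).1 x‖ ≤ 2 ^ i * A := by
    intro i
    induction i with
    | zero => simpa using hf
    | succ i ih =>
      intro x
      have h3 : Bdd 0 (2 ^ i * A) 1 ((Er a ^ i) f) := ih
      rw [pow_succ', Module.End.mul_apply, Er_apply]
      refine ((h3.sub (Mo_bdd h3)).sup x).trans (le_of_eq (by ring))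
  have h4 : ∀ x, ‖((∑ i ∈ Finset.range ord, Er a ^ i) f).1 x‖ ≤ 2 ^ ord * A := by
    intro x
    have hA : 0 ≤ A := (norm_nonneg _).trans (hf 0)
    rw [LinearMap.sum_apply, B.sum_val]
    refine (norm_sum_le_of_le _ fun i _ => h2 i x).trans ?_
    rw [← Finset.sum_mul]
    refine mul_le_mul_of_nonneg_right ?_ hA
    have := geom_sum_eq (x := (2 : ℝ)) (by norm_num) ord
    rw [this]
    norm_num
  rw [h1, Module.End.mul_apply, mul_assoc]
  exact hC a _ _ ha h4

/-! ### Complex derivatives -/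

/-- The derivative `∂`. -/
def dz : Derivation ℂ B B := (1 / 2 : ℂ) • (D 1 - Complex.I • D 2)

/-- The derivative `∂̄`. -/
def db : Derivation ℂ B B := (1 / 2 : ℂ) • (D 1 + Complex.I • D 2)

lemma dz_apply (f : B) : dz f = (1 / 2 : ℂ) • (D 1 f - Complex.I • D 2 f) := rfl
lemma db_apply (f : B) : db f = (1 / 2 : ℂ) • (D 1 f + Complex.I • D 2 f) := rfl

lemma D_dz (v : Fin 3) (f : B) : D v (dz f) = dz (D v f) := by
  simp only [dz_apply, Derivation.map_smul, map_sub, D_comm v]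

lemma D_db (v : Fin 3) (f : B) : D v (db f) = db (D v f) := by
  simp only [db_apply, Derivation.map_smul, map_add, D_comm v]

lemma dz_db (f : B) : dz (db f) = db (dz f) := by
  rw [dz_apply, D_db, D_db, db_apply (dz f), D_dz, D_dz, dz_apply (D 1 f), dz_apply (D 2 f),
    db_apply (D 1 f), db_apply (D 2 f), D_comm 2 1]
  ext x
  simp
  ring

lemma cj_dz (f : B) : cj (dz f) = db (cj f) := by
  rw [dz_apply, db_apply, cj_smul, map_sub, cj_smul, cj_D, cj_D]
  ext x
  simp

lemma cj_db (f : B) : cj (db f) = dz (cj f) := by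
  rw [← cj_cj (dz (cj f)), cj_dz, cj_cj]

lemma dz_mem_Z {t : ℝ} {f : B} (hf : f ∈ Z t) : dz f ∈ Z t :=
  csmul_mem_Z _ (Ideal.sub_mem _ (D_mem_Z 1 hf) (csmul_mem_Z _ (D_mem_Z 2 hf)))

lemma db_mem_Z {t : ℝ} {f : B} (hf : f ∈ Z t) : db f ∈ Z t :=
  csmul_mem_Z _ (Ideal.add_mem _ (D_mem_Z 1 hf) (csmul_mem_Z _ (D_mem_Z 2 hf)))

/-! ### An antidivergence -/

lemma Bdd.J {n : ℕ} {A l : ℝ} {f : B} (v : Fin 3) (hl : 0 ≤ l) (hf : Bdd n A l f) :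
    Bdd n (4 * A) l (J v f) := by
  refine (hf.avg (continuous_id.div_const _).integrableOn_Ioc
    (continuous_smul_ev v).measurable).mono ?_ hl le_rfl
  refine mul_le_mul_of_nonneg_right ?_ hf.nonneg
  rw [← intervalIntegral.integral_of_le two_pi_pos.le]
  have : ∀ s ∈ Set.uIcc 0 (2 * π), |id s / (2 * π)| = s / (2 * π) := fun s hs => by
    rw [Set.uIcc_of_le two_pi_pos.le] at hs
    exact abs_of_nonneg (div_nonneg hs.1 two_pi_pos.le)
  rw [intervalIntegral.integral_congr this, intervalIntegral.integral_div, integral_id]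
  have hp := pi_pos
  have : ((2 * π) ^ 2 - 0 ^ 2) / 2 / (2 * π) = π := by field_simp; ring
  rw [this]
  exact pi_le_four

lemma Bdd.Mn {n : ℕ} {A l : ℝ} {f : B} (v : Fin 3) (hl : 0 ≤ l) (hf : Bdd n A l f) :
    Bdd n A l (Mn v f) := by
  refine (hf.avg (w := fun _ => 1 / (2 * π)) (continuous_const.integrableOn_Ioc)
    (continuous_smul_ev v).measurable).mono ?_ hl le_rfl
  refine mul_le_of_le_one_left hf.nonneg ?_
  rw [← intervalIntegral.integral_of_le two_pi_pos.le, intervalIntegral.integral_const,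
    abs_of_pos (by positivity)]
  have hp := pi_pos
  simp
  field_simp
  rfl

/-- Real part. -/
def re (f : B) : B := (1 / 2 : ℂ) • (f + cj f)

/-- Imaginary part. -/
def im (f : B) : B := (-Complex.I / 2) • (f - cj f)

lemma cj_re (f : B) : cj (re f) = re f := by rw [re, cj_smul, map_add, cj_cj, add_comm]; simp

lemma cj_im (f : B) : cj (im f) = im f := by
  rw [im, cj_smul, map_sub, cj_cj]
  ext x
  simp
  ring

lemma re_add_im (f : B) : re f + Complex.I • im f = f := by
  ext x
  simp [re, im]
  ring_nf
  simp
  ring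

lemma Bdd.re {n : ℕ} {A l : ℝ} {f : B} (hf : Bdd n A l f) : Bdd n A l (re f) := by
  have h := (hf.add hf.cj).smul (1 / 2)
  rw [show ‖(1 / 2 : ℂ)‖ * (A + A) = A by simp; ring] at h
  exact h

lemma Bdd.im {n : ℕ} {A l : ℝ} {f : B} (hf : Bdd n A l f) : Bdd n A l (im f) := by
  have h := (hf.sub hf.cj).smul (-Complex.I / 2)
  rw [show ‖(-Complex.I / 2 : ℂ)‖ * (A + A) = A by simp; ring] at h
  exact h

lemma re_mem_Z {t : ℝ} {f : B} (hf : f ∈ Z t) : re f ∈ Z t :=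
  csmul_mem_Z _ (Ideal.add_mem _ hf (cj_mem_Z hf))

lemma im_mem_Z {t : ℝ} {f : B} (hf : f ∈ Z t) : im f ∈ Z t :=
  csmul_mem_Z _ (Ideal.sub_mem _ hf (cj_mem_Z hf))

/-- Off-diagonal entry of the symmetric antidivergence. -/
def S12 (f : B) : B := J 2 (Mn 1 (re f)) + J 1 (Mn 2 (im f))

/-- Trace-free part of the antidivergence. -/
def RS (f : B) : B := J 1 (re f) - J 2 (im f) + (2 * Complex.I) • S12 f

/-- Trace part of the antidivergence. -/
def PS (f : B) : B := (1 / 2 : ℂ) • (J 1 (re f) + J 2 (im f))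

lemma Mn_comm (f : B) : Mn 1 (Mn 2 f) = Mn 2 (Mn 1 f) := by
  ext x
  rw [Mn_val, Mn_val]
  simp only [Mn_val, intervalIntegral.integral_const_mul]
  rw [intervalIntegral.integral_of_le two_pi_pos.le, intervalIntegral.integral_of_le two_pi_pos.le]
  simp only [intervalIntegral.integral_of_le two_pi_pos.le]
  rw [integral_integral_swap]
  · simp only [add_right_comm x]
  · obtain ⟨C, hC⟩ := B.bounded f
    refine Integrable.of_bound (C := C) ?_ (Filter.Eventually.of_forall fun p => hC _)
    refine Continuous.aestronglyMeasurable ?_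
    exact (B.continuous f).comp ((continuous_const.add
      ((continuous_smul_ev 1).comp continuous_fst)).add
      ((continuous_smul_ev 2).comp continuous_snd))

lemma antidiv (f : B) (hf : Mn 1 (Mn 2 f) = 0) : dz (RS f) + (2 : ℂ) • db (PS f) = f := by
  have hcj : Mn 1 (Mn 2 (cj f)) = 0 := by rw [← cj_Mn, ← cj_Mn, hf, map_zero]
  have hre : Mn 2 (Mn 1 (re f)) = 0 := by
    rw [← Mn_comm, re, map_smul, map_smul, map_add, map_add, hf, hcj]; simp
  have him : Mn 1 (Mn 2 (im f)) = 0 := by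
    rw [im, map_smul, map_smul, map_sub, map_sub, hf, hcj]; simp
  have a1 : D 1 (J 1 (re f)) = re f - Mn 1 (re f) := by rw [D_J, J_D_self (by decide)]
  have a2 : D 2 (J 2 (im f)) = im f - Mn 2 (im f) := by rw [D_J, J_D_self (by decide)]
  have a3 : D 2 (J 2 (Mn 1 (re f))) = Mn 1 (re f) := by
    rw [D_J, J_D_self (by decide), hre, sub_zero]
  have a4 : D 1 (J 1 (Mn 2 (im f))) = Mn 2 (im f) := by
    rw [D_J, J_D_self (by decide), him, sub_zero]
  have a5 : D 1 (J 2 (Mn 1 (re f))) = 0 := by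
    rw [D_J, D_Mn, Mn_D_self (by decide), map_zero]
  have a6 : D 2 (J 1 (Mn 2 (im f))) = 0 := by
    rw [D_J, D_Mn, Mn_D_self (by decide), map_zero]
  conv_rhs => rw [← re_add_im f]
  rw [dz_apply, db_apply, RS, PS, S12]
  simp only [map_add, map_sub, Derivation.map_smul, a1, a2, a3, a4, a5, a6]
  ext x
  simp
  linear_combination (-(Mn 1 (re f)).1 x) * Complex.I_sq

lemma Bdd.S12 {n : ℕ} {A l : ℝ} {f : B} (hl : 0 ≤ l) (hf : Bdd n A l f) :
    Bdd n (8 * A) l (S12 f) :=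
  (((hf.re.Mn 1 hl).J 2 hl).add ((hf.im.Mn 2 hl).J 1 hl)).mono (by linarith) hl le_rfl

lemma Bdd.RS {n : ℕ} {A l : ℝ} {f : B} (hl : 0 ≤ l) (hf : Bdd n A l f) :
    Bdd n (24 * A) l (RS f) := by
  refine (((hf.re.J 1 hl).sub (hf.im.J 2 hl)).add ((hf.S12 hl).smul (2 * Complex.I))).mono
    (le_of_eq ?_) hl le_rfl
  simp
  ring

lemma Bdd.PS {n : ℕ} {A l : ℝ} {f : B} (hl : 0 ≤ l) (hf : Bdd n A l f) :
    Bdd n (4 * A) l (PS f) := by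
  refine (((hf.re.J 1 hl).add (hf.im.J 2 hl)).smul (1 / 2)).mono (le_of_eq ?_) hl le_rfl
  simp
  ring

lemma cj_PS (f : B) : cj (PS f) = PS f := by
  rw [PS, cj_smul, map_add, cj_J, cj_J, cj_re, cj_im]
  simp

lemma RS_mem_Z {t : ℝ} {f : B} (hf : f ∈ Z t) : RS f ∈ Z t :=
  Ideal.add_mem _ (Ideal.sub_mem _ (J_mem_Z (by decide) (re_mem_Z hf))
    (J_mem_Z (by decide) (im_mem_Z hf)))
    (csmul_mem_Z _ (Ideal.add_mem _ (J_mem_Z (by decide) (Mn_mem_Z (by decide) (re_mem_Z hf)))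
      (J_mem_Z (by decide) (Mn_mem_Z (by decide) (im_mem_Z hf)))))

/-! ### Exponentials and plane waves -/

lemma BD_exp (n : ℕ) (f : B) : BD n (fun x => Complex.exp (f.1 x)) := by
  have hd : ∀ x, HasFDerivAt (fun x => Complex.exp (f.1 x))
      (Complex.exp (f.1 x) • fderiv ℝ f.1 x) x :=
    fun x => (B.differentiable f x).hasFDerivAt.cexp
  have h0 : BD0 (fun x => Complex.exp (f.1 x)) := by
    obtain ⟨C, hC⟩ := B.bounded f
    refine ⟨(B.continuous f).cexp, ⟨Real.exp C, fun x => ?_⟩, fun v hv x => by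
      simp only [B.periodic f hv]⟩
    rw [Complex.norm_exp]
    exact Real.exp_le_exp.2 ((Complex.re_le_norm _).trans (hC x))
  induction n with
  | zero => exact h0
  | succ n ih =>
    refine ⟨h0, fun x => (hd x).differentiableAt, fun v => ?_⟩
    convert ((D v f).2 n).mul ih using 2 with x
    rw [(hd x).fderiv, D_val]
    simp [mul_comm]

/-- Exponential of a function. -/
def expB (f : B) : B := ⟨_, fun n => BD_exp n f⟩

lemma expB_val (f : B) (x : Pt) : (expB f).1 x = Complex.exp (f.1 x) := rfl

lemma D_expB (v : Fin 3) (f : B) : D v (expB f) = D v f * expB f := by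
  ext x
  rw [D_val, B.mul_val, D_val]
  change fderiv ℝ (fun x => Complex.exp (f.1 x)) x (ev v) = _
  rw [((B.differentiable f x).hasFDerivAt.cexp).fderiv, expB_val]
  simp [mul_comm]

lemma expB_add (f g : B) : expB (f + g) = expB f * expB g := by
  ext x; simp [expB_val, Complex.exp_add]

lemma expB_zero : expB 0 = 1 := by ext x; simp [expB_val]

lemma cj_expB (f : B) : cj (expB f) = expB (cj f) := by
  ext x; simp [expB_val, Complex.exp_conj]

/-- The phase of a plane wave. -/
def phase (a b : ℝ) : Pt →L[ℝ] ℂ :=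
  Complex.I • Complex.ofRealCLM.comp
    (a • ContinuousLinearMap.proj (R := ℝ) (φ := fun _ : Fin 3 => ℝ) 1 +
      b • ContinuousLinearMap.proj (R := ℝ) (φ := fun _ : Fin 3 => ℝ) 2)

lemma phase_apply (a b : ℝ) (x : Pt) : phase a b x = Complex.I * (a * x 1 + b * x 2) := by
  simp [phase, mul_add]

lemma BD_planeWave (n : ℕ) (a b : ℤ) : BD n (fun x => Complex.exp (phase a b x)) := by
  have hd : ∀ x, HasFDerivAt (fun x => Complex.exp (phase a b x))
      (Complex.exp (phase a b x) • phase a b) x :=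
    fun x => (phase a b).hasFDerivAt.cexp
  have h0 : BD0 (fun x => Complex.exp (phase a b x)) := by
    refine ⟨(phase a b).continuous.cexp, ⟨1, fun x => ?_⟩, fun v hv x => ?_⟩
    · rw [Complex.norm_exp, phase_apply]
      simp
    · rw [Complex.exp_eq_exp_iff_exists_int]
      fin_cases v
      · exact absurd rfl hv
      · refine ⟨a, ?_⟩
        simp [phase_apply, ev]
        ring
      · refine ⟨b, ?_⟩
        simp [phase_apply, ev]
        ring
  induction n with
  | zero => exact h0
  | succ n ih =>
    refine ⟨h0, fun x => (hd x).differentiableAt, fun v => ?_⟩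
    convert (BD.const n (phase a b (ev v))).mul ih using 2 with x
    rw [(hd x).fderiv]
    simp [mul_comm]

/-- The plane wave with integer frequency `(a, b)`. -/
def planeWave (a b : ℤ) : B := ⟨_, fun n => BD_planeWave n a b⟩

lemma planeWave_val (a b : ℤ) (x : Pt) :
    (planeWave a b).1 x = Complex.exp (Complex.I * (a * x 1 + b * x 2)) := by
  change Complex.exp (phase a b x) = _
  rw [phase_apply]
  simp

lemma D_planeWave (v : Fin 3) (a b : ℤ) :
    D v (planeWave a b) = (phase a b (ev v)) • planeWave a b := by
  ext x
  rw [D_val]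
  change fderiv ℝ (fun x => Complex.exp (phase a b x)) x (ev v) = _
  rw [((phase a b).hasFDerivAt.cexp).fderiv, B.smul_val]
  simp [mul_comm]
  left; rfl

lemma D_planeWave_zero (a b : ℤ) : D 0 (planeWave a b) = 0 := by
  rw [D_planeWave]; simp [phase_apply, ev]

lemma D_planeWave_one (a b : ℤ) : D 1 (planeWave a b) = (Complex.I * a) • planeWave a b := by
  rw [D_planeWave]; simp [phase_apply, ev]

lemma D_planeWave_two (a b : ℤ) : D 2 (planeWave a b) = (Complex.I * b) • planeWave a b := by
  rw [D_planeWave]; simp [phase_apply, ev]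

lemma planeWave_add (a b c d : ℤ) :
    planeWave (a + c) (b + d) = planeWave a b * planeWave c d := by
  ext x
  rw [B.mul_val, planeWave_val, planeWave_val, planeWave_val, ← Complex.exp_add]
  push_cast
  ring_nf

lemma planeWave_zero : planeWave 0 0 = 1 := by ext x; simp [planeWave_val]

lemma cj_planeWave (a b : ℤ) : cj (planeWave a b) = planeWave (-a) (-b) := by
  ext x
  rw [cj_val, planeWave_val, planeWave_val, RCLike.star_def, ← Complex.exp_conj]
  simp
  ring_nf

/-! ### Functions of time -/

/-- Smooth functions on the line with all derivatives bounded. -/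
def BT (f : ℝ → ℝ) : Prop := ContDiff ℝ ∞ f ∧ ∀ n, ∃ C, ∀ t, |iteratedDeriv n f t| ≤ C

lemma BT.deriv {f : ℝ → ℝ} (hf : BT f) : BT (deriv f) :=
  ⟨(contDiff_infty_iff_deriv.1 hf.1).2, fun n => by simpa [iteratedDeriv_succ'] using hf.2 (n + 1)⟩

lemma BT.of_periodic {f : ℝ → ℝ} (hf : ContDiff ℝ ∞ f) (hp : Function.Periodic f 1) : BT f := by
  refine ⟨hf, fun n => ?_⟩
  have hc : Continuous (iteratedDeriv n f) := hf.continuous_iteratedDeriv n (by exact_mod_cast le_top)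
  have hq : Function.Periodic (iteratedDeriv n f) 1 := by
    intro x
    have := congrFun (iteratedDeriv_comp_add_const n f 1) x
    rw [← this]
    congr 1
    exact funext hp
  obtain ⟨C, hC⟩ := (hq.compact_of_continuous one_ne_zero hc).isBounded.exists_norm_le
  exact ⟨C, fun t => hC _ ⟨t, rfl⟩⟩

lemma BT.comp_add {f : ℝ → ℝ} (hf : BT f) (a : ℝ) : BT fun t => f (t + a) := by
  refine ⟨hf.1.comp (contDiff_id.add contDiff_const), fun n => ?_⟩
  obtain ⟨C, hC⟩ := hf.2 n
  exact ⟨C, fun t => by rw [iteratedDeriv_comp_add_const]; exact hC _⟩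

lemma BD_time (n : ℕ) {f : ℝ → ℝ} (hf : BT f) (a b : ℝ) :
    BD n (fun x => ((f (a * x 0 + b) : ℝ) : ℂ)) := by
  have hd : ∀ f : ℝ → ℝ, BT f → ∀ x : Pt, HasFDerivAt (fun x : Pt => ((f (a * x 0 + b) : ℝ) : ℂ))
      (Complex.ofRealCLM.comp ((deriv f (a * x 0 + b)) •
        (a • ContinuousLinearMap.proj (R := ℝ) (φ := fun _ : Fin 3 => ℝ) 0))) x := by
    intro f hf x
    have h1 : HasFDerivAt (fun x : Pt => a * x 0 + b)
        (a • ContinuousLinearMap.proj (R := ℝ) (φ := fun _ : Fin 3 => ℝ) 0) x :=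
      ((hasFDerivAt_apply 0 x).const_mul a).add_const b
    exact Complex.ofRealCLM.hasFDerivAt.comp x
      (((hf.1.differentiable (by simp) _).hasDerivAt).comp_hasFDerivAt x h1)
  have h0 : ∀ f : ℝ → ℝ, BT f → BD0 (fun x => ((f (a * x 0 + b) : ℝ) : ℂ)) := by
    intro f hf
    obtain ⟨C, hC⟩ := hf.2 0
    refine ⟨continuous_iff_continuousAt.2 fun x => (hd f hf x).continuousAt,
      ⟨C, fun x => by simpa using hC _⟩, fun v hv x => by simp [ev, hv.symm]⟩
  induction n generalizing f with
  | zero => exact h0 f hf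
  | succ n ih =>
    refine ⟨h0 f hf, fun x => (hd f hf x).differentiableAt, fun v => ?_⟩
    convert (BD.const n ((a * (ev v 0) : ℝ) : ℂ)).mul (ih hf.deriv) using 2 with x
    rw [(hd f hf x).fderiv]
    simp
    ring

/-- A rescaled function of time. -/
def timeB {f : ℝ → ℝ} (hf : BT f) (a b : ℝ) : B := ⟨_, fun n => BD_time n hf a b⟩

lemma timeB_val {f : ℝ → ℝ} (hf : BT f) (a b : ℝ) (x : Pt) :
    (timeB hf a b).1 x = ((f (a * x 0 + b) : ℝ) : ℂ) := rfl

lemma D_timeB {f : ℝ → ℝ} (hf : BT f) (a b : ℝ) (v : Fin 3) :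
    D v (timeB hf a b) = ((a * (ev v 0) : ℝ) : ℂ) • timeB hf.deriv a b := by
  ext x
  have h1 : HasFDerivAt (fun x : Pt => a * x 0 + b)
      (a • ContinuousLinearMap.proj (R := ℝ) (φ := fun _ : Fin 3 => ℝ) 0) x :=
    ((hasFDerivAt_apply 0 x).const_mul a).add_const b
  have h2 : HasFDerivAt (fun x : Pt => ((f (a * x 0 + b) : ℝ) : ℂ)) _ x :=
    Complex.ofRealCLM.hasFDerivAt.comp x
      (((hf.1.differentiable (by simp) _).hasDerivAt).comp_hasFDerivAt x h1)
  rw [D_val]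
  change fderiv ℝ (fun x : Pt => ((f (a * x 0 + b) : ℝ) : ℂ)) x (ev v) = _
  rw [h2.fderiv, B.smul_val, timeB_val]
  simp
  ring

lemma D_timeB_zero {f : ℝ → ℝ} (hf : BT f) (a b : ℝ) :
    D 0 (timeB hf a b) = (a : ℂ) • timeB hf.deriv a b := by
  rw [D_timeB]; simp [ev]

lemma D_timeB_space {f : ℝ → ℝ} (hf : BT f) (a b : ℝ) {v : Fin 3} (hv : v ≠ 0) :
    D v (timeB hf a b) = 0 := by
  rw [D_timeB]; simp [ev, hv.symm]

lemma dz_timeB {f : ℝ → ℝ} (hf : BT f) (a b : ℝ) : dz (timeB hf a b) = 0 := by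
  rw [dz_apply, D_timeB_space _ _ _ (by decide), D_timeB_space _ _ _ (by decide)]; simp

lemma db_timeB {f : ℝ → ℝ} (hf : BT f) (a b : ℝ) : db (timeB hf a b) = 0 := by
  rw [db_apply, D_timeB_space _ _ _ (by decide), D_timeB_space _ _ _ (by decide)]; simp

lemma cj_timeB {f : ℝ → ℝ} (hf : BT f) (a b : ℝ) : cj (timeB hf a b) = timeB hf a b := by
  ext x; simp [timeB_val]

lemma timeB_bdd {f : ℝ → ℝ} (hf : BT f) (n : ℕ) : ∃ C, ∀ a b, 0 ≤ a →
    Bdd n C a (timeB hf a b) := by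
  induction n generalizing f with
  | zero =>
    obtain ⟨C, hC⟩ := hf.2 0
    exact ⟨C, fun a b _ x => by simpa [timeB_val] using hC _⟩
  | succ n ih =>
    obtain ⟨C, hC⟩ := hf.2 0
    obtain ⟨K, hK⟩ := ih hf.deriv
    have hC0 : 0 ≤ C := (abs_nonneg _).trans (hC 0)
    have hK0 : 0 ≤ K := (hK 0 0 le_rfl).nonneg
    refine ⟨C + K, fun a b ha => ⟨fun x => ?_, fun v => ?_⟩⟩
    · have : ‖(timeB hf a b).1 x‖ ≤ C := by simpa [timeB_val] using hC _
      linarith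
    · by_cases hv : v = 0
      · subst hv
        rw [D_timeB_zero]
        refine ((hK a b ha).smul a).mono ?_ ha le_rfl
        rw [Complex.norm_real, norm_of_nonneg ha, mul_comm]
        exact mul_le_mul_of_nonneg_right (by linarith) ha
      · rw [D_timeB_space _ _ _ hv]
        exact Bdd.zero (by positivity) ha

/-! ### Partition of unity in time -/

lemma cos_two_pi_periodic (t : ℝ) : cos (2 * π * (t + 1)) = cos (2 * π * t) := by
  rw [mul_add, mul_one, cos_add_two_pi]

/-- The profile of the temporal partition of unity. -/
def cutProfile (t : ℝ) : ℝ := smoothTransition (1 / 2 + 2 * cos (2 * π * t))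

lemma cutProfile_contDiff : ContDiff ℝ ∞ cutProfile :=
  smoothTransition.contDiff.comp (contDiff_const.add (contDiff_const.mul
    (contDiff_cos.comp (contDiff_const.mul contDiff_id))))

lemma cutProfile_periodic : Function.Periodic cutProfile 1 := fun t => by
  simp only [cutProfile, cos_two_pi_periodic]

lemma exists_slope : ∃ q : ℝ → ℝ, ContDiff ℝ ∞ q ∧ Function.Periodic q 1 ∧
    (∀ t, -(1 / 4) ≤ cos (2 * π * t) → q t = -1) ∧ ∫ t in (0)..1, q t = 0 := by
  set q : ℝ → ℝ := fun t => smoothTransition (-1 - 4 * cos (2 * π * t)) with hq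
  have hc : ContDiff ℝ ∞ q :=
    smoothTransition.contDiff.comp (contDiff_const.sub (contDiff_const.mul
      (contDiff_cos.comp (contDiff_const.mul contDiff_id))))
  have hI : 0 < ∫ t in (0)..1, q t := by
    refine intervalIntegral.integral_pos one_pos hc.continuous.continuousOn
      (fun t _ => smoothTransition.nonneg _) ⟨1 / 2, by norm_num, ?_⟩
    refine smoothTransition.pos_of_pos ?_
    rw [show 2 * π * (1 / 2) = π by ring, cos_pi]
    norm_num
  refine ⟨fun t => -1 + (∫ t in (0)..1, q t)⁻¹ * q t, contDiff_const.add (contDiff_const.mul hc),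
    fun t => ?_, fun t ht => ?_, ?_⟩
  · simp only [hq, cos_two_pi_periodic]
  · have : q t = 0 := smoothTransition.zero_of_nonpos (by linarith)
    simp [this]
  · have h := intervalIntegral.integral_add (μ := volume) (a := 0) (b := 1)
      (f := fun _ => (-1 : ℝ)) (g := fun t => (∫ t in (0)..1, q t)⁻¹ * q t)
      intervalIntegrable_const ((continuous_const.mul hc.continuous).intervalIntegrable _ _)
    rw [h, intervalIntegral.integral_const_mul, inv_mul_cancel₀ hI.ne']
    simp

lemma exists_clock : ∃ S : ℝ → ℝ, BT S ∧ ∀ t, -(1 / 4) < cos (2 * π * t) → deriv S t = -1 := by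
  obtain ⟨q, hq, hp, h1, h0⟩ := exists_slope
  have hd : ∀ t, HasDerivAt (fun t => ∫ s in (0)..t, q s) (q t) t := fun t =>
    intervalIntegral.integral_hasDerivAt_right (hq.continuous.intervalIntegrable _ _)
      (hq.continuous.stronglyMeasurableAtFilter _ _) hq.continuous.continuousAt
  have hd' : deriv (fun t => ∫ s in (0)..t, q s) = q := funext fun t => (hd t).deriv
  refine ⟨fun t => ∫ s in (0)..t, q s, BT.of_periodic ?_ ?_, fun t ht => ?_⟩
  · exact contDiff_infty_iff_deriv.2 ⟨fun t => (hd t).differentiableAt, by rwa [hd']⟩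
  · intro t
    have h2 := hp.intervalIntegral_add_eq t 0
    rw [zero_add, h0] at h2
    have h3 := intervalIntegral.integral_add_adjacent_intervals (μ := volume)
      (hq.continuous.intervalIntegrable 0 t) (hq.continuous.intervalIntegrable t (t + 1))
    simp only
    rw [← h3, h2, add_zero]
  · rw [hd']
    exact h1 t ht.le

lemma exists_cutoffs : ∃ X S : Fin 2 → ℝ → ℝ, (∀ g, BT (X g)) ∧ (∀ g, BT (S g)) ∧
    (∀ t, X 0 t ^ 2 + X 1 t ^ 2 = 1) ∧ ∀ g t, X g t * (1 + deriv (S g) t) = 0 := by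
  obtain ⟨S, hS, hS1⟩ := exists_clock
  have hc := (contDiff_const (c := π / 2)).mul cutProfile_contDiff
  refine ⟨![fun t => sin (π / 2 * cutProfile t), fun t => cos (π / 2 * cutProfile t)],
    ![S, fun t => S (t + 1 / 2)], ?_, ?_, ?_, ?_⟩
  · intro g
    fin_cases g
    · exact BT.of_periodic (contDiff_sin.comp hc) fun t => by simp [cutProfile_periodic t]
    · exact BT.of_periodic (contDiff_cos.comp hc) fun t => by simp [cutProfile_periodic t]
  · intro g
    fin_cases g
    · exact hS
    · exact hS.comp_add _
  · intro t
    exact sin_sq_add_cos_sq _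
  · intro g t
    fin_cases g
    · by_cases h : -(1 / 4) < cos (2 * π * t)
      · simp [hS1 t h]
      · have : cutProfile t = 0 := smoothTransition.zero_of_nonpos (by linarith)
        simp [this]
    · by_cases h : cos (2 * π * t) < 1 / 4
      · have h2 : deriv (fun t => S (t + 1 / 2)) t = -1 := by
          rw [deriv_comp_add_const]
          refine hS1 _ ?_
          rw [mul_add, show 2 * π * (1 / 2) = π by ring, cos_add_pi]
          linarith
        simp only [Fin.mk_one, Matrix.cons_val_one, Matrix.cons_val_fin_one] at h2 ⊢
        rw [h2]
        simp
      · have : cutProfile t = 1 := smoothTransition.one_of_one_le (by linarith)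
        simp [this]

/-- A smooth step. -/
def step (t : ℝ) : ℝ := smoothTransition (t + 2)

lemma step_zero {t : ℝ} (h : t ≤ -2) : step t = 0 := smoothTransition.zero_of_nonpos (by linarith)
lemma step_one {t : ℝ} (h : -1 ≤ t) : step t = 1 := smoothTransition.one_of_one_le (by linarith)

lemma step_BT : BT step := by
  have hc : ContDiff ℝ ∞ step := smoothTransition.contDiff.comp (contDiff_id.add contDiff_const)
  refine ⟨hc, fun n => ?_⟩
  cases n with
  | zero =>
    refine ⟨1, fun t => ?_⟩
    rw [iteratedDeriv_zero, step, abs_of_nonneg (smoothTransition.nonneg _)]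
    exact smoothTransition.le_one _
  | succ n =>
    have hs : HasCompactSupport (deriv step) := by
      refine HasCompactSupport.of_support_subset_isCompact (isCompact_Icc (a := -2) (b := -1)) ?_
      intro t ht
      by_contra hn
      apply ht
      rcases lt_or_ge t (-2) with h | h
      · have : step =ᶠ[nhds t] fun _ => 0 := by
          filter_upwards [Iio_mem_nhds h] with s hs
          exact step_zero (le_of_lt hs)
        rw [this.deriv_eq]; simp
      · have h' : -1 < t := by
          by_contra h'
          exact hn ⟨h, not_lt.1 h'⟩
        have : step =ᶠ[nhds t] fun _ => 1 := by
          filter_upwards [Ioi_mem_nhds h'] with s hs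
          exact step_one (le_of_lt hs)
        rw [this.deriv_eq]; simp
    have hs2 : HasCompactSupport (iteratedDeriv (n + 1) step) := by
      rw [iteratedDeriv_succ']
      clear * - hs
      generalize deriv step = f at hs
      induction n generalizing f with
      | zero => simpa using hs
      | succ n ih => rw [iteratedDeriv_succ']; exact ih _ hs.deriv
    obtain ⟨C, hC⟩ := hs2.exists_bound_of_continuous (hc.continuous_iteratedDeriv _ (by exact_mod_cast le_top))
    exact ⟨C, hC⟩

end Euler2D

namespace Euler2D

/-! ### Approximate solutions -/

/-- The complex velocity of a stream function. -/
def vel (ψ : B) : B := (2 * Complex.I) • db ψ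

/-- Approximate solutions of the planar Euler equations, with stream function `ψ`, pressure `P`
and stress `R`, oscillating at frequency at most `lam` and vanishing before time `t0`. -/
structure Good (lam t0 : ℝ) (ψ P R : B) : Prop where
  real_ψ : cj ψ = ψ
  real_P : cj P = P
  eqn : D 0 (vel ψ) + dz (vel ψ ^ 2 + R) + (2 : ℂ) • db P = 0
  sup_U : ∀ x, ‖(vel ψ).1 x‖ ≤ 1 - lam ^ (-(1 / 14) : ℝ)
  der_U : ∀ v, Bdd ord (lam ^ (6 / 7 : ℝ)) lam (D v (vel ψ))
  sup_R : ∀ x, ‖R.1 x‖ ≤ lam ^ (-(8 / 21) : ℝ)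
  der_P : ∀ v x, ‖(D v P).1 x‖ ≤ lam
  supp_ψ : ψ ∈ Z t0
  supp_R : R ∈ Z t0

/-- Approximate solutions at sufficiently high frequency. -/
structure Data where
  lam : ℝ
  t0 : ℝ
  ψ : B
  P : B
  R : B
  good : Good lam t0 ψ P R
  large : (300 : ℝ) ^ (300 : ℝ) ≤ lam

namespace Data

lemma one_le (i : Data) : 1 ≤ i.lam :=
  (one_le_rpow (by norm_num) (by norm_num)).trans i.large

lemma pos (i : Data) : 0 < i.lam := zero_lt_one.trans_le i.one_le

lemma rpow_pos (i : Data) (s : ℝ) : 0 < i.lam ^ s := Real.rpow_pos_of_pos i.pos s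

lemma rpow_le (i : Data) {s t : ℝ} (h : s ≤ t) : i.lam ^ s ≤ i.lam ^ t :=
  rpow_le_rpow_of_exponent_le i.one_le h

lemma rpow_mul_rpow (i : Data) (s t : ℝ) : i.lam ^ s * i.lam ^ t = i.lam ^ (s + t) :=
  (rpow_add i.pos s t).symm

end Data

/-- Families of functions of order `s`, each derivative of which costs `l`. -/
def Sy (s l : ℝ) (f : Data → B) : Prop :=
  ∀ n, ∃ C, ∀ i : Data, Bdd n (C * i.lam ^ s) (i.lam ^ l) (f i)

namespace Sy

variable {s t r l l' : ℝ} {f g : Data → B}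

lemma exists_nonneg (h : Sy s l f) (n : ℕ) :
    ∃ C, 0 ≤ C ∧ ∀ i : Data, Bdd n (C * i.lam ^ s) (i.lam ^ l) (f i) := by
  obtain ⟨C, hC⟩ := h n
  refine ⟨|C|, abs_nonneg _, fun i => (hC i).mono ?_ (i.rpow_pos l).le le_rfl⟩
  exact mul_le_mul_of_nonneg_right (le_abs_self _) (i.rpow_pos s).le

lemma mono (h : Sy s l f) (hs : s ≤ t) (hl : l ≤ l') : Sy t l' f := by
  intro n
  obtain ⟨C, hC0, hC⟩ := h.exists_nonneg n
  exact ⟨C, fun i => (hC i).mono (mul_le_mul_of_nonneg_left (i.rpow_le hs) hC0)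
    (i.rpow_pos l).le (i.rpow_le hl)⟩

lemma add (hf : Sy s l f) (hg : Sy s l g) : Sy s l fun i => f i + g i := by
  intro n
  obtain ⟨C, hC⟩ := hf n
  obtain ⟨K, hK⟩ := hg n
  exact ⟨C + K, fun i => by rw [add_mul]; exact (hC i).add (hK i)⟩

lemma sub (hf : Sy s l f) (hg : Sy s l g) : Sy s l fun i => f i - g i := by
  intro n
  obtain ⟨C, hC⟩ := hf n
  obtain ⟨K, hK⟩ := hg n
  exact ⟨C + K, fun i => by rw [add_mul]; exact (hC i).sub (hK i)⟩

lemma neg (hf : Sy s l f) : Sy s l fun i => -f i := fun n => by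
  obtain ⟨C, hC⟩ := hf n
  exact ⟨C, fun i => (hC i).neg⟩

lemma mul (hf : Sy s l f) (hg : Sy t l g) (h : s + t ≤ r) : Sy r l fun i => f i * g i := by
  intro n
  obtain ⟨C, hC0, hC⟩ := hf.exists_nonneg n
  obtain ⟨K, hK0, hK⟩ := hg.exists_nonneg n
  refine ⟨2 ^ n * (C * K), fun i => ((hC i).mul (i.rpow_pos l).le (hK i)).mono ?_
    (i.rpow_pos l).le le_rfl⟩
  have := i.rpow_le h
  rw [← i.rpow_mul_rpow] at this
  calc 2 ^ n * (C * i.lam ^ s * (K * i.lam ^ t))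
      = 2 ^ n * (C * K) * (i.lam ^ s * i.lam ^ t) := by ring
    _ ≤ _ := mul_le_mul_of_nonneg_left this (by positivity)

lemma smul (c : ℂ) (hf : Sy s l f) : Sy s l fun i => c • f i := fun n => by
  obtain ⟨C, hC⟩ := hf n
  exact ⟨‖c‖ * C, fun i => by rw [mul_assoc]; exact (hC i).smul c⟩

lemma smulf {c : Data → ℂ} {K : ℝ} (hc : ∀ i : Data, ‖c i‖ ≤ K * i.lam ^ t) (hf : Sy s l f)
    (h : s + t ≤ r) : Sy r l fun i => c i • f i := by
  intro n
  obtain ⟨C, hC0, hC⟩ := hf.exists_nonneg n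
  refine ⟨|K| * C, fun i => ((hC i).smul (c i)).mono ?_ (i.rpow_pos l).le le_rfl⟩
  have h1 := i.rpow_le h
  rw [← i.rpow_mul_rpow] at h1
  have h2 := i.rpow_pos s
  have h3 := i.rpow_pos t
  calc ‖c i‖ * (C * i.lam ^ s) ≤ |K| * i.lam ^ t * (C * i.lam ^ s) :=
        mul_le_mul_of_nonneg_right ((hc i).trans (mul_le_mul_of_nonneg_right (le_abs_self _)
          h3.le)) (by positivity)
    _ = |K| * C * (i.lam ^ s * i.lam ^ t) := by ring
    _ ≤ _ := mul_le_mul_of_nonneg_left h1 (by positivity)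

lemma cj (hf : Sy s l f) : Sy s l fun i => cj (f i) := fun n => by
  obtain ⟨C, hC⟩ := hf n
  exact ⟨C, fun i => (hC i).cj⟩

lemma re (hf : Sy s l f) : Sy s l fun i => re (f i) := fun n => by
  obtain ⟨C, hC⟩ := hf n
  exact ⟨C, fun i => (hC i).re⟩

lemma im (hf : Sy s l f) : Sy s l fun i => im (f i) := fun n => by
  obtain ⟨C, hC⟩ := hf n
  exact ⟨C, fun i => (hC i).im⟩

lemma D (v : Fin 3) (hf : Sy s l f) (h : s + l ≤ r) : Sy r l fun i => D v (f i) := by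
  intro n
  obtain ⟨C, hC0, hC⟩ := hf.exists_nonneg (n + 1)
  refine ⟨C, fun i => ((hC i).2 v).mono ?_ (i.rpow_pos l).le le_rfl⟩
  rw [mul_assoc, i.rpow_mul_rpow]
  exact mul_le_mul_of_nonneg_left (i.rpow_le h) hC0

lemma dz_of (h1 : Sy s l fun i => Euler2D.D 1 (f i)) (h2 : Sy s l fun i => Euler2D.D 2 (f i)) :
    Sy s l fun i => dz (f i) := (h1.sub (h2.smul _)).smul _

lemma db_of (h1 : Sy s l fun i => Euler2D.D 1 (f i)) (h2 : Sy s l fun i => Euler2D.D 2 (f i)) :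
    Sy s l fun i => db (f i) := (h1.add (h2.smul _)).smul _

lemma dz (hf : Sy s l f) (h : s + l ≤ r) : Sy r l fun i => dz (f i) :=
  dz_of (hf.D 1 h) (hf.D 2 h)

lemma db (hf : Sy s l f) (h : s + l ≤ r) : Sy r l fun i => db (f i) :=
  db_of (hf.D 1 h) (hf.D 2 h)

lemma zero : Sy s l fun _ => 0 := fun n =>
  ⟨0, fun i => by simpa using Bdd.zero le_rfl (i.rpow_pos l).le⟩

lemma one : Sy 0 l fun _ => 1 := by
  intro n
  refine ⟨1, fun i => ?_⟩
  rw [rpow_zero, mul_one]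
  cases n with
  | zero => exact fun x => by simp
  | succ n =>
    refine ⟨fun x => by simp, fun v => ?_⟩
    rw [Derivation.map_one_eq_zero]
    exact Bdd.zero (by rw [one_mul]; exact (i.rpow_pos l).le) (i.rpow_pos l).le

lemma sum {J : Type*} (S : Finset J) {f : J → Data → B} (h : ∀ j ∈ S, Sy s l (f j)) :
    Sy s l fun i => ∑ j ∈ S, f j i := by
  classical
  induction S using Finset.induction_on with
  | empty => simpa using zero
  | insert a S ha ih =>
    simp only [Finset.sum_insert ha]
    exact (h a (Finset.mem_insert_self _ _)).add
      (ih fun j hj => h j (Finset.mem_insert_of_mem hj))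

lemma expB_of (h0 : ∃ C, ∀ (i : Data) x, ‖(g i).1 x‖ ≤ C)
    {a : Fin 3 → Data → B} (ha : ∀ v, Sy l l (a v))
    (h : ∀ v i, Euler2D.D v (g i) = a v i * g i) : Sy 0 l g := by
  intro n
  induction n with
  | zero =>
    obtain ⟨C, hC⟩ := h0
    exact ⟨C, fun i x => by simpa using hC i x⟩
  | succ n ih =>
    obtain ⟨C, hC⟩ := h0
    obtain ⟨M, hM⟩ := ih
    choose K hK0 hK using fun v => (ha v).exists_nonneg n
    have hS : 0 ≤ ∑ v, K v := Finset.sum_nonneg fun v _ => hK0 v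
    refine ⟨|C| + 2 ^ n * ((∑ v, K v) * |M|), fun i => ⟨fun x => ?_, fun v => ?_⟩⟩
    · rw [rpow_zero, mul_one]
      refine (hC i x).trans ((le_abs_self C).trans (le_add_of_nonneg_right (by positivity)))
    · rw [h]
      refine ((hK v i).mul (i.rpow_pos l).le (hM i)).mono ?_ (i.rpow_pos l).le le_rfl
      have hp := i.rpow_pos l
      have := Finset.single_le_sum (fun v _ => hK0 v) (Finset.mem_univ v)
      rw [rpow_zero, mul_one, mul_one]
      calc 2 ^ n * (K v * i.lam ^ l * M) ≤ 2 ^ n * ((∑ v, K v) * i.lam ^ l * |M|) := by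
            refine mul_le_mul_of_nonneg_left ?_ (by positivity)
            refine (mul_le_mul_of_nonneg_left (le_abs_self M) ?_).trans
              (mul_le_mul_of_nonneg_right (mul_le_mul_of_nonneg_right this hp.le) (abs_nonneg _))
            exact mul_nonneg (hK0 v) hp.le
        _ = 2 ^ n * ((∑ v, K v) * |M|) * i.lam ^ l := by ring
        _ ≤ _ := mul_le_mul_of_nonneg_right (le_add_of_nonneg_left (abs_nonneg _)) hp.le

end Sy

/-! ### Mollified approximate solutions -/

namespace Data

/-- The mollification scale. -/
def ell (i : Data) : ℝ := i.lam ^ (-(301 / 300) : ℝ)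

lemma ell_pos (i : Data) : 0 < i.ell := i.rpow_pos _

lemma ell_inv (i : Data) : i.ell⁻¹ = i.lam ^ (301 / 300 : ℝ) := by
  rw [ell, rpow_neg i.pos.le, inv_inv]

/-- Velocity before mollification. -/
def U0 (i : Data) : B := vel i.ψ

/-- Mollified velocity. -/
def U (i : Data) : B := Tm i.ell i.U0

/-- Mollified stress. -/
def Rl (i : Data) : B := Tm i.ell i.R

/-- The commutator stress. -/
def comm (i : Data) : B := Tm i.ell (i.U0 ^ 2) - i.U ^ 2

end Data

lemma Tm_Sy {f : Data → B} {s K : ℝ} (h : ∀ i x, ‖(f i).1 x‖ ≤ K * i.lam ^ s) :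
    Sy s (301 / 300) fun i => Tm i.ell (f i) := by
  intro n
  obtain ⟨C, hC0, hC⟩ := Tm_bdd n
  refine ⟨C * K, fun i => ?_⟩
  rw [← i.ell_inv, mul_assoc]
  exact hC _ _ _ i.ell_pos (h i)

lemma Data.U0_sup (i : Data) (x : Pt) : ‖i.U0.1 x‖ ≤ 1 :=
  (i.good.sup_U x).trans (by linarith [i.rpow_pos (-(1 / 14))])

lemma Data.U0_bdd (i : Data) : Bdd (ord + 1) 1 i.lam i.U0 := by
  refine ⟨i.U0_sup, fun v => (i.good.der_U v).mono ?_ i.pos.le le_rfl⟩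
  rw [one_mul]
  nth_rw 2 [← rpow_one i.lam]
  exact i.rpow_le (by norm_num)

lemma U_Sy : Sy 0 (301 / 300) Data.U :=
  Tm_Sy (K := 1) fun i x => by simpa using i.U0_sup x

lemma DU_Sy (v : Fin 3) : Sy (6 / 7) (301 / 300) fun i => D v i.U := by
  have : (fun i : Data => D v i.U) = fun i : Data => Tm i.ell (D v i.U0) :=
    funext fun i => D_Tm _ _ _
  rw [this]
  exact Tm_Sy (K := 1) fun i x => by rw [one_mul]; exact (i.good.der_U v).sup x

lemma Rl_Sy : Sy (-(8 / 21)) (301 / 300) Data.Rl :=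
  Tm_Sy (K := 1) fun i x => by simpa using i.good.sup_R x

lemma Data.ell_mul (i : Data) : i.ell * i.lam = i.lam ^ (-(1 / 300) : ℝ) := by
  calc i.ell * i.lam = i.lam ^ (-(301 / 300) : ℝ) * i.lam ^ (1 : ℝ) := by rw [ell, rpow_one]
    _ = _ := by rw [i.rpow_mul_rpow]; norm_num

lemma Data.scale_pow (i : Data) : (3 * i.ell * i.lam) ^ ord = 3 ^ ord * i.lam ^ (-1 : ℝ) := by
  rw [mul_assoc, i.ell_mul, mul_pow, ← rpow_natCast (i.lam ^ _), ← rpow_mul i.pos.le, ord_eq]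
  norm_num

lemma Data.Er_sup (i : Data) {A : ℝ} {f : B} (h : Bdd (ord + 1) A i.lam f) (x : Pt) :
    ‖((Er i.ell ^ ord) f).1 x‖ ≤ 3 ^ ord * A * i.lam ^ (-1 : ℝ) := by
  have := (Er_pow_bdd (n := 1) i.ell_pos.le ord (by rwa [add_comm])).sup x
  rw [i.scale_pow] at this
  linarith

lemma Data.U_sub (i : Data) (x : Pt) : ‖i.U.1 x - i.U0.1 x‖ ≤ 3 ^ ord * i.lam ^ (-1 : ℝ) := by
  have := i.Er_sup i.U0_bdd x
  rw [U, Tm_apply, B.sub_val]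
  simpa using this

lemma comm_sup : ∃ C, ∀ (i : Data) x, ‖i.comm.1 x‖ ≤ C * i.lam ^ (-1 : ℝ) := by
  refine ⟨3 ^ ord * (2 ^ (ord + 1)) + 2 * 3 ^ ord + (3 ^ ord) ^ 2, fun i x => ?_⟩
  have hl := i.rpow_pos (-1)
  have hl1 : i.lam ^ (-1 : ℝ) ≤ 1 := by simpa using i.rpow_le (s := -1) (t := 0) (by norm_num)
  have h1 := i.Er_sup (i.U0_bdd.mul i.pos.le i.U0_bdd) x
  have h2 := i.Er_sup i.U0_bdd x
  have h3 := i.U0_sup x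
  have e : i.comm = 2 * i.U0 * ((Er i.ell ^ ord) i.U0) - (Er i.ell ^ ord) (i.U0 * i.U0)
      - ((Er i.ell ^ ord) i.U0) ^ 2 := by
    rw [Data.comm, Data.U, Tm_apply, Tm_apply, pow_two i.U0]
    ring
  rw [mul_one, mul_one] at h1
  rw [mul_one] at h2
  have h4 : ‖(2 * i.U0 * ((Er i.ell ^ ord) i.U0)).1 x‖ ≤ 2 * (3 ^ ord * i.lam ^ (-1 : ℝ)) := by
    rw [B.mul_val, B.mul_val, norm_mul, norm_mul, show (2 : B).1 x = 2 from rfl]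
    rw [show ‖(2 : ℂ)‖ = 2 by simp, mul_assoc]
    refine mul_le_mul_of_nonneg_left ?_ (by norm_num)
    exact (mul_le_of_le_one_left (norm_nonneg _) h3).trans h2
  have h5 : ‖(((Er i.ell ^ ord) i.U0) ^ 2).1 x‖ ≤ (3 ^ ord) ^ 2 * i.lam ^ (-1 : ℝ) := by
    rw [B.pow_val, norm_pow]
    refine (pow_le_pow_left₀ (norm_nonneg _) h2 2).trans ?_
    rw [mul_pow]
    exact mul_le_mul_of_nonneg_left (by nlinarith) (by positivity)
  rw [e, B.sub_val, B.sub_val]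
  refine (norm_sub_le _ _).trans ((add_le_add (norm_sub_le _ _) le_rfl).trans ?_)
  linarith

lemma Er_pow_sup {a A : ℝ} {f : B} (m : ℕ) (hf : ∀ x, ‖f.1 x‖ ≤ A) (x : Pt) :
    ‖((Er a ^ m) f).1 x‖ ≤ 2 ^ m * A := by
  induction m generalizing x with
  | zero => simpa using hf x
  | succ m ih =>
    rw [pow_succ', Module.End.mul_apply, Er_apply, B.sub_val]
    have h : Bdd 0 (2 ^ m * A) 1 ((Er a ^ m) f) := ih
    refine (norm_sub_le _ _).trans ((add_le_add (ih x) ((Mo_bdd (a := a) h) x)).trans ?_)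
    rw [pow_succ]
    linarith

lemma P_sub (i : Data) (x : Pt) :
    ‖(Tm i.ell i.P).1 x - i.P.1 x‖ ≤ 2 ^ 299 * 3 * i.lam ^ (-(1 / 300) : ℝ) := by
  obtain ⟨K, hK⟩ := B.bounded i.P
  have h0 : ∀ x, ‖(Er i.ell i.P).1 x‖ ≤ 3 * i.lam ^ (-(1 / 300) : ℝ) := by
    have hm : 0 < max K 1 := lt_max_of_lt_right one_pos
    have h : Bdd (0 + 1) (max K 1) (i.lam / max K 1) i.P :=
      ⟨fun x => (hK x).trans (le_max_left _ _), fun v x => (i.good.der_P v x).trans_eq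
        (mul_div_cancel₀ _ hm.ne').symm⟩
    intro x
    refine (Euler2D.Er_sup i.ell_pos.le h x).trans_eq ?_
    rw [← i.ell_mul]
    field_simp
  have h1 := Er_pow_sup (a := i.ell) 299 h0 x
  rw [Tm_apply, B.sub_val, ord_eq, pow_succ, Module.End.mul_apply]
  simpa [mul_assoc] using h1

/-! ### Algebra of a superposition of waves -/

/-- The material derivative along `U`. -/
def mat (U : B) : Derivation ℂ B B := D 0 + U • dz + cj U • db

lemma mat_apply (U f : B) : mat U f = D 0 f + U * dz f + cj U * db f := rfl

lemma cj_mat (U f : B) : cj (mat U f) = mat U (cj f) := by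
  rw [mat_apply, mat_apply, map_add, map_add, map_mul, map_mul, cj_cj, cj_D, cj_dz, cj_db]
  ring

lemma cj_vel (ψ : B) : cj (vel ψ) = (-(2 * Complex.I)) • dz (cj ψ) := by
  rw [vel, cj_smul, cj_db]
  congr 1
  simp

lemma div_vel {ψ : B} (h : cj ψ = ψ) : dz (vel ψ) + db (cj (vel ψ)) = 0 := by
  rw [cj_vel, h, vel, Derivation.map_smul, Derivation.map_smul, dz_db, ← add_smul]
  simp

lemma linear_part {U W : B} (hU : dz U + db (cj U) = 0) (hW : dz W + db (cj W) = 0) :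
    D 0 W + dz (2 * U * W) + db (U * cj W + cj U * W) = mat U W + W * dz U + cj W * db U := by
  rw [two_mul, add_mul]
  simp only [mat_apply, map_add, Derivation.leibniz, smul_eq_mul]
  linear_combination W * hU + U * hW

section Waves

variable {ι : Type*} [Fintype ι] (ν : Equiv.Perm ι)

lemma mat_wave_sum (U : B) (c : ℂ) (C H e : ι → B)
    (he : ∀ p, mat U (e p) = c • (H p * e p)) :
    mat U (∑ p, C p * e p) = ∑ p, (mat U (C p) + c • (C p * H p)) * e p := by
  rw [map_sum]
  refine Finset.sum_congr rfl fun p _ => ?_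
  rw [Derivation.leibniz, he]
  simp only [smul_eq_mul, Algebra.smul_def]
  ring

lemma cj_wave_sum (hν : ∀ p, ν (ν p) = p) (C e : ι → B) (he : ∀ p, cj (e p) = e (ν p)) :
    cj (∑ p, C p * e p) = ∑ p, cj (C (ν p)) * e p := by
  rw [map_sum, ← Equiv.sum_comp ν]
  refine Finset.sum_congr rfl fun p _ => ?_
  rw [map_mul, he, hν]

/-- The forcing created by a pair of waves. -/
def pairForce [DecidableEq ι] (c : ℂ) (A C K : ι → B) (p q : ι) : B :=
  if q = ν p then 0 else
    dz (C p * C q) + c • (C p * C q * cj (K p + K q)) - db (A p * A q)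
      - c • (A p * A q * (K p + K q))

lemma quadratic_part [DecidableEq ι] (c : ℂ) (A C K e : ι → B) (hee : ∀ p, e p * e (ν p) = 1)
    (hz : ∀ p, dz (e p) = c • (cj (K p) * e p)) (hb : ∀ p, db (e p) = c • (K p * e p)) :
    dz ((∑ p, C p * e p) ^ 2) - db ((∑ p, A p * e p) ^ 2) + db (∑ p, A p * A (ν p))
      = dz (∑ p, C p * C (ν p)) + ∑ p, ∑ q, pairForce ν c A C K p q * (e p * e q) := by
  have h : ∀ p q, dz (C p * e p * (C q * e q)) - db (A p * e p * (A q * e q))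
      = (if q = ν p then dz (C p * C q) - db (A p * A q) else 0)
        + pairForce ν c A C K p q * (e p * e q) := by
    intro p q
    rw [pairForce]
    split_ifs with hq
    · subst hq
      rw [mul_mul_mul_comm, hee, mul_one, mul_mul_mul_comm, hee, mul_one, zero_mul, add_zero]
    · simp only [Derivation.leibniz, smul_eq_mul, Algebra.smul_def, hz, hb, map_add]
      ring
  have hs : ∑ p, ∑ q, (dz (C p * e p * (C q * e q)) - db (A p * e p * (A q * e q)))
      = ∑ p, ∑ q, ((if q = ν p then dz (C p * C q) - db (A p * A q) else 0)
        + pairForce ν c A C K p q * (e p * e q)) :=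
    Finset.sum_congr rfl fun p _ => Finset.sum_congr rfl fun q _ => h p q
  simp only [Finset.sum_sub_distrib, Finset.sum_add_distrib, Finset.sum_ite_eq',
    Finset.mem_univ, if_true] at hs
  rw [pow_two, pow_two, Finset.sum_mul_sum, Finset.sum_mul_sum]
  simp only [map_sum]
  linear_combination hs

end Waves

lemma Mn_dz (f : B) : Mn 1 (Mn 2 (dz f)) = 0 := by
  have h1 : Mn 1 (Mn 2 (D 1 f)) = 0 := by rw [Mn_comm, Mn_D_self (by decide), map_zero]
  have h2 : Mn 1 (Mn 2 (D 2 f)) = 0 := by rw [Mn_D_self (by decide), map_zero]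
  rw [dz_apply, map_smul, map_smul, map_sub, map_sub, map_smul, map_smul, h1, h2]
  simp

lemma Mn_db (f : B) : Mn 1 (Mn 2 (db f)) = 0 := by
  have h1 : Mn 1 (Mn 2 (D 1 f)) = 0 := by rw [Mn_comm, Mn_D_self (by decide), map_zero]
  have h2 : Mn 1 (Mn 2 (D 2 f)) = 0 := by rw [Mn_D_self (by decide), map_zero]
  rw [db_apply, map_smul, map_smul, map_add, map_add, map_smul, map_smul, h1, h2]
  simp

lemma vel_add (f g : B) : vel (f + g) = vel f + vel g := by rw [vel, map_add, smul_add]; rfl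

lemma D_vel (v : Fin 3) (f : B) : D v (vel f) = vel (D v f) := by
  rw [vel, Derivation.map_smul, D_db]; rfl

/-- The equation for the superposition of an approximate solution and a perturbation. -/
lemma new_equation {ψ Ψ P Q S r g : B} (hψ : cj ψ = ψ) (hΨ : cj Ψ = Ψ)
    (heq : D 0 (vel ψ) + dz (vel ψ ^ 2 + S) + (2 : ℂ) • db P = 0)
    (hW : mat (vel ψ) (vel Ψ) + vel Ψ * dz (vel ψ) + cj (vel Ψ) * db (vel ψ)
      + dz (vel Ψ ^ 2) + (2 : ℂ) • db Q = dz g + r) :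
    D 0 (vel (ψ + Ψ)) + dz (vel (ψ + Ψ) ^ 2 + (S - g - RS r)) + (2 : ℂ) • db
      (P + ((1 / 2 : ℂ) • (vel ψ * cj (vel Ψ) + cj (vel ψ) * vel Ψ) + Q) - PS r) = 0 := by
  have hl := linear_part (div_vel hψ) (div_vel hΨ)
  have hr : Mn 1 (Mn 2 r) = 0 := by
    rw [← hl] at hW
    have : r = vel (D 0 Ψ) + dz (2 * vel ψ * vel Ψ)
        + db (vel ψ * cj (vel Ψ) + cj (vel ψ) * vel Ψ) + dz (vel Ψ ^ 2) + (2 : ℂ) • db Q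
        - dz g := by rw [← D_vel]; linear_combination -hW
    rw [this, vel]
    simp only [map_add, map_sub, map_smul, Mn_dz, Mn_db]
    simp
  have ha := antidiv r hr
  have hsq : (vel ψ + vel Ψ) ^ 2 + (S - g - RS r)
      = (vel ψ ^ 2 + S) + 2 * vel ψ * vel Ψ + vel Ψ ^ 2 - g - RS r := by ring
  rw [vel_add, hsq]
  simp only [map_add, map_sub, Derivation.map_smul, smul_add, smul_sub, smul_smul] at *
  norm_num at *
  linear_combination heq + hl + hW - ha

/-! ### Wave vectors -/

/-- Labels of waves: a temporal cutoff, a pair of perpendicular lines, a direction. -/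
abbrev Wv := Fin 2 × Fin 2 × Fin 4

/-- The opposite wave. -/
def opp : Equiv.Perm Wv :=
  Function.Involutive.toPerm (fun p => (p.1, p.2.1, p.2.2 + 2))
    (show ∀ p : Wv, (p.1, p.2.1, p.2.2 + 2 + 2) = p by decide)

lemma opp_opp (p : Wv) : opp (opp p) = p := by revert p; decide

lemma opp_fst (p : Wv) : (opp p).1 = p.1 := rfl

/-- First coordinate of the wave vector. -/
def kx (p : Wv) : ℤ :=
  ![![![65, 0, -65, 0], ![39, -52, -39, 52]],
    ![![25, -60, -25, 60], ![-33, -56, 33, 56]]] p.1 p.2.1 p.2.2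

/-- Second coordinate of the wave vector. -/
def ky (p : Wv) : ℤ :=
  ![![![0, 65, 0, -65], ![52, 39, -52, -39]],
    ![![60, 25, -60, -25], ![56, -33, -56, 33]]] p.1 p.2.1 p.2.2

lemma kx_opp (p : Wv) : kx (opp p) = -kx p := by revert p; decide

lemma ky_opp (p : Wv) : ky (opp p) = -ky p := by revert p; decide

lemma kx_sq_add_ky_sq (p : Wv) : kx p ^ 2 + ky p ^ 2 = 65 ^ 2 := by revert p; decide

lemma abs_kx_le (p : Wv) : |kx p| ≤ 65 := by revert p; decide

lemma abs_ky_le (p : Wv) : |ky p| ≤ 65 := by revert p; decide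

lemma eq_opp_of_add_eq_zero (p q : Wv) (h1 : kx p + kx q = 0) (h2 : ky p + ky q = 0) :
    q = opp p := by
  revert p q; decide

/-- The wave vector as a complex number. -/
def kc (p : Wv) : ℂ := (kx p + ky p * Complex.I) / 65

lemma kc_opp (p : Wv) : kc (opp p) = -kc p := by
  rw [kc, kc, kx_opp, ky_opp]; push_cast; ring

lemma kc_mul_star (p : Wv) : kc p * star (kc p) = 1 := by
  have h : ((kx p : ℂ)) ^ 2 + (ky p : ℂ) ^ 2 = 65 ^ 2 := by exact_mod_cast kx_sq_add_ky_sq p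
  rw [kc]
  simp only [Complex.star_def, map_div₀, map_add, map_mul, Complex.conj_I, map_intCast]
  rw [show (starRingEnd ℂ) 65 = 65 from Complex.conj_ofNat 65]
  linear_combination h / 65 ^ 2 - (ky p : ℂ) ^ 2 / 65 ^ 2 * Complex.I_sq

lemma kc_ne_zero (p : Wv) : kc p ≠ 0 := left_ne_zero_of_mul_eq_one (kc_mul_star p)

lemma kc_add_ne_zero {p q : Wv} (h : q ≠ opp p) : kc p + kc q ≠ 0 := by
  intro h0
  apply h
  have h1 : ((kx p + kx q : ℤ) : ℂ) + ((ky p + ky q : ℤ) : ℂ) * Complex.I = 0 := by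
    have := congrArg (fun z => 65 * z) h0
    simp only [kc] at this
    push_cast
    linear_combination this
  have hr := congrArg Complex.re h1
  have hi := congrArg Complex.im h1
  simp only [Complex.add_re, Complex.add_im, Complex.mul_re, Complex.mul_im, Complex.intCast_re,
    Complex.intCast_im, Complex.I_re, Complex.I_im, Complex.zero_re, Complex.zero_im] at hr hi
  refine eq_opp_of_add_eq_zero p q ?_ ?_
  · have : ((kx p + kx q : ℤ) : ℝ) = 0 := by linarith
    exact_mod_cast this
  · have : ((ky p + ky q : ℤ) : ℝ) = 0 := by linarith
    exact_mod_cast this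

/-! ### Phases -/

/-- Taylor expansion in time of the phase correction. -/
def taylor (U s h : B) (n : ℕ) : B :=
  ∑ j ∈ Finset.range n, ((j + 1).factorial : ℂ)⁻¹ • (s ^ (j + 1) * (mat U)^[j] h)

lemma taylor_spec {U χ s : B} (hs : χ * (1 + mat U s) = 0) (h : B) (n : ℕ) :
    χ * (h + mat U (taylor U s h n)) = χ * ((n.factorial : ℂ)⁻¹ • (s ^ n * (mat U)^[n] h)) := by
  induction n with
  | zero => simp [taylor]
  | succ n ih =>
    rw [taylor, Finset.sum_range_succ, map_add, ← add_assoc, mul_add]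
    rw [show ∑ j ∈ Finset.range n, ((j + 1).factorial : ℂ)⁻¹ • (s ^ (j + 1) * (mat U)^[j] h)
      = taylor U s h n from rfl, ih, Derivation.map_smul, Derivation.leibniz,
      Derivation.leibniz_pow, ← Function.iterate_succ_apply' (mat U), Nat.factorial_succ]
    have hn : ((n.factorial : ℕ) : ℂ) ≠ 0 := by exact_mod_cast n.factorial_ne_zero
    have hn1 : ((n : ℂ) + 1) ≠ 0 := by exact_mod_cast n.succ_ne_zero
    rw [← Nat.cast_smul_eq_nsmul ℂ]
    ext x
    have hx := congrArg (fun f : B => f.1 x) hs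
    simp only [B.add_val, B.smul_val, B.mul_val, B.pow_val, B.one_val, B.zero_val, smul_eq_mul,
      Nat.add_sub_cancel] at hx ⊢
    push_cast
    field_simp
    linear_combination (n + 1) * s.1 x ^ n * ((mat U)^[n] h).1 x * hx

lemma taylor_neg (U s h : B) (n : ℕ) : taylor U s (-h) n = -taylor U s h n := by
  have : ∀ j, (mat U)^[j] (-h) = -(mat U)^[j] h := fun j => by
    induction j with
    | zero => rfl
    | succ j ih => rw [Function.iterate_succ_apply', ih, map_neg, Function.iterate_succ_apply']
  rw [taylor, taylor, ← Finset.sum_neg_distrib]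
  refine Finset.sum_congr rfl fun j _ => ?_
  rw [this, Algebra.smul_def, Algebra.smul_def]
  ring

lemma cj_taylor {U s h : B} (hs : cj s = s) (hh : cj h = h) (n : ℕ) :
    cj (taylor U s h n) = taylor U s h n := by
  have : ∀ j, cj ((mat U)^[j] h) = (mat U)^[j] h := fun j => by
    induction j with
    | zero => exact hh
    | succ j ih => rw [Function.iterate_succ_apply', cj_mat, ih]
  simp only [taylor, map_sum, cj_smul, map_mul, map_pow, hs, this, star_inv₀, star_natCast]

lemma dz_taylor (U h : B) {s : B} (hs : dz s = 0) (n : ℕ) :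
    dz (taylor U s h n) = ∑ j ∈ Finset.range n,
      ((j + 1).factorial : ℂ)⁻¹ • (s ^ (j + 1) * dz ((mat U)^[j] h)) := by
  simp [taylor, Derivation.leibniz_pow, hs]

/-! ### Modulated plane waves -/

/-- A plane wave of frequency `65 * N` in direction `p`, with phase corrected by `φ`. -/
def wave (N : ℕ) (p : Wv) (φ : B) : B :=
  planeWave (N * kx p) (N * ky p) * expB ((Complex.I * (65 * N)) • φ)

/-- The initial drift of the phase in direction `k`. -/
def drift (U : B) (k : ℂ) : B := (1 / 2 : ℂ) • (star k • U + k • cj U)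

lemma cj_drift (U : B) (k : ℂ) : cj (drift U k) = drift U k := by
  rw [drift, cj_smul, map_add, cj_smul, cj_smul, cj_cj, star_star, add_comm]
  simp

lemma drift_neg (U : B) (k : ℂ) : drift U (-k) = -drift U k := by
  simp only [drift, star_neg, neg_smul, smul_add, smul_neg]
  abel

lemma D_wave (N : ℕ) (p : Wv) (φ : B) (v : Fin 3) :
    D v (wave N p φ) = (phase (N * kx p) (N * ky p) (ev v) • 1
      + (Complex.I * (65 * N)) • D v φ) * wave N p φ := by
  rw [wave, Derivation.leibniz, D_expB, D_planeWave, Derivation.map_smul]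
  simp only [smul_eq_mul, Algebra.smul_def]
  push_cast
  ring

lemma wave_opp (N : ℕ) (p : Wv) (φ : B) : wave N p φ * wave N (opp p) (-φ) = 1 := by
  rw [wave, wave, mul_mul_mul_comm, ← planeWave_add, ← expB_add, kx_opp, ky_opp, smul_neg,
    add_neg_cancel, expB_zero]
  rw [mul_neg, mul_neg, add_neg_cancel, add_neg_cancel, planeWave_zero, one_mul]

lemma cj_wave (N : ℕ) (p : Wv) {φ : B} (hφ : cj φ = φ) :
    cj (wave N p φ) = wave N (opp p) (-φ) := by
  rw [wave, wave, map_mul, cj_planeWave, cj_expB, cj_smul, hφ, kx_opp, ky_opp, mul_neg, mul_neg,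
    smul_neg, ← neg_smul]
  congr 3
  simp

lemma wave_norm (N : ℕ) (p : Wv) {φ : B} (hφ : cj φ = φ) (x : Pt) :
    ‖(wave N p φ).1 x‖ = 1 := by
  have h := congrArg (fun f : B => ‖f.1 x‖) (wave_opp N p φ)
  rw [← cj_wave N p hφ] at h
  simp only [B.mul_val, norm_mul, cj_val, norm_star, B.one_val, norm_one] at h
  nlinarith [norm_nonneg ((wave N p φ).1 x)]

/-- The local wave vector. -/
def locK (p : Wv) (φ : B) : B := kc p • 1 + (2 : ℂ) • db φ

lemma cj_locK (p : Wv) {φ : B} (hφ : cj φ = φ) :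
    cj (locK p φ) = star (kc p) • 1 + (2 : ℂ) • dz φ := by
  rw [locK, map_add, cj_smul, cj_smul, cj_db, hφ, map_one]
  simp

lemma locK_opp (p : Wv) (φ : B) : locK (opp p) (-φ) = -locK p φ := by
  rw [locK, locK, kc_opp, map_neg, neg_smul, smul_neg]; abel

lemma dz_wave (N : ℕ) (p : Wv) {φ : B} (hφ : cj φ = φ) :
    dz (wave N p φ) = (Complex.I * (65 * N) / 2) • (cj (locK p φ) * wave N p φ) := by
  rw [cj_locK p hφ, dz_apply, dz_apply, D_wave, D_wave, phase_apply, phase_apply, kc]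
  ext x
  simp [ev]
  ring

lemma db_wave (N : ℕ) (p : Wv) (φ : B) :
    db (wave N p φ) = (Complex.I * (65 * N) / 2) • (locK p φ * wave N p φ) := by
  rw [locK, db_apply, db_apply, D_wave, D_wave, phase_apply, phase_apply, kc]
  ext x
  simp [ev]
  ring

lemma mat_wave (N : ℕ) (p : Wv) {φ : B} (hφ : cj φ = φ) (U : B) :
    mat U (wave N p φ) = (Complex.I * (65 * N)) •
      ((drift U (kc p) + mat U φ) * wave N p φ) := by
  have h0 : D 0 (wave N p φ) = (Complex.I * (65 * N)) • (D 0 φ * wave N p φ) := by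
    rw [D_wave, phase_apply]
    simp [ev]
  rw [mat_apply, mat_apply, h0, dz_wave N p hφ, db_wave, cj_locK p hφ, locK, drift]
  ext x
  simp only [B.add_val, B.smul_val, B.mul_val, B.one_val]
  ring

/-! ### Estimates for phases and waves -/

lemma Sy.pow {s l : ℝ} {f : Data → B} (hl : 0 ≤ l) (h : Sy s l f) (n : ℕ) :
    Sy (n * s) l fun i => f i ^ n := by
  induction n with
  | zero => simpa using Sy.one.mono le_rfl hl
  | succ n ih =>
    simp only [pow_succ]
    exact ih.mul h (by push_cast; linarith)

/-- Temporal cutoffs. -/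
def cutX : Fin 2 → ℝ → ℝ := exists_cutoffs.choose

/-- Temporal clocks. -/
def cutS : Fin 2 → ℝ → ℝ := exists_cutoffs.choose_spec.choose

lemma cutX_BT (g : Fin 2) : BT (cutX g) := exists_cutoffs.choose_spec.choose_spec.1 g

lemma cutS_BT (g : Fin 2) : BT (cutS g) := exists_cutoffs.choose_spec.choose_spec.2.1 g

lemma cutX_sq (t : ℝ) : cutX 0 t ^ 2 + cutX 1 t ^ 2 = 1 :=
  exists_cutoffs.choose_spec.choose_spec.2.2.1 t

lemma cutX_mul (g : Fin 2) (t : ℝ) : cutX g t * (1 + deriv (cutS g) t) = 0 :=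
  exists_cutoffs.choose_spec.choose_spec.2.2.2 g t

namespace Data

/-- The time scale of the cutoffs. -/
def tau (i : Data) : ℝ := i.lam ^ (-(151 / 150) : ℝ)

lemma tau_pos (i : Data) : 0 < i.tau := i.rpow_pos _

lemma tau_inv (i : Data) : i.tau⁻¹ = i.lam ^ (151 / 150 : ℝ) := by
  rw [tau, rpow_neg i.pos.le, inv_inv]

/-- Temporal cutoff at scale `tau`. -/
def chi (i : Data) (g : Fin 2) : B := timeB (cutX_BT g) i.tau⁻¹ 0

/-- Clock at scale `tau`. -/
def clock (i : Data) (g : Fin 2) : B := (i.tau : ℂ) • timeB (cutS_BT g) i.tau⁻¹ 0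

/-- Smooth onset at time `t0`. -/
def onset (i : Data) : B := timeB step_BT i.lam (-(i.lam * i.t0))

lemma chi_sq (i : Data) : i.chi 0 ^ 2 + i.chi 1 ^ 2 = 1 := by
  ext x
  rw [B.add_val, B.pow_val, B.pow_val, chi, chi, timeB_val, timeB_val, B.one_val]
  exact_mod_cast cutX_sq _

lemma dz_clock (i : Data) (g : Fin 2) : dz (i.clock g) = 0 := by
  rw [clock, Derivation.map_smul, dz_timeB, smul_zero]

lemma db_clock (i : Data) (g : Fin 2) : db (i.clock g) = 0 := by
  rw [clock, Derivation.map_smul, db_timeB, smul_zero]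

lemma cj_clock (i : Data) (g : Fin 2) : cj (i.clock g) = i.clock g := by
  rw [clock, cj_smul, cj_timeB]
  simp

lemma chi_clock (i : Data) (g : Fin 2) (U : B) : i.chi g * (1 + mat U (i.clock g)) = 0 := by
  rw [mat_apply, dz_clock, db_clock, mul_zero, mul_zero, add_zero, add_zero, clock,
    Derivation.map_smul, D_timeB_zero, smul_smul]
  rw [show (i.tau : ℂ) * ((i.tau⁻¹ : ℝ) : ℂ) = 1 by
    rw [← Complex.ofReal_mul, mul_inv_cancel₀ i.tau_pos.ne', Complex.ofReal_one], one_smul]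
  ext x
  rw [B.mul_val, B.add_val, B.one_val, chi, timeB_val, timeB_val, B.zero_val]
  exact_mod_cast cutX_mul _ _

lemma onset_mem_Z (i : Data) : i.onset ∈ Z (i.t0 - 2 / i.lam) := by
  intro x hx
  rw [onset, timeB_val, step_zero]
  · simp
  · have := mul_lt_mul_of_pos_left hx i.pos
    rw [mul_sub, mul_div_cancel₀ _ i.pos.ne'] at this
    linarith

lemma ord_ell (i : Data) : ord * i.ell ≤ 1 / i.lam := by
  rw [le_div_iff₀ i.pos, mul_assoc, i.ell_mul, ord_eq, rpow_neg i.pos.le]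
  have h : (300 : ℝ) ≤ i.lam ^ (1 / 300 : ℝ) := by
    have := rpow_le_rpow (by positivity) i.large (show (0 : ℝ) ≤ 1 / 300 by norm_num)
    rwa [← rpow_mul (by norm_num), show (300 : ℝ) * (1 / 300) = 1 by norm_num, rpow_one] at this
  rw [← div_eq_mul_inv, div_le_one (i.rpow_pos _)]
  exact_mod_cast h

lemma Rl_mem_Z (i : Data) : i.Rl ∈ Z (i.t0 - 1 / i.lam) :=
  Z_anti (by linarith [i.ord_ell]) (Tm_mem_Z i.ell_pos.le i.good.supp_R)

lemma onset_mul_Rl (i : Data) : i.onset * i.Rl = i.Rl := by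
  ext x
  rw [B.mul_val]
  by_cases hx : x 0 < i.t0 - 1 / i.lam
  · rw [i.Rl_mem_Z x hx, mul_zero]
  · rw [onset, timeB_val, step_one]
    · simp
    · have := mul_le_mul_of_nonneg_left (not_lt.1 hx) i.pos.le
      rw [mul_sub, mul_div_cancel₀ _ i.pos.ne'] at this
      linarith

end Data

lemma timeB_Sy {f : ℝ → ℝ} (hf : BT f) {l : ℝ} {b : Data → ℝ} :
    Sy 0 l fun i => timeB hf (i.lam ^ l) (b i) := by
  intro n
  obtain ⟨C, hC⟩ := timeB_bdd hf n
  exact ⟨C, fun i => by rw [rpow_zero, mul_one]; exact hC _ _ (i.rpow_pos l).le⟩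

lemma chi_Sy (g : Fin 2) : Sy 0 (151 / 150) fun i => i.chi g := by
  simp only [Data.chi, Data.tau_inv]
  exact timeB_Sy _

lemma clock_Sy (g : Fin 2) : Sy (-(151 / 150)) (151 / 150) fun i => i.clock g := by
  simp only [Data.clock, Data.tau_inv]
  refine (timeB_Sy (cutS_BT g)).smulf (K := 1) (t := -(151 / 150)) (fun i => ?_) (by norm_num)
  rw [Complex.norm_real, norm_of_nonneg i.tau_pos.le, one_mul, Data.tau]

lemma onset_Sy : Sy 0 1 Data.onset := by
  have := timeB_Sy step_BT (l := 1) (b := fun i => -(i.lam * i.t0))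
  simp only [rpow_one] at this
  exact this

lemma mat_Sy {s r l : ℝ} {f : Data → B} (hl : 301 / 300 ≤ l) (h : Sy s l f) (hr : s + l ≤ r) :
    Sy r l fun i => mat i.U (f i) := by
  have hU := U_Sy.mono le_rfl hl
  exact ((h.D 0 hr).add (hU.mul (h.dz hr) (by linarith))).add
    (hU.cj.mul (h.db hr) (by linarith))

lemma drift_Sy (k : ℂ) : Sy 0 (301 / 300) fun i => drift i.U k :=
  ((U_Sy.smul _).add (U_Sy.cj.smul _)).smul _

lemma D_drift_Sy (k : ℂ) (v : Fin 3) : Sy (6 / 7) (301 / 300) fun i => D v (drift i.U k) := by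
  have h : ∀ i : Data, D v (drift i.U k) = (1 / 2 : ℂ) • (star k • D v i.U + k • cj (D v i.U)) := by
    intro i
    rw [drift, Derivation.map_smul, map_add, Derivation.map_smul, Derivation.map_smul, cj_D]
  simp only [h]
  exact (((DU_Sy v).smul _).add ((DU_Sy v).cj.smul _)).smul _

lemma mat_drift_Sy (k : ℂ) (j : ℕ) :
    Sy (6 / 7 + j * (301 / 300)) (301 / 300) fun i => (mat i.U)^[j + 1] (drift i.U k) := by
  induction j with
  | zero =>
    have h := D_drift_Sy k
    simp only [zero_add, Function.iterate_one, Nat.cast_zero, zero_mul, add_zero]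
    exact ((h 0).add (U_Sy.mul (Sy.dz_of (h 1) (h 2)) (by norm_num))).add
      (U_Sy.cj.mul (Sy.db_of (h 1) (h 2)) (by norm_num))
  | succ j ih =>
    simp only [Function.iterate_succ_apply' _ (j + 1)]
    exact mat_Sy le_rfl ih (by push_cast; linarith)

/-- The exponent of the `j`-th material derivative. -/
lemma iter_drift_Sy (k : ℂ) (j : ℕ) :
    Sy (j * (301 / 300)) (301 / 300) fun i => (mat i.U)^[j] (drift i.U k) := by
  cases j with
  | zero => simpa using drift_Sy k
  | succ j => exact (mat_drift_Sy k j).mono (by push_cast; linarith) le_rfl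

lemma D_iter_drift_Sy (k : ℂ) (j : ℕ) (v : Fin 3) :
    Sy (6 / 7 + j * (301 / 300)) (301 / 300)
      fun i => D v ((mat i.U)^[j] (drift i.U k)) := by
  cases j with
  | zero => simpa using D_drift_Sy k v
  | succ j => exact (mat_drift_Sy k j).D v (by push_cast; linarith)

/-- The phase correction of the wave `p`. -/
def Data.ph (i : Data) (p : Wv) : B := taylor i.U (i.clock p.1) (drift i.U (kc p)) ord

lemma Data.ph_opp (i : Data) (p : Wv) : i.ph (opp p) = -i.ph p := by
  rw [ph, ph, kc_opp, drift_neg, taylor_neg, opp_fst]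

lemma Data.cj_ph (i : Data) (p : Wv) : cj (i.ph p) = i.ph p :=
  cj_taylor (i.cj_clock _) (cj_drift _ _) _

lemma clock_pow_Sy (g : Fin 2) (j : ℕ) :
    Sy (j * -(151 / 150)) (151 / 150) fun i => i.clock g ^ j :=
  (clock_Sy g).pow (by norm_num) j

lemma ph_Sy (p : Wv) : Sy (-(151 / 150)) (151 / 150) fun i => i.ph p := by
  simp only [Data.ph, taylor]
  refine Sy.sum _ fun j _ => Sy.smul _ ?_
  refine (clock_pow_Sy p.1 (j + 1)).mul ((iter_drift_Sy (kc p) j).mono le_rfl (by norm_num)) ?_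
  push_cast
  have : (0 : ℝ) ≤ j := j.cast_nonneg
  linarith

lemma dz_ph_Sy (p : Wv) : Sy (-(1 / 7)) (151 / 150) fun i => dz (i.ph p) := by
  simp only [Data.ph, dz_taylor _ _ (Data.dz_clock _ _)]
  refine Sy.sum _ fun j _ => Sy.smul _ ?_
  refine (clock_pow_Sy p.1 (j + 1)).mul ((Sy.dz_of (D_iter_drift_Sy (kc p) j 1)
    (D_iter_drift_Sy (kc p) j 2)).mono le_rfl (by norm_num)) ?_
  push_cast
  have : (0 : ℝ) ≤ j := j.cast_nonneg
  linarith

lemma db_ph_Sy (p : Wv) : Sy (-(1 / 7)) (151 / 150) fun i => db (i.ph p) := by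
  have := (dz_ph_Sy p).cj
  simpa only [cj_dz, Data.cj_ph] using this

lemma chi_ph (i : Data) (p : Wv) : i.chi p.1 * (drift i.U (kc p) + mat i.U (i.ph p)) =
    i.chi p.1 * ((ord.factorial : ℂ)⁻¹ • (i.clock p.1 ^ ord *
      (mat i.U)^[ord] (drift i.U (kc p)))) :=
  taylor_spec (i.chi_clock _ _) _ _

lemma chi_ph_Sy (p : Wv) : Sy (-(8 / 7)) (151 / 150)
    fun i => i.chi p.1 * (drift i.U (kc p) + mat i.U (i.ph p)) := by
  simp only [chi_ph]
  obtain ⟨m, hm, e⟩ : ∃ m : ℕ, (m : ℝ) = 299 ∧ ord = m + 1 := ⟨299, by norm_num, ord_eq⟩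
  rw [e]
  refine (chi_Sy _).mul (Sy.smul _ ((clock_pow_Sy p.1 (m + 1)).mul
    ((mat_drift_Sy (kc p) m).mono le_rfl (by norm_num)) le_rfl)) ?_
  push_cast
  rw [hm]
  norm_num

namespace Data

/-- The number of oscillations. -/
def nn (i : Data) : ℕ := ⌈i.lam ^ (133 / 100 : ℝ)⌉₊

/-- The frequency of the waves. -/
def mu (i : Data) : ℂ := 65 * i.nn

lemma le_nn (i : Data) : i.lam ^ (133 / 100 : ℝ) ≤ i.nn := Nat.le_ceil _

lemma nn_le (i : Data) : (i.nn : ℝ) ≤ 2 * i.lam ^ (133 / 100 : ℝ) := by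
  have h1 : 1 ≤ i.lam ^ (133 / 100 : ℝ) := one_le_rpow i.one_le (by norm_num)
  have := Nat.ceil_lt_add_one (i.rpow_pos (133 / 100)).le
  rw [nn]
  linarith

lemma nn_pos (i : Data) : (0 : ℝ) < i.nn := (i.rpow_pos _).trans_le i.le_nn

lemma mu_ne (i : Data) : i.mu ≠ 0 := by
  have := i.nn_pos
  rw [mu]
  exact mul_ne_zero (by norm_num) (by exact_mod_cast this.ne')

lemma norm_mu (i : Data) : ‖i.mu‖ ≤ 130 * i.lam ^ (133 / 100 : ℝ) := by
  have := i.nn_le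
  rw [mu, norm_mul, Complex.norm_natCast, Complex.norm_ofNat]
  linarith

lemma norm_mu_inv (i : Data) : ‖i.mu⁻¹‖ ≤ 1 * i.lam ^ (-(133 / 100) : ℝ) := by
  rw [norm_inv, one_mul, rpow_neg i.pos.le]
  refine inv_anti₀ (i.rpow_pos _) (i.le_nn.trans ?_)
  rw [mu, norm_mul, Complex.norm_natCast, Complex.norm_ofNat]
  linarith [i.nn_pos]

/-- The wave `p`. -/
def ex (i : Data) (p : Wv) : B := wave i.nn p (i.ph p)

/-- The local wave vector of the wave `p`. -/
def K (i : Data) (p : Wv) : B := locK p (i.ph p)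

lemma ex_opp (i : Data) (p : Wv) : i.ex p * i.ex (opp p) = 1 := by
  rw [ex, ex, ph_opp, wave_opp]

lemma cj_ex (i : Data) (p : Wv) : cj (i.ex p) = i.ex (opp p) := by
  rw [ex, ex, ph_opp, cj_wave _ _ (i.cj_ph p)]

lemma dz_ex (i : Data) (p : Wv) : dz (i.ex p) = (Complex.I * i.mu / 2) • (cj (i.K p) * i.ex p) :=
  dz_wave _ _ (i.cj_ph p)

lemma db_ex (i : Data) (p : Wv) : db (i.ex p) = (Complex.I * i.mu / 2) • (i.K p * i.ex p) :=
  db_wave _ _ _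

lemma mat_ex (i : Data) (p : Wv) : mat i.U (i.ex p) =
    (Complex.I * i.mu) • ((drift i.U (kc p) + mat i.U (i.ph p)) * i.ex p) :=
  mat_wave _ _ (i.cj_ph p) _

lemma K_opp (i : Data) (p : Wv) : i.K (opp p) = -i.K p := by
  rw [K, K, ph_opp, locK_opp]

end Data

lemma norm_phase_ev (N : ℕ) (p : Wv) (v : Fin 3) :
    ‖phase (N * kx p) (N * ky p) (ev v)‖ ≤ 130 * N := by
  have h1 : |(kx p : ℝ)| ≤ 65 := by exact_mod_cast abs_kx_le p
  have h2 : |(ky p : ℝ)| ≤ 65 := by exact_mod_cast abs_ky_le p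
  have hN : (0 : ℝ) ≤ N := N.cast_nonneg
  have hv : ∀ w, |ev v w| ≤ 1 := fun w => by
    rw [ev, Pi.single_apply]; split_ifs <;> simp
  rw [phase_apply, norm_mul, Complex.norm_I, one_mul]
  refine (norm_add_le _ _).trans ?_
  rw [← Complex.ofReal_mul, ← Complex.ofReal_mul, Complex.norm_real, Complex.norm_real,
    norm_eq_abs, norm_eq_abs, abs_mul, abs_mul, abs_mul, abs_mul, abs_of_nonneg hN]
  have a1 := mul_le_mul (mul_le_mul_of_nonneg_left h1 hN) (hv 1) (abs_nonneg _) (by positivity)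
  have a2 := mul_le_mul (mul_le_mul_of_nonneg_left h2 hN) (hv 2) (abs_nonneg _) (by positivity)
  linarith

lemma ex_Sy (p : Wv) : Sy 0 (133 / 100) fun i => i.ex p := by
  refine Sy.expB_of (a := fun v i => phase (i.nn * kx p) (i.nn * ky p) (ev v) • 1
      + (Complex.I * (65 * i.nn)) • D v (i.ph p)) ⟨1, fun i x => ?_⟩ (fun v => ?_) fun v i => ?_
  · exact (wave_norm _ _ (i.cj_ph p) x).le
  · refine (Sy.smulf (K := 260) (t := 133 / 100) (fun i => ?_) (Sy.one (l := 133 / 100))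
      (by norm_num)).add ?_
    · exact (norm_phase_ev _ _ _).trans (by linarith [i.nn_le])
    · refine Sy.smulf (K := 130) (t := 133 / 100) (s := 0) (fun i => ?_) ?_ (by norm_num)
      · rw [norm_mul, Complex.norm_I, one_mul]
        exact i.norm_mu
      · exact ((ph_Sy p).D v (by norm_num)).mono le_rfl (by norm_num)
  · exact D_wave _ _ _ _

lemma K_Sy (p : Wv) : Sy 0 (151 / 150) fun i => i.K p :=
  (Sy.one.smul _).add (((db_ph_Sy p).mono (by norm_num) le_rfl).smul _)

/-! ### Amplitudes -/

/-- Squared direction of a pair of lines. -/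
def gsq : Fin 2 → ℂ := ![1, (-119 + 120 * Complex.I) / 169]

/-- Squared direction inside a pair of lines. -/
def csq : Fin 2 → ℂ := ![1, (-7 + 24 * Complex.I) / 25]

/-- Sign of the squared direction. -/
def sgn : Fin 4 → ℂ := ![1, -1, 1, -1]

lemma sgn_opp (p : Wv) : sgn (opp p).2.2 = sgn p.2.2 := by
  obtain ⟨g, b, m⟩ := p
  change sgn (m + 2) = sgn m
  fin_cases m <;> rfl

lemma star_sgn (m : Fin 4) : star (sgn m) = sgn m := by
  fin_cases m <;> simp [sgn]

lemma kc_sq (p : Wv) : kc p ^ 2 = sgn p.2.2 * (gsq p.1 * csq p.2.1) := by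
  obtain ⟨g, b, m⟩ := p
  fin_cases g <;> fin_cases b <;> fin_cases m <;>
    simp [kc, kx, ky, gsq, csq, sgn] <;> ring_nf <;> simp only [Complex.I_sq] <;> ring

lemma gsq_mul_star (g : Fin 2) : gsq g * star (gsq g) = 1 := by
  fin_cases g
  · simp [gsq]
  · simp [gsq]
    ring_nf
    simp only [Complex.I_sq]
    ring

namespace Data

/-- The coefficients of the stress in the basis given by the directions. -/
def rc (i : Data) (g b : Fin 2) : B :=
  if b = 0 then re (star (gsq g) • i.Rl) + (7 / 24 : ℂ) • im (star (gsq g) • i.Rl)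
  else (25 / 24 : ℂ) • im (star (gsq g) • i.Rl)

lemma rc_sum (i : Data) (g : Fin 2) : ∑ b, (gsq g * csq b) • i.rc g b = i.Rl := by
  have h1 := re_add_im (star (gsq g) • i.Rl)
  have h2 := gsq_mul_star g
  rw [Fin.sum_univ_two]
  ext x
  have hx := congrArg (fun f : B => f.1 x) h1
  simp only [rc, csq, if_true, if_neg (show ¬ (1 : Fin 2) = 0 by decide), B.add_val, B.smul_val,
    Matrix.cons_val_zero, Matrix.cons_val_one] at hx ⊢
  linear_combination gsq g * hx + i.Rl.1 x * h2

lemma cj_rc (i : Data) (g b : Fin 2) : cj (i.rc g b) = i.rc g b := by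
  rw [rc]
  split_ifs
  · rw [map_add, cj_smul, cj_re, cj_im]; simp
  · rw [cj_smul, cj_im]; simp

lemma cj_onset (i : Data) : cj i.onset = i.onset := cj_timeB _ _ _

lemma onset_mul_rc (i : Data) (g b : Fin 2) : i.onset * i.rc g b = i.rc g b := by
  have h := i.onset_mul_Rl
  have h' : i.onset * cj i.Rl = cj i.Rl := by
    have := congrArg cj h
    rwa [map_mul, cj_onset] at this
  ext x
  have hx := congrArg (fun f : B => f.1 x) h
  have hx' := congrArg (fun f : B => f.1 x) h'
  rw [rc]
  split_ifs
  · simp only [re, im, cj_smul, B.mul_val, B.add_val, B.sub_val, B.smul_val] at hx hx' ⊢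
    linear_combination ((1 / 2 - 7 / 48 * Complex.I) * star (gsq g)) * hx
      + ((1 / 2 + 7 / 48 * Complex.I) * star (star (gsq g))) * hx'
  · simp only [im, cj_smul, B.mul_val, B.sub_val, B.smul_val] at hx hx' ⊢
    linear_combination (-25 / 48 * Complex.I * star (gsq g)) * hx
      + (25 / 48 * Complex.I * star (star (gsq g))) * hx'

/-- The size of the amplitudes. -/
def sd (i : Data) : ℝ := i.lam ^ (-(4 / 21) : ℝ)

lemma sd_ne (i : Data) : (i.sd : ℂ) ≠ 0 := Complex.ofReal_ne_zero.mpr (i.rpow_pos _).ne'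

/-- The amplitude of a wave, before cutting off in time. -/
def amp0 (i : Data) (p : Wv) : B :=
  (i.sd : ℂ) • i.onset - ((i.sd : ℂ)⁻¹ * (sgn p.2.2 / 8)) • i.rc p.1 p.2.1

/-- The amplitude of a wave. -/
def A (i : Data) (p : Wv) : B := i.chi p.1 * i.amp0 p

lemma cj_chi (i : Data) (g : Fin 2) : cj (i.chi g) = i.chi g := cj_timeB _ _ _

lemma cj_A (i : Data) (p : Wv) : cj (i.A p) = i.A p := by
  rw [A, map_mul, cj_chi, amp0, map_sub, cj_smul, cj_smul, cj_rc, cj_onset, star_mul', star_div₀,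
    star_sgn, star_inv₀]
  simp

lemma A_opp (i : Data) (p : Wv) : i.A (opp p) = i.A p := by
  rw [A, A, amp0, amp0, sgn_opp]; rfl

lemma rc_mem_Z (i : Data) (g b : Fin 2) : i.rc g b ∈ Z (i.t0 - 2 / i.lam) := by
  have h : i.Rl ∈ Z (i.t0 - 2 / i.lam) :=
    Z_anti (sub_le_sub_left (div_le_div_of_nonneg_right (by norm_num) i.pos.le) _) i.Rl_mem_Z
  have hi := im_mem_Z (csmul_mem_Z (star (gsq g)) h)
  rw [rc]
  split_ifs
  · exact add_mem (re_mem_Z (csmul_mem_Z _ h)) (csmul_mem_Z _ hi)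
  · exact csmul_mem_Z _ hi

lemma A_mem_Z (i : Data) (p : Wv) : i.A p ∈ Z (i.t0 - 2 / i.lam) :=
  Ideal.mul_mem_left _ _ (sub_mem (csmul_mem_Z _ i.onset_mem_Z) (csmul_mem_Z _ (i.rc_mem_Z _ _)))

lemma sum_A_sq (i : Data) : ∑ p, kc p ^ 2 • i.A p ^ 2 = -i.Rl := by
  have h : ∀ g b, ∑ m, kc (g, b, m) ^ 2 • i.A (g, b, m) ^ 2
      = -(i.chi g ^ 2 * ((gsq g * csq b) • i.rc g b)) := by
    intro g b
    have hr := i.onset_mul_rc g b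
    simp only [kc_sq, A, amp0, sgn, Fin.sum_univ_four]
    ext x
    have hx := congrArg (fun f : B => f.1 x) hr
    have hs := i.sd_ne
    simp [B.mul_val] at hx ⊢
    field_simp
    linear_combination (-64 * (gsq g * csq b * (i.chi g).1 x ^ 2) * (i.sd : ℂ) ^ 2) * hx
  simp only [Fintype.sum_prod_type, h]
  simp only [Finset.sum_neg_distrib, ← Finset.mul_sum, rc_sum]
  rw [← Finset.sum_mul, Fin.sum_univ_two, chi_sq, one_mul]

lemma db_chi (i : Data) (g : Fin 2) : db (i.chi g) = 0 := db_timeB _ _ _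

/-- The coefficient of a wave in the velocity, before cutting off in time. -/
def C0 (i : Data) (p : Wv) : B := -(i.amp0 p * i.K p) + (2 * Complex.I * i.mu⁻¹) • db (i.amp0 p)

/-- The coefficient of a wave in the velocity. -/
def C (i : Data) (p : Wv) : B := -(i.A p * i.K p) + (2 * Complex.I * i.mu⁻¹) • db (i.A p)

lemma C_eq (i : Data) (p : Wv) : i.C p = i.chi p.1 * i.C0 p := by
  rw [C, C0, A, Derivation.leibniz, db_chi]
  simp only [smul_eq_mul, Algebra.smul_def]
  ring

lemma C_mem_Z (i : Data) (p : Wv) : i.C p ∈ Z (i.t0 - 2 / i.lam) :=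
  add_mem (neg_mem (Ideal.mul_mem_right _ _ (i.A_mem_Z p)))
    (csmul_mem_Z _ (db_mem_Z (i.A_mem_Z p)))

/-- The stream function of the perturbation. -/
def Psi (i : Data) : B := i.mu⁻¹ • ∑ p, i.A p * i.ex p

lemma star_mu (i : Data) : star i.mu = i.mu := by
  rw [mu, star_mul', star_natCast]
  norm_num

lemma cj_Psi (i : Data) : cj i.Psi = i.Psi := by
  rw [Psi, cj_smul, cj_wave_sum opp opp_opp _ _ i.cj_ex, star_inv₀, star_mu]
  simp only [cj_A, A_opp]

lemma Psi_mem_Z (i : Data) : i.Psi ∈ Z (i.t0 - 2 / i.lam) :=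
  csmul_mem_Z _ (sum_mem fun p _ => Ideal.mul_mem_right _ _ (i.A_mem_Z p))

lemma vel_Psi (i : Data) : vel i.Psi = ∑ p, i.C p * i.ex p := by
  rw [vel, Psi, Derivation.map_smul, map_sum, Finset.smul_sum, Finset.smul_sum]
  refine Finset.sum_congr rfl fun p _ => ?_
  rw [Derivation.leibniz, db_ex, C]
  ext x
  have := i.mu_ne
  simp
  field_simp
  linear_combination i.mu * (i.A p).1 x * (i.K p).1 x * (i.ex p).1 x * Complex.I_sq

end Data

lemma rc_Sy (g b : Fin 2) : Sy (-(8 / 21)) (301 / 300) fun i => i.rc g b := by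
  have h := Rl_Sy.smul (star (gsq g))
  simp only [Data.rc]
  split_ifs
  · exact h.re.add (h.im.smul _)
  · exact h.im.smul _

lemma norm_sd (i : Data) : ‖(i.sd : ℂ)‖ ≤ 1 * i.lam ^ (-(4 / 21) : ℝ) := by
  rw [Complex.norm_real, Data.sd, norm_of_nonneg (i.rpow_pos _).le, one_mul]

lemma norm_sd_inv (i : Data) : ‖(i.sd : ℂ)⁻¹‖ ≤ 1 * i.lam ^ (4 / 21 : ℝ) := by
  rw [norm_inv, Complex.norm_real, Data.sd, norm_of_nonneg (i.rpow_pos _).le, one_mul,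
    rpow_neg i.pos.le, inv_inv]

lemma amp0_Sy (p : Wv) : Sy (-(4 / 21)) (151 / 150) fun i => i.amp0 p := by
  simp only [Data.amp0, mul_smul]
  exact ((onset_Sy.mono le_rfl (by norm_num)).smulf norm_sd (by norm_num)).sub
    ((((rc_Sy _ _).mono le_rfl (by norm_num)).smul _).smulf norm_sd_inv (by norm_num))

lemma A_Sy (p : Wv) : Sy (-(4 / 21)) (151 / 150) fun i => i.A p :=
  (chi_Sy _).mul (amp0_Sy p) (by norm_num)

lemma db_amp_Sy {s r : ℝ} {f : Data → B} (h : Sy s (151 / 150) f) (hr : s - 97 / 300 ≤ r) :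
    Sy r (151 / 150) fun i => (2 * Complex.I * i.mu⁻¹) • db (f i) := by
  simp only [mul_smul]
  exact Sy.smul 2 (Sy.smul _ ((h.db le_rfl).smulf Data.norm_mu_inv (by linarith)))

lemma C0_Sy (p : Wv) : Sy (-(4 / 21)) (151 / 150) fun i => i.C0 p :=
  ((amp0_Sy p).mul (K_Sy p) (by norm_num)).neg.add (db_amp_Sy (amp0_Sy p) (by norm_num))

lemma C_Sy (p : Wv) : Sy (-(4 / 21)) (151 / 150) fun i => i.C p := by
  simp only [Data.C_eq]
  exact (chi_Sy _).mul (C0_Sy p) (by norm_num)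

lemma W_Sy : Sy (-(4 / 21)) (133 / 100) fun i => vel i.Psi := by
  simp only [Data.vel_Psi]
  exact Sy.sum _ fun p _ => ((C_Sy p).mono le_rfl (by norm_num)).mul (ex_Sy p) (by norm_num)

/-- The stress not cancelled by the interaction of a wave with its opposite. -/
lemma low_stress_Sy : Sy (-(11 / 21)) (151 / 150)
    fun i => i.Rl - ∑ p, i.C p * i.C (opp p) := by
  have h : ∀ i : Data, i.Rl - ∑ p, i.C p * i.C (opp p)
      = ∑ p, (i.A p * i.A p * ((4 * kc p) • db (i.ph p) + (4 : ℂ) • (db (i.ph p) * db (i.ph p)))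
        - ((2 * Complex.I * i.mu⁻¹) • db (i.A p)) * ((2 * Complex.I * i.mu⁻¹) • db (i.A p))) := by
    intro i
    have := i.sum_A_sq
    rw [eq_comm, neg_eq_iff_eq_neg] at this
    rw [this, ← Finset.sum_neg_distrib, ← Finset.sum_sub_distrib]
    refine Finset.sum_congr rfl fun p _ => ?_
    rw [Data.C, Data.C, Data.A_opp, Data.K_opp, Data.K, locK]
    ext x
    simp
    ring
  simp only [h]
  refine Sy.sum _ fun p _ => Sy.sub ?_ ?_
  · refine ((A_Sy p).mul (A_Sy p) le_rfl).mul (t := -(1 / 7)) (((db_ph_Sy p).smul _).add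
      (((db_ph_Sy p).mul (db_ph_Sy p) (by norm_num)).smul _)) (by norm_num)
  · exact (db_amp_Sy (A_Sy p) le_rfl).mul (db_amp_Sy (A_Sy p) le_rfl) (by norm_num)

/-! ### Forces -/

/-- The force carried by a wave. -/
def Data.F1 (i : Data) (p : Wv) : B :=
  mat i.U (i.C p) + (Complex.I * i.mu) • (i.C p * (drift i.U (kc p) + mat i.U (i.ph p)))
    + i.C p * dz i.U + cj (i.C (opp p)) * db i.U

/-- The force carried by a pair of waves. -/
def Data.F2 (i : Data) (p q : Wv) : B :=
  pairForce opp (Complex.I * i.mu / 2) i.A i.C i.K p q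

lemma Data.F1_mem_Z (i : Data) (p : Wv) : i.F1 p ∈ Z (i.t0 - 2 / i.lam) := by
  have h := i.C_mem_Z
  refine add_mem (add_mem (add_mem ?_ (csmul_mem_Z _ (Ideal.mul_mem_right _ _ (h p))))
    (Ideal.mul_mem_right _ _ (h p))) (Ideal.mul_mem_right _ _ (cj_mem_Z (h _)))
  exact add_mem (add_mem (D_mem_Z _ (h p)) (Ideal.mul_mem_left _ _ (dz_mem_Z (h p))))
    (Ideal.mul_mem_left _ _ (db_mem_Z (h p)))

lemma Data.F2_mem_Z (i : Data) (p q : Wv) : i.F2 p q ∈ Z (i.t0 - 2 / i.lam) := by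
  have h := Ideal.mul_mem_right (i.C q) _ (i.C_mem_Z p)
  have h' := Ideal.mul_mem_right (i.A q) _ (i.A_mem_Z p)
  rw [Data.F2, pairForce]
  split_ifs
  · exact zero_mem _
  · exact sub_mem (sub_mem (add_mem (dz_mem_Z h) (csmul_mem_Z _ (Ideal.mul_mem_right _ _ h)))
      (db_mem_Z h')) (csmul_mem_Z _ (Ideal.mul_mem_right _ _ h'))

lemma F1_Sy (p : Wv) : Sy (17 / 21 + 1 / 150) (151 / 150) fun i => i.F1 p := by
  have hU : ∀ v, Sy (6 / 7) (151 / 150) fun i => D v i.U :=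
    fun v => (DU_Sy v).mono le_rfl (by norm_num)
  refine (((mat_Sy (by norm_num) (C_Sy p) (by norm_num)).add ?_).add ((C_Sy p).mul
    (Sy.dz_of (hU 1) (hU 2)) (by norm_num))).add ((C_Sy _).cj.mul (Sy.db_of (hU 1) (hU 2))
    (by norm_num))
  have h : ∀ i : Data, (Complex.I * i.mu) • (i.C p * (drift i.U (kc p) + mat i.U (i.ph p)))
      = Complex.I • i.mu • (i.C0 p * (i.chi p.1 * (drift i.U (kc p) + mat i.U (i.ph p)))) := by
    intro i
    rw [Data.C_eq, mul_smul]
    congr 2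
    ring
  simp only [h]
  exact Sy.smul _ (((C0_Sy p).mul (chi_ph_Sy p) le_rfl).smulf Data.norm_mu (by norm_num))

lemma K_cj_K_Sy (p : Wv) : Sy (-(1 / 7)) (151 / 150) fun i => i.K p * cj (i.K p) - 1 := by
  have h : ∀ i : Data, i.K p * cj (i.K p) - 1 = (2 * kc p) • dz (i.ph p)
      + (2 * star (kc p)) • db (i.ph p) + (4 : ℂ) • (db (i.ph p) * dz (i.ph p)) := by
    intro i
    have := kc_mul_star p
    rw [Data.K, cj_locK p (i.cj_ph p), locK]
    ext x
    simp only [B.add_val, B.sub_val, B.smul_val, B.mul_val, B.one_val]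
    linear_combination this
  simp only [h]
  exact (((dz_ph_Sy p).smul _).add ((db_ph_Sy p).smul _)).add
    (((db_ph_Sy p).mul (dz_ph_Sy p) (by norm_num)).smul _)

lemma pair_C_Sy (p q : Wv) : Sy (-(8 / 21) - 97 / 300) (151 / 150)
    fun i => i.C p * i.C q - i.A p * i.A q * (i.K p * i.K q) := by
  have h : ∀ i : Data, i.C p * i.C q - i.A p * i.A q * (i.K p * i.K q)
      = ((2 * Complex.I * i.mu⁻¹) • db (i.A p)) * i.C q
        - i.A p * i.K p * ((2 * Complex.I * i.mu⁻¹) • db (i.A q)) := by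
    intro i
    rw [Data.C, Data.C]
    ring
  simp only [h]
  exact ((db_amp_Sy (A_Sy p) le_rfl).mul (C_Sy q) (by norm_num)).sub
    (((A_Sy p).mul (K_Sy p) le_rfl).mul (db_amp_Sy (A_Sy q) le_rfl) (by norm_num))

lemma F2_Sy (p q : Wv) : Sy (17 / 21 + 1 / 150) (151 / 150) fun i => i.F2 p q := by
  by_cases hq : q = opp p
  · simp only [Data.F2, pairForce, if_pos hq]
    exact Sy.zero
  have h : ∀ i : Data, i.F2 p q = dz (i.C p * i.C q) - db (i.A p * i.A q)
      + (Complex.I / 2) • i.mu • ((i.C p * i.C q - i.A p * i.A q * (i.K p * i.K q))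
          * cj (i.K p + i.K q)
        + i.A p * i.A q * ((i.K p * cj (i.K p) - 1) * i.K q
          + (i.K q * cj (i.K q) - 1) * i.K p)) := by
    intro i
    rw [Data.F2, pairForce, if_neg hq, smul_smul]
    simp only [Algebra.smul_def, map_add]
    rw [show algebraMap ℂ B (Complex.I * i.mu / 2) = algebraMap ℂ B (Complex.I / 2 * i.mu) by
      congr 1; ring]
    ring
  simp only [h]
  have hA := (A_Sy p).mul (A_Sy q) le_rfl
  refine ((((C_Sy p).mul (C_Sy q) le_rfl).dz (by norm_num)).sub (hA.db (by norm_num))).add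
    (Sy.smul _ (Sy.smulf Data.norm_mu (s := -(11 / 21)) ?_ (by norm_num)))
  refine ((pair_C_Sy p q).mul ((K_Sy p).add (K_Sy q)).cj (by norm_num)).add
    (hA.mul (t := -(1 / 7)) ?_ (by norm_num))
  exact ((K_cj_K_Sy p).mul (K_Sy q) (by norm_num)).add ((K_cj_K_Sy q).mul (K_Sy p) (by norm_num))

lemma force_eq (i : Data) :
    mat i.U (vel i.Psi) + vel i.Psi * dz i.U + cj (vel i.Psi) * db i.U + dz (vel i.Psi ^ 2)
      + (2 : ℂ) • db ((1 / 2 : ℂ) • (∑ p, i.A p * i.A (opp p) - (∑ p, i.A p * i.ex p) ^ 2))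
      = dz (∑ p, i.C p * i.C (opp p)) + (∑ p, i.F1 p * i.ex p
        + ∑ p, ∑ q, i.F2 p q * (i.ex p * i.ex q)) := by
  have hq := quadratic_part opp _ i.A i.C i.K i.ex i.ex_opp i.dz_ex i.db_ex
  have h1 : mat i.U (vel i.Psi) + vel i.Psi * dz i.U + cj (vel i.Psi) * db i.U
      = ∑ p, i.F1 p * i.ex p := by
    rw [i.vel_Psi, mat_wave_sum _ _ _ _ _ i.mat_ex, cj_wave_sum opp opp_opp _ _ i.cj_ex,
      Finset.sum_mul, Finset.sum_mul, ← Finset.sum_add_distrib, ← Finset.sum_add_distrib]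
    refine Finset.sum_congr rfl fun p _ => ?_
    rw [Data.F1]
    ring
  rw [h1, i.vel_Psi, Derivation.map_smul, smul_smul, map_sub,
    show (2 : ℂ) * (1 / 2) = 1 by norm_num, one_smul]
  simp only [Data.F2]
  linear_combination hq

/-! ### One stage of convex integration -/

lemma oscillation {κ : ℂ} (hκ : κ ≠ 0) {b E : Data → B} (hb : Sy (-(1 / 7)) (151 / 150) b)
    (hE : ∀ i, dz (E i) = (Complex.I * i.mu / 2) • ((κ • 1 + b i) * E i)) {t : Data → ℝ} {s : ℝ}
    {F : Data → B} (hF : Sy s (151 / 150) F) (ht : ∀ i, F i ∈ Z (t i)) (n : ℕ) :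
    ∃ G F' : Data → B, Sy (s - 133 / 100) (151 / 150) G ∧ Sy (s - n / 7) (151 / 150) F' ∧
      (∀ i, G i ∈ Z (t i)) ∧ (∀ i, F' i ∈ Z (t i)) ∧
      ∀ i, F i * E i = dz (G i * E i) + F' i * E i := by
  induction n with
  | zero => exact ⟨fun _ => 0, F, Sy.zero, by simpa using hF, fun i => zero_mem _, ht, fun i => by simp⟩
  | succ n ih =>
    obtain ⟨G, F', hG, hF', tG, tF', h⟩ := ih
    have hG1 : Sy (s - n / 7 - 133 / 100) (151 / 150)
        fun i => (2 / (Complex.I * κ)) • i.mu⁻¹ • F' i :=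
      Sy.smul _ (hF'.smulf Data.norm_mu_inv (by linarith))
    refine ⟨fun i => G i + (2 / (Complex.I * κ)) • i.mu⁻¹ • F' i,
      fun i => -(dz ((2 / (Complex.I * κ)) • i.mu⁻¹ • F' i) + κ⁻¹ • (F' i * b i)),
      hG.add (hG1.mono ?_ le_rfl), ((hG1.dz ?_).add ((hF'.mul hb ?_).smul _)).neg,
      fun i => add_mem (tG i) (csmul_mem_Z _ (csmul_mem_Z _ (tF' i))),
      fun i => neg_mem (add_mem (dz_mem_Z (csmul_mem_Z _ (csmul_mem_Z _ (tF' i))))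
        (csmul_mem_Z _ (Ideal.mul_mem_right _ _ (tF' i)))), fun i => ?_⟩
    · have : (0 : ℝ) ≤ n / 7 := by positivity
      linarith
    · push_cast; linarith
    · push_cast; linarith
    · rw [h i, add_mul, map_add]
      simp only [Derivation.leibniz, hE, smul_eq_mul]
      ext x
      have := i.mu_ne
      simp only [B.add_val, B.smul_val, B.mul_val, B.one_val, B.neg_val]
      field_simp
      ring

lemma exists_split : ∃ g r : Data → B,
    Sy (-(11 / 21) + 1 / 100) (133 / 100) (fun i => i.Rl - g i) ∧
    Sy (-(11 / 21) + 1 / 100) (133 / 100) r ∧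
    (∀ i, g i ∈ Z (i.t0 - 2 / i.lam)) ∧ (∀ i, r i ∈ Z (i.t0 - 2 / i.lam)) ∧
    ∀ i, mat i.U (vel i.Psi) + vel i.Psi * dz i.U + cj (vel i.Psi) * db i.U + dz (vel i.Psi ^ 2)
      + (2 : ℂ) • db ((1 / 2 : ℂ) • (∑ p, i.A p * i.A (opp p) - (∑ p, i.A p * i.ex p) ^ 2))
      = dz (g i) + r i := by
  have hK : ∀ (i : Data) p, cj (i.K p) = star (kc p) • 1 + (2 : ℂ) • dz (i.ph p) :=
    fun i p => cj_locK p (i.cj_ph p)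
  have h1 : ∀ p, ∃ G F' : Data → B, Sy (17 / 21 + 1 / 150 - 133 / 100) (151 / 150) G ∧
      Sy (17 / 21 + 1 / 150 - (10 : ℕ) / 7) (151 / 150) F' ∧
      (∀ i, G i ∈ Z (i.t0 - 2 / i.lam)) ∧ (∀ i, F' i ∈ Z (i.t0 - 2 / i.lam)) ∧
      ∀ i, i.F1 p * i.ex p = dz (G i * i.ex p) + F' i * i.ex p := fun p =>
    oscillation (star_ne_zero.mpr (kc_ne_zero p)) ((dz_ph_Sy p).smul 2)
      (fun i => by rw [i.dz_ex, hK]) (F1_Sy p) (fun i => i.F1_mem_Z p) 10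
  have h2 : ∀ p q, ∃ G F' : Data → B, Sy (17 / 21 + 1 / 150 - 133 / 100) (151 / 150) G ∧
      Sy (17 / 21 + 1 / 150 - (10 : ℕ) / 7) (151 / 150) F' ∧
      (∀ i, G i ∈ Z (i.t0 - 2 / i.lam)) ∧ (∀ i, F' i ∈ Z (i.t0 - 2 / i.lam)) ∧
      ∀ i, i.F2 p q * (i.ex p * i.ex q) = dz (G i * (i.ex p * i.ex q))
        + F' i * (i.ex p * i.ex q) := fun p q => by
    by_cases hq : q = opp p
    · exact ⟨fun _ => 0, fun _ => 0, Sy.zero, Sy.zero, fun _ => zero_mem _, fun _ => zero_mem _,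
        fun i => by simp [Data.F2, pairForce, hq]⟩
    · refine oscillation (star_ne_zero.mpr (kc_add_ne_zero hq))
        (((dz_ph_Sy p).smul 2).add ((dz_ph_Sy q).smul 2)) (fun i => ?_) (F2_Sy p q)
        (fun i => i.F2_mem_Z p q) 10
      rw [Derivation.leibniz, i.dz_ex, i.dz_ex, hK, hK, star_add]
      simp only [smul_eq_mul, Algebra.smul_def, map_add]
      ring
  choose G1 R1 hG1 hR1 tG1 tR1 e1 using h1
  choose G2 R2 hG2 hR2 tG2 tR2 e2 using h2
  have hex : ∀ p q, Sy 0 (133 / 100) fun i => i.ex p * i.ex q :=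
    fun p q => (ex_Sy p).mul (ex_Sy q) (by norm_num)
  refine ⟨fun i => ∑ p, i.C p * i.C (opp p) + (∑ p, G1 p i * i.ex p
      + ∑ p, ∑ q, G2 p q i * (i.ex p * i.ex q)),
    fun i => ∑ p, R1 p i * i.ex p + ∑ p, ∑ q, R2 p q i * (i.ex p * i.ex q), ?_, ?_, ?_, ?_, ?_⟩
  · simp only [← sub_sub (Data.Rl _)]
    refine (low_stress_Sy.mono (by norm_num) (by norm_num)).sub (Sy.add ?_ ?_)
    · exact Sy.sum _ fun p _ => ((hG1 p).mono le_rfl (by norm_num)).mul (ex_Sy p) (by norm_num)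
    · exact Sy.sum _ fun p _ => Sy.sum _ fun q _ =>
        ((hG2 p q).mono le_rfl (by norm_num)).mul (hex p q) (by norm_num)
  · refine Sy.add ?_ ?_
    · exact Sy.sum _ fun p _ => ((hR1 p).mono le_rfl (by norm_num)).mul (ex_Sy p) (by norm_num)
    · exact Sy.sum _ fun p _ => Sy.sum _ fun q _ =>
        ((hR2 p q).mono le_rfl (by norm_num)).mul (hex p q) (by norm_num)
  · exact fun i => add_mem (sum_mem fun p _ => Ideal.mul_mem_right _ _ (i.C_mem_Z p))
      (add_mem (sum_mem fun p _ => Ideal.mul_mem_right _ _ (tG1 p i))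
        (sum_mem fun p _ => sum_mem fun q _ => Ideal.mul_mem_right _ _ (tG2 p q i)))
  · exact fun i => add_mem (sum_mem fun p _ => Ideal.mul_mem_right _ _ (tR1 p i))
      (sum_mem fun p _ => sum_mem fun q _ => Ideal.mul_mem_right _ _ (tR2 p q i))
  · intro i
    simp only [force_eq, e1, e2, Finset.sum_add_distrib, map_add, map_sum]
    abel

open Filter in
lemma eventually_rpow_le (C : ℝ) {s t : ℝ} (h : s < t) :
    ∀ᶠ l : ℝ in atTop, C * l ^ s ≤ l ^ t := by
  filter_upwards [(tendsto_rpow_atTop (sub_pos.mpr h)).eventually_ge_atTop C,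
    eventually_gt_atTop 0] with l h1 h2
  calc C * l ^ s ≤ l ^ (t - s) * l ^ s := mul_le_mul_of_nonneg_right h1 (rpow_nonneg h2.le _)
    _ = l ^ t := by rw [← rpow_add h2, sub_add_cancel]

lemma Sy.sup {s l : ℝ} {f : Data → B} (h : Sy s l f) :
    ∃ C, 0 ≤ C ∧ ∀ (i : Data) x, ‖(f i).1 x‖ ≤ C * i.lam ^ s := by
  obtain ⟨C, h0, hC⟩ := h.exists_nonneg 0
  exact ⟨C, h0, fun i x => (hC i).sup x⟩

lemma Tm_vel (a : ℝ) (ψ : B) : vel (Tm a ψ) = Tm a (vel ψ) := by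
  rw [vel, vel, map_smul, db_apply, db_apply, map_smul, map_add, map_smul, D_Tm, D_Tm]

lemma Data.mollified (i : Data) : D 0 (vel (Tm i.ell i.ψ)) + dz (vel (Tm i.ell i.ψ) ^ 2
    + (i.comm + i.Rl)) + (2 : ℂ) • db (Tm i.ell i.P) = 0 := by
  have h := congrArg (Tm i.ell) i.good.eqn
  have hz : ∀ f, Tm i.ell (dz f) = dz (Tm i.ell f) := fun f => by
    rw [dz_apply, dz_apply, map_smul, map_sub, map_smul, D_Tm, D_Tm]
  have hb : ∀ f, Tm i.ell (db f) = db (Tm i.ell f) := fun f => by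
    rw [db_apply, db_apply, map_smul, map_add, map_smul, D_Tm, D_Tm]
  rw [map_add, map_add, map_smul, hz, hb, ← D_Tm, map_add, map_zero] at h
  rw [Tm_vel, Data.comm, Data.U, Data.Rl, Data.U0, ← add_assoc, add_sub_cancel, h]

lemma DP_Tm_sup : ∃ C, ∀ (i : Data) v x, ‖(D v (Tm i.ell i.P)).1 x‖ ≤ C * i.lam ^ (1 : ℝ) := by
  obtain ⟨C, -, hC⟩ := Tm_bdd 0
  refine ⟨C, fun i v x => ?_⟩
  rw [D_Tm, rpow_one]
  exact (hC i.ell i.lam _ i.ell_pos (i.good.der_P v)).sup x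

lemma Sy.RS {s l : ℝ} {f : Data → B} (hf : Sy s l f) : Sy s l fun i => RS (f i) := fun n => by
  obtain ⟨C, hC⟩ := hf n
  exact ⟨24 * C, fun i => by rw [mul_assoc]; exact (hC i).RS (i.rpow_pos l).le⟩

lemma Sy.PS {s l : ℝ} {f : Data → B} (hf : Sy s l f) : Sy s l fun i => PS (f i) := fun n => by
  obtain ⟨C, hC⟩ := hf n
  exact ⟨4 * C, fun i => by rw [mul_assoc]; exact (hC i).PS (i.rpow_pos l).le⟩

lemma Data.comm_mem_Z (i : Data) : i.comm ∈ Z (i.t0 - 2 / i.lam) := by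
  have hU : i.U0 ∈ Z i.t0 := csmul_mem_Z _ (db_mem_Z i.good.supp_ψ)
  have h : i.t0 - 2 / i.lam ≤ i.t0 - ord * i.ell := by
    have := i.ord_ell
    have := div_pos one_pos i.pos
    rw [show (2 : ℝ) / i.lam = 1 / i.lam + 1 / i.lam by ring]
    linarith
  rw [Data.comm, pow_two, pow_two]
  exact Z_anti h (sub_mem (Tm_mem_Z i.ell_pos.le (Ideal.mul_mem_right _ _ hU))
    (Ideal.mul_mem_right _ _ (Tm_mem_Z i.ell_pos.le hU)))

lemma Data.Tm_ψ_mem_Z (i : Data) : Tm i.ell i.ψ ∈ Z (i.t0 - 2 / i.lam) := by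
  have h : i.t0 - 2 / i.lam ≤ i.t0 - ord * i.ell := by
    have := i.ord_ell
    have := div_pos one_pos i.pos
    rw [show (2 : ℝ) / i.lam = 1 / i.lam + 1 / i.lam by ring]
    linarith
  exact Z_anti h (Tm_mem_Z i.ell_pos.le i.good.supp_ψ)

/-- The increment of the pressure. -/
def Data.presQ (i : Data) : B :=
  (1 / 2 : ℂ) • (i.U * cj (vel i.Psi) + cj i.U * vel i.Psi)
    + (1 / 2 : ℂ) • (∑ p, i.A p * i.A (opp p) - (∑ p, i.A p * i.ex p) ^ 2)

lemma Data.cj_presQ (i : Data) : cj i.presQ = i.presQ := by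
  have h : cj (∑ p, i.A p * i.ex p) = ∑ p, i.A p * i.ex p := by
    rw [cj_wave_sum opp opp_opp _ _ i.cj_ex]
    simp only [cj_A, A_opp]
  rw [presQ, map_add, cj_smul, cj_smul, map_add, map_sub, map_mul, map_mul, map_pow, h, map_sum,
    cj_cj, cj_cj]
  simp only [map_mul, cj_A]
  rw [add_comm (cj i.U * vel i.Psi)]
  simp

lemma presQ_Sy : Sy (-(4 / 21)) (133 / 100) Data.presQ := by
  have hU : Sy 0 (133 / 100) Data.U := U_Sy.mono le_rfl (by norm_num)
  have hA : ∀ p, Sy (-(4 / 21)) (133 / 100) fun i => i.A p :=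
    fun p => (A_Sy p).mono le_rfl (by norm_num)
  have hs : Sy (-(4 / 21)) (133 / 100) fun i => ∑ p, i.A p * i.ex p :=
    Sy.sum _ fun p _ => (hA p).mul (ex_Sy p) (by norm_num)
  change Sy _ _ fun i => i.presQ
  simp only [Data.presQ, pow_two]
  exact (((hU.mul W_Sy.cj (by norm_num)).add (hU.cj.mul W_Sy (by norm_num))).smul _).add
    (((Sy.sum _ fun p _ => (hA p).mul (hA (opp p)) (by norm_num)).sub
      (hs.mul hs (by norm_num))).smul _)

lemma P_sub_sup : ∃ C, 0 ≤ C ∧ ∀ (i : Data) x,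
    ‖(Tm i.ell i.P).1 x - i.P.1 x‖ ≤ C * i.lam ^ (-(1 / 300) : ℝ) :=
  ⟨2 ^ 299 * 3, by positivity, P_sub⟩

lemma Data.new_eqn (i : Data) {g r : B} (h : mat i.U (vel i.Psi) + vel i.Psi * dz i.U
      + cj (vel i.Psi) * db i.U + dz (vel i.Psi ^ 2)
      + (2 : ℂ) • db ((1 / 2 : ℂ) • (∑ p, i.A p * i.A (opp p) - (∑ p, i.A p * i.ex p) ^ 2))
      = dz g + r) :
    D 0 (vel (Tm i.ell i.ψ + i.Psi)) + dz (vel (Tm i.ell i.ψ + i.Psi) ^ 2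
      + (i.comm + i.Rl - g - RS r)) + (2 : ℂ) • db (Tm i.ell i.P + i.presQ - PS r) = 0 := by
  have hv : vel (Tm i.ell i.ψ) = i.U := Tm_vel _ _
  rw [← hv] at h
  have := new_equation (by rw [cj_Tm, i.good.real_ψ]) i.cj_Psi i.mollified h
  rw [hv] at this
  exact this

open Filter in
theorem stage : ∃ C L, 0 ≤ C ∧ ∀ i : Data, L ≤ i.lam → ∃ ψ' P' R' : B,
    Good (i.lam ^ (4 / 3 : ℝ)) (i.t0 - 2 / i.lam) ψ' P' R' ∧
    (∀ x, ‖(vel ψ').1 x - (vel i.ψ).1 x‖ ≤ C * i.lam ^ (-(4 / 21) : ℝ)) ∧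
    ∀ x, ‖P'.1 x - i.P.1 x‖ ≤ C * i.lam ^ (-(1 / 300) : ℝ) := by
  obtain ⟨g, r, hg, hr, tg, tr, e⟩ := exists_split
  obtain ⟨C1, p1, hW⟩ := W_Sy.sup
  obtain ⟨C2, p2, hS⟩ := (hg.sub hr.RS).sup
  obtain ⟨C3, hc⟩ := comm_sup
  obtain ⟨C9, p9, hUs⟩ : ∃ C : ℝ, 0 ≤ C ∧ ∀ (i : Data) x,
      ‖i.U.1 x - i.U0.1 x‖ ≤ C * i.lam ^ (-1 : ℝ) := ⟨3 ^ ord, by positivity, Data.U_sub⟩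
  have hp : Sy (-(4 / 21)) (133 / 100) fun i => i.presQ - PS (r i) :=
    presQ_Sy.sub (hr.PS.mono (by norm_num) le_rfl)
  obtain ⟨C4, p4, hP⟩ := hp.sup
  have hD : ∀ v, ∃ C, 0 ≤ C ∧ ∀ i : Data,
      Bdd ord (C * i.lam ^ (8 / 7 - 1 / 1000 : ℝ)) (i.lam ^ (133 / 100 : ℝ))
        (D v (i.U + vel i.Psi)) := by
    intro v
    have h := ((DU_Sy v).mono (t := 8 / 7 - 1 / 1000) (by norm_num)
      (show (301 / 300 : ℝ) ≤ 133 / 100 by norm_num)).add (W_Sy.D v (by norm_num))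
    simp only [← map_add] at h
    exact h.exists_nonneg ord
  choose C5 p5 hD using hD
  have hDP : ∀ v, ∃ C, 0 ≤ C ∧ ∀ (i : Data) x,
      ‖(D v (i.presQ - PS (r i))).1 x‖ ≤ C * i.lam ^ (-(4 / 21) + 133 / 100 : ℝ) :=
    fun v => (hp.D v le_rfl).sup
  choose C6 p6 hDP using hDP
  obtain ⟨C7, hT⟩ := DP_Tm_sup
  have hev : ∀ᶠ l : ℝ in atTop,
      (1 + (C9 + C1)) * l ^ (-(2 / 21) : ℝ) ≤ l ^ (-(1 / 14) : ℝ) ∧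
      (C2 + |C3|) * l ^ (-(11 / 21) + 1 / 100 : ℝ) ≤ l ^ (-(32 / 63) : ℝ) ∧
      (∀ v, C5 v * l ^ (8 / 7 - 1 / 1000 : ℝ) ≤ l ^ (8 / 7 : ℝ)) ∧
      ∀ v, (|C7| + C6 v) * l ^ (6 / 5 : ℝ) ≤ l ^ (4 / 3 : ℝ) :=
    (eventually_rpow_le _ (by norm_num)).and ((eventually_rpow_le _ (by norm_num)).and
      ((eventually_all.mpr fun v => eventually_rpow_le _ (by norm_num)).and
        (eventually_all.mpr fun v => eventually_rpow_le _ (by norm_num))))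
  obtain ⟨L, hL⟩ := eventually_atTop.mp hev
  obtain ⟨C8, p8, hPs⟩ := P_sub_sup
  refine ⟨C9 + C1 + (C8 + C4), L, by positivity, fun i hi => ?_⟩
  obtain ⟨l1, l2, l3, l4⟩ := hL _ hi
  have hUW : ∀ x, ‖(vel (Tm i.ell i.ψ + i.Psi)).1 x - (vel i.ψ).1 x‖
      ≤ (C9 + C1) * i.lam ^ (-(4 / 21) : ℝ) := by
    intro x
    rw [vel_add, B.add_val, add_sub_right_comm, Tm_vel, add_mul]
    refine norm_add_le_of_le ((hUs i x).trans ?_) (hW i x)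
    exact mul_le_mul_of_nonneg_left (i.rpow_le (by norm_num)) (by positivity)
  have hcomm : ∀ x, ‖i.comm.1 x‖ ≤ |C3| * i.lam ^ (-(11 / 21) + 1 / 100 : ℝ) := fun x =>
    (hc i x).trans (mul_le_mul (le_abs_self _) (i.rpow_le (by norm_num)) (i.rpow_pos _).le
      (abs_nonneg _))
  refine ⟨Tm i.ell i.ψ + i.Psi, Tm i.ell i.P + i.presQ - PS (r i),
    i.comm + i.Rl - g i - RS (r i), ⟨?_, ?_, ?_, fun x => ?_, fun v => ?_, fun x => ?_,
    fun v x => ?_, ?_, ?_⟩, fun x => (hUW x).trans ?_, fun x => ?_⟩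
  · rw [map_add, cj_Tm, i.good.real_ψ, i.cj_Psi]
  · rw [map_sub, map_add, cj_Tm, i.good.real_P, i.cj_presQ, cj_PS]
  · exact i.new_eqn (e i)
  · rw [← rpow_mul i.pos.le, show (4 / 3 : ℝ) * -(1 / 14) = -(2 / 21) by norm_num]
    have h1 := hUW x
    have h2 := i.good.sup_U x
    have h3 := norm_sub_norm_le ((vel (Tm i.ell i.ψ + i.Psi)).1 x) ((vel i.ψ).1 x)
    have h4 := mul_le_mul_of_nonneg_left (i.rpow_le (show (-(4 / 21) : ℝ) ≤ -(2 / 21) by norm_num))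
      (show 0 ≤ C9 + C1 by positivity)
    linarith
  · rw [← rpow_mul i.pos.le, show (4 / 3 : ℝ) * (6 / 7) = 8 / 7 by norm_num, vel_add, Tm_vel]
    exact (hD v i).mono (l3 v) (i.rpow_pos _).le (i.rpow_le (by norm_num))
  · rw [← rpow_mul i.pos.le, show (4 / 3 : ℝ) * -(8 / 21) = -(32 / 63) by norm_num]
    refine le_trans ?_ l2
    rw [show i.comm + i.Rl - g i - RS (r i) = (i.Rl - g i - RS (r i)) + i.comm by abel,
      B.add_val, add_mul]
    exact norm_add_le_of_le (hS i x) (hcomm x)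
  · refine le_trans ?_ (l4 v)
    rw [add_sub_assoc, map_add, B.add_val, add_mul]
    refine norm_add_le_of_le ((hT i v x).trans ?_) ((hDP v i x).trans ?_)
    · exact mul_le_mul (le_abs_self _) (i.rpow_le (by norm_num)) (i.rpow_pos _).le (abs_nonneg _)
    · exact mul_le_mul_of_nonneg_left (i.rpow_le (by norm_num)) (p6 v)
  · exact add_mem i.Tm_ψ_mem_Z i.Psi_mem_Z
  · refine sub_mem (sub_mem (add_mem i.comm_mem_Z (Z_anti ?_ i.Rl_mem_Z)) (tg i))
      (RS_mem_Z (tr i))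
    exact sub_le_sub_left (div_le_div_of_nonneg_right (by norm_num) i.pos.le) _
  · exact mul_le_mul_of_nonneg_right (by linarith) (i.rpow_pos _).le
  · rw [add_sub_assoc, B.add_val, add_sub_right_comm]
    refine (norm_add_le_of_le (hPs i x) ((hP i x).trans (mul_le_mul_of_nonneg_left
      (i.rpow_le (show (-(4 / 21) : ℝ) ≤ -(1 / 300) by norm_num)) p4))).trans ?_
    rw [← add_mul]
    exact mul_le_mul_of_nonneg_right (le_add_of_nonneg_left (by positivity)) (i.rpow_pos _).le

end Euler2D

namespace Euler2D

open Filter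

/-! ### A starting point -/

/-- The function `cos x₁`. -/
def cosB : B := (1 / 2 : ℂ) • (planeWave 1 0 + planeWave (-1) 0)

/-- The function `sin x₁`. -/
def sinB : B := (-Complex.I / 2) • (planeWave 1 0 - planeWave (-1) 0)

lemma sinB_val (x : Pt) : sinB.1 x = (sin (x 1) : ℂ) := by
  simp only [sinB, B.smul_val, B.sub_val, planeWave_val]
  rw [Complex.ofReal_sin, Complex.sin]
  push_cast
  ring_nf

lemma cosB_val (x : Pt) : cosB.1 x = (cos (x 1) : ℂ) := by
  simp only [cosB, B.smul_val, B.add_val, planeWave_val]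
  rw [Complex.ofReal_cos, Complex.cos]
  push_cast
  ring_nf

lemma D_one_cosB : D 1 cosB = -sinB := by
  simp only [cosB, sinB, Derivation.map_smul, map_add, D_planeWave_one]
  ext x
  simp only [B.smul_val, B.add_val, B.neg_val, B.sub_val]
  push_cast
  ring

lemma D_one_sinB : D 1 sinB = cosB := by
  simp only [cosB, sinB, Derivation.map_smul, map_sub, D_planeWave_one]
  ext x
  simp only [B.smul_val, B.add_val, B.sub_val]
  push_cast
  linear_combination (-(1 / 2) * (planeWave 1 0).1 x - (1 / 2) * (planeWave (-1) 0).1 x) *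
    Complex.I_sq

lemma D_two_cosB : D 2 cosB = 0 := by
  simp [cosB, D_planeWave_two]

lemma D_two_sinB : D 2 sinB = 0 := by
  simp [sinB, D_planeWave_two]

lemma D_zero_sinB : D 0 sinB = 0 := by
  simp [sinB, D_planeWave_zero]

lemma cj_sinB : cj sinB = sinB := by ext x; rw [cj_val, sinB_val]; exact Complex.conj_ofReal _

lemma cj_cosB : cj cosB = cosB := by ext x; rw [cj_val, cosB_val]; exact Complex.conj_ofReal _

/-- A slowly growing shear flow. -/
def shear (κ : ℝ) : B := (1 / 4 : ℂ) • (timeB step_BT κ 0 * cosB)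

lemma vel_shear (κ : ℝ) : vel (shear κ) = (-Complex.I / 4) • (timeB step_BT κ 0 * sinB) := by
  rw [vel, shear, Derivation.map_smul, Derivation.leibniz, db_timeB, db_apply, D_one_cosB,
    D_two_cosB]
  ext x
  simp
  ring

/-- The pressure of the shear flow. -/
def shearP (κ : ℝ) : B := (1 / 32 : ℂ) • (timeB step_BT κ 0 * sinB) ^ 2

/-- The stress of the shear flow. -/
def shearR (κ : ℝ) : B := (-Complex.I / 2 * κ) • (timeB step_BT.deriv κ 0 * cosB)

lemma shear_eqn (κ : ℝ) : D 0 (vel (shear κ)) + dz (vel (shear κ) ^ 2 + shearR κ) +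
    (2 : ℂ) • db (shearP κ) = 0 := by
  have h1 : D 1 (timeB step_BT κ 0 * sinB) = timeB step_BT κ 0 * cosB := by
    rw [Derivation.leibniz, D_timeB_space _ _ _ (by decide), D_one_sinB]; simp
  have h2 : D 2 (timeB step_BT κ 0 * sinB) = 0 := by
    rw [Derivation.leibniz, D_timeB_space _ _ _ (by decide), D_two_sinB]; simp
  have h0 : D 0 (timeB step_BT κ 0 * sinB) = (κ : ℂ) • (timeB step_BT.deriv κ 0 * sinB) := by
    rw [Derivation.leibniz, D_timeB_zero, D_zero_sinB]
    ext x
    simp only [B.smul_val, B.add_val, B.mul_val, B.zero_val, smul_eq_mul]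
    ring
  have h3 : dz (shearR κ) = (Complex.I / 4 * κ) • (timeB step_BT.deriv κ 0 * sinB) := by
    rw [shearR, Derivation.map_smul, Derivation.leibniz, dz_timeB, dz_apply, D_one_cosB,
      D_two_cosB]
    ext x
    simp
    ring
  have h4 : dz (timeB step_BT κ 0 * sinB) = (1 / 2 : ℂ) • (timeB step_BT κ 0 * cosB) := by
    rw [dz_apply, h1, h2]; simp
  have h5 : db (timeB step_BT κ 0 * sinB) = (1 / 2 : ℂ) • (timeB step_BT κ 0 * cosB) := by
    rw [db_apply, h1, h2]; simp
  rw [vel_shear, shearP, map_add, h3]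
  generalize timeB step_BT κ 0 * sinB = F at *
  rw [Derivation.map_smul, Derivation.map_smul, h0, sq, sq,
    Derivation.leibniz, Derivation.leibniz, Derivation.map_smul, h4, h5]
  ext x
  simp only [B.smul_val, B.add_val, B.mul_val, B.zero_val, smul_eq_mul]
  linear_combination (1 / 16) * F.1 x * ((timeB step_BT κ 0).1 x * cosB.1 x) * Complex.I_sq

lemma abs_step_le (t : ℝ) : |step t| ≤ 1 := by
  rw [step, abs_of_nonneg (smoothTransition.nonneg _)]
  exact smoothTransition.le_one _

lemma timeB_mem_Z {l : ℝ} (hl : 0 < l) :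
    timeB step_BT (l ^ (-(1 / 2) : ℝ)) 0 ∈ Z (-2 * l ^ (1 / 2 : ℝ)) := by
  rw [mem_Z]
  intro x hx
  rw [timeB_val, step_zero, Complex.ofReal_zero]
  have h := mul_lt_mul_of_pos_left hx (rpow_pos_of_pos hl (-(1 / 2)))
  rw [mul_left_comm, ← rpow_add hl] at h
  norm_num at h ⊢
  linarith

lemma timeB_deriv_mem_Z {l : ℝ} (hl : 0 < l) :
    timeB step_BT.deriv (l ^ (-(1 / 2) : ℝ)) 0 ∈ Z (-2 * l ^ (1 / 2 : ℝ)) := by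
  have h := csmul_mem_Z ((l ^ (-(1 / 2) : ℝ) : ℝ) : ℂ)⁻¹ (D_mem_Z 0 (timeB_mem_Z hl))
  rwa [D_timeB_zero, inv_smul_smul₀] at h
  exact_mod_cast (rpow_pos_of_pos hl _).ne'

lemma shear_bounds : ∃ C, ∀ κ, 0 ≤ κ → κ ≤ 1 → (Bdd (ord + 1) C 1 (vel (shear κ))) ∧
    (∀ v x, ‖(D v (shearP κ)).1 x‖ ≤ C) ∧ ∀ x, ‖(shearR κ).1 x‖ ≤ C * κ := by
  obtain ⟨C1, h1⟩ := timeB_bdd step_BT (ord + 1)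
  obtain ⟨C2, h2⟩ := Bdd.exists_const (ord + 1) sinB
  obtain ⟨C3, h3⟩ := timeB_bdd step_BT.deriv 0
  obtain ⟨C4, h4⟩ : ∃ C, ∀ κ, 0 ≤ κ → κ ≤ 1 →
      Bdd (ord + 1) C 1 (timeB step_BT κ 0 * sinB) :=
    ⟨_, fun κ h0 hκ => ((h1 κ 0 h0).mono le_rfl h0 hκ).mul zero_le_one h2⟩
  obtain ⟨C5, h5⟩ : ∃ C, ∀ κ, 0 ≤ κ → κ ≤ 1 → Bdd (ord + 1) C 1 (shearP κ) :=
    ⟨_, fun κ h0 hκ => by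
      rw [shearP, sq]
      exact ((h4 κ h0 hκ).mul zero_le_one (h4 κ h0 hκ)).smul _⟩
  have p4 := (h4 0 le_rfl zero_le_one).nonneg
  have p5 := (h5 0 le_rfl zero_le_one).nonneg
  have p3 := (h3 0 0 le_rfl).nonneg
  refine ⟨C4 + C5 + C3, fun κ h0 hκ => ⟨?_, fun v x => ?_, fun x => ?_⟩⟩
  · rw [vel_shear]
    refine ((h4 κ h0 hκ).smul _).mono ?_ zero_le_one le_rfl
    simp
    linarith
  · refine (((h5 κ h0 hκ).deriv v).sup x).trans ?_
    linarith
  · rw [shearR, B.smul_val, B.mul_val, cosB_val]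
    have := (h3 κ 0 h0).sup x
    have h6 : ‖(cos (x 1) : ℂ)‖ ≤ 1 := by
      rw [Complex.norm_real]; exact abs_cos_le_one _
    rw [norm_mul, norm_mul, norm_mul]
    have h7 : ‖(-Complex.I / 2)‖ = 1 / 2 := by simp
    rw [h7, Complex.norm_real, norm_of_nonneg h0]
    have h8 := mul_le_mul this h6 (norm_nonneg _) p3
    calc _ ≤ 1 / 2 * κ * (C3 * 1) := mul_le_mul_of_nonneg_left h8 (by positivity)
      _ ≤ _ := by nlinarith [mul_nonneg p3 h0, mul_nonneg p4 h0, mul_nonneg p5 h0]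

theorem exists_start : ∀ᶠ lam : ℝ in atTop, ∃ ψ P R : B,
    Good lam (-2 * lam ^ (1 / 2 : ℝ)) ψ P R ∧ ‖(vel ψ).1 ![0, π / 2, 0]‖ = 1 / 4 := by
  obtain ⟨C, hC⟩ := shear_bounds
  filter_upwards [eventually_ge_atTop 1, eventually_rpow_le C (show (0 : ℝ) < 6 / 7 by norm_num),
    eventually_rpow_le C (show (0 : ℝ) < 1 by norm_num),
    eventually_rpow_le C (show (-(1 / 2) : ℝ) < -(8 / 21) by norm_num),
    eventually_rpow_le 2 (show (-(1 / 14) : ℝ) < 0 by norm_num)] with l l1 h1 h2 h3 h4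
  rw [rpow_zero, mul_one] at h1 h2
  rw [rpow_zero] at h4
  rw [rpow_one] at h2
  have hl : 0 < l := by linarith
  set κ := l ^ (-(1 / 2) : ℝ) with hκ
  obtain ⟨b1, b2, b3⟩ := hC κ (rpow_nonneg hl.le _) (rpow_le_one_of_one_le_of_nonpos l1 (by norm_num))
  have hU : ∀ x, ‖(vel (shear κ)).1 x‖ = 1 / 4 * |step (κ * x 0 + 0)| * |sin (x 1)| := by
    intro x
    rw [vel_shear, B.smul_val, B.mul_val, sinB_val, timeB_val, norm_mul, norm_mul,
      Complex.norm_real, Complex.norm_real]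
    simp [mul_assoc]
  refine ⟨shear κ, shearP κ, shearR κ, ⟨?_, ?_, shear_eqn κ, fun x => ?_, fun v => ?_,
    fun x => (b3 x).trans h3, fun v x => (b2 v x).trans h2, ?_, ?_⟩, ?_⟩
  · rw [shear, cj_smul, map_mul, cj_timeB, cj_cosB]; simp
  · rw [shearP, cj_smul, map_pow, map_mul, cj_timeB, cj_sinB]; simp
  · rw [hU]
    have := mul_le_mul (abs_step_le (κ * x 0 + 0)) (abs_sin_le_one (x 1)) (abs_nonneg _) zero_le_one
    linarith
  · have := b1.deriv v
    rw [mul_one] at this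
    exact this.mono h1 zero_le_one l1
  · exact csmul_mem_Z _ (Ideal.mul_mem_right _ _ (timeB_mem_Z hl))
  · exact csmul_mem_Z _ (Ideal.mul_mem_right _ _ (timeB_deriv_mem_Z hl))
  · rw [hU]
    simp [step_one]

/-! ### Convergence of the scheme -/

theorem exists_sequence : ∃ C L, 0 ≤ C ∧ ∀ i : Data, L ≤ i.lam → ∃ s : ℕ → Data, s 0 = i ∧ ∀ q,
    (s (q + 1)).lam = (s q).lam ^ (4 / 3 : ℝ) ∧ (s (q + 1)).t0 = (s q).t0 - 2 / (s q).lam ∧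
    (∀ x, ‖(vel (s (q + 1)).ψ).1 x - (vel (s q).ψ).1 x‖ ≤ C * (s q).lam ^ (-(4 / 21) : ℝ)) ∧
    ∀ x, ‖(s (q + 1)).P.1 x - (s q).P.1 x‖ ≤ C * (s q).lam ^ (-(1 / 300) : ℝ) := by
  obtain ⟨C, L, hC, h⟩ := stage
  have hl : ∀ i : Data, i.lam ≤ i.lam ^ (4 / 3 : ℝ) := fun i => by
    simpa using i.rpow_le (show (1 : ℝ) ≤ 4 / 3 by norm_num)
  have h' : ∀ i : {i : Data // L ≤ i.lam}, ∃ j : {i : Data // L ≤ i.lam},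
      j.1.lam = i.1.lam ^ (4 / 3 : ℝ) ∧ j.1.t0 = i.1.t0 - 2 / i.1.lam ∧
      (∀ x, ‖(vel j.1.ψ).1 x - (vel i.1.ψ).1 x‖ ≤ C * i.1.lam ^ (-(4 / 21) : ℝ)) ∧
      ∀ x, ‖j.1.P.1 x - i.1.P.1 x‖ ≤ C * i.1.lam ^ (-(1 / 300) : ℝ) := fun i => by
    obtain ⟨ψ, P, R, hg, hU, hP⟩ := h i.1 i.2
    exact ⟨⟨⟨_, _, ψ, P, R, hg, i.1.large.trans (hl i.1)⟩, i.2.trans (hl i.1)⟩, rfl, rfl, hU, hP⟩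
  choose nx hn using h'
  exact ⟨C, L, hC, fun i hi => ⟨fun q => (nx^[q] ⟨i, hi⟩).1, rfl, fun q => by
    simp only [Function.iterate_succ_apply']
    exact hn _⟩⟩

lemma eight_le (i : Data) : 8 ≤ i.lam :=
  (show (8 : ℝ) ≤ 300 by norm_num).trans
    ((self_le_rpow_of_one_le (by norm_num) (by norm_num)).trans i.large)

lemma two_mul_le (i : Data) : 2 * i.lam ≤ i.lam ^ (4 / 3 : ℝ) := by
  have h : (2 : ℝ) ≤ i.lam ^ (1 / 3 : ℝ) := by
    have h := rpow_le_rpow (by norm_num) (eight_le i) (show (0 : ℝ) ≤ 1 / 3 by norm_num)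
    rwa [show (8 : ℝ) = 2 ^ (3 : ℝ) by norm_num, ← rpow_mul (by norm_num),
      show (3 : ℝ) * (1 / 3) = 1 by norm_num, rpow_one] at h
  calc 2 * i.lam ≤ i.lam ^ (1 / 3 : ℝ) * i.lam ^ (1 : ℝ) := by
        rw [rpow_one]; exact mul_le_mul_of_nonneg_right h i.pos.le
    _ = _ := by rw [i.rpow_mul_rpow]; norm_num

lemma growth {s : ℕ → Data} (h : ∀ q, (s (q + 1)).lam = (s q).lam ^ (4 / 3 : ℝ)) (q : ℕ) :
    2 ^ q * (s 0).lam ≤ (s q).lam := by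
  induction q with
  | zero => simp
  | succ q ih =>
    rw [h, pow_succ]
    linarith [two_mul_le (s q)]

lemma decay {s : ℕ → Data} (h : ∀ q, (s (q + 1)).lam = (s q).lam ^ (4 / 3 : ℝ)) {t : ℝ}
    (ht : t ≤ 0) (q : ℕ) : (s q).lam ^ t ≤ (s 0).lam ^ t * (2 ^ t) ^ q := by
  refine (rpow_le_rpow_of_nonpos (by have := (s 0).pos; positivity) (growth h q) ht).trans ?_
  rw [mul_rpow (by positivity) (s 0).pos.le, mul_comm, ← rpow_natCast, ← rpow_natCast,
    ← rpow_mul (by norm_num), ← rpow_mul (by norm_num), mul_comm t]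

lemma exists_uniform_limit {f : ℕ → Pt → ℂ} {C r : ℝ} (h0 : 0 ≤ r) (h1 : r < 1)
    (h : ∀ q x, ‖f (q + 1) x - f q x‖ ≤ C * r ^ q) :
    ∃ g, TendstoUniformly f g atTop ∧ ∀ x, ‖f 0 x - g x‖ ≤ C / (1 - r) := by
  have h' : ∀ x q, dist (f q x) (f (q + 1) x) ≤ C * r ^ q := fun x q => by
    rw [dist_comm, dist_eq_norm]; exact h q x
  choose g hg using fun x => cauchySeq_tendsto_of_complete (cauchySeq_of_le_geometric r C h1 (h' x))
  refine ⟨g, ?_, fun x => ?_⟩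
  · have hz : Tendsto (fun q => C * r ^ q / (1 - r)) atTop (nhds 0) := by
      simpa using ((tendsto_pow_atTop_nhds_zero_of_lt_one h0 h1).const_mul C).div_const (1 - r)
    rw [Metric.tendstoUniformly_iff]
    intro ε hε
    filter_upwards [hz.eventually_lt_const hε] with q hq x
    rw [dist_comm]
    exact (dist_le_of_le_geometric_of_tendsto r C h1 (h' x) (hg x) q).trans_lt hq
  · rw [← dist_eq_norm]
    exact dist_le_of_le_geometric_of_tendsto₀ r C h1 (h' x) (hg x)

lemma lipschitz {f : B} {K : ℝ} (h : ∀ v x, ‖(D v f).1 x‖ ≤ K) (x y : Pt) :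
    ‖f.1 x - f.1 y‖ ≤ 3 * K * ‖x - y‖ := by
  refine Convex.norm_image_sub_le_of_norm_fderiv_le (𝕜 := ℝ) (s := Set.univ)
    (fun z _ => B.differentiable f z) (fun z _ => ?_) convex_univ trivial trivial
  have hK : 0 ≤ K := (norm_nonneg _).trans (h 0 0)
  refine ContinuousLinearMap.opNorm_le_bound _ (by positivity) fun w => ?_
  rw [fderiv_apply]
  refine (norm_sum_le_of_le _ (f := fun v => (w v : ℂ) * (D v f).1 z) (n := fun _ => K * ‖w‖)
    fun v _ => ?_).trans ?_
  · rw [norm_mul, Complex.norm_real, mul_comm]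
    exact mul_le_mul (h v z) (norm_le_pi_norm w v) (norm_nonneg _) hK
  · simp
    linarith

lemma le_interpolate {a A A' θ : ℝ} (h0 : 0 ≤ a) (h1 : a ≤ A) (h2 : a ≤ A') (hθ : 0 ≤ θ)
    (hθ1 : θ ≤ 1) : a ≤ A ^ (1 - θ) * A' ^ θ := by
  rcases h0.eq_or_lt with rfl | h
  · exact mul_nonneg (rpow_nonneg h1 _) (rpow_nonneg h2 _)
  · calc a = a ^ (1 - θ) * a ^ θ := by rw [← rpow_add h]; simp
      _ ≤ _ := mul_le_mul (rpow_le_rpow h0 h1 (by linarith)) (rpow_le_rpow h0 h2 hθ)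
        (rpow_nonneg h0 _) (rpow_nonneg (h0.trans h1) _)

lemma holder_increment {i j : Data} {C θ : ℝ} (hC : 0 ≤ C) (hj : j.lam = i.lam ^ (4 / 3 : ℝ))
    (h : ∀ x, ‖(vel j.ψ).1 x - (vel i.ψ).1 x‖ ≤ C * i.lam ^ (-(4 / 21) : ℝ))
    (h0 : 0 ≤ θ) (h1 : θ < 1 / 7) (x y : Pt) :
    ‖((vel j.ψ).1 x - (vel j.ψ).1 y) - ((vel i.ψ).1 x - (vel i.ψ).1 y)‖ ≤
      (2 * C + 6) * ‖x - y‖ ^ θ * i.lam ^ (4 / 3 * θ - 4 / 21) := by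
  have hK : 0 ≤ 2 * C + 6 := by linarith
  have b1 : ‖((vel j.ψ).1 x - (vel j.ψ).1 y) - ((vel i.ψ).1 x - (vel i.ψ).1 y)‖ ≤
      (2 * C + 6) * i.lam ^ (-(4 / 21) : ℝ) := by
    rw [sub_sub_sub_comm]
    refine (norm_sub_le_of_le (h x) (h y)).trans ?_
    rw [← add_mul]
    exact mul_le_mul_of_nonneg_right (by linarith) (i.rpow_pos _).le
  have b2 : ‖((vel j.ψ).1 x - (vel j.ψ).1 y) - ((vel i.ψ).1 x - (vel i.ψ).1 y)‖ ≤
      (2 * C + 6) * (i.lam ^ (8 / 7 : ℝ) * ‖x - y‖) := by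
    have e1 := lipschitz (fun v z => (j.good.der_U v).sup z) x y
    have e2 := lipschitz (fun v z => (i.good.der_U v).sup z) x y
    rw [hj, ← rpow_mul i.pos.le, show (4 / 3 : ℝ) * (6 / 7) = 8 / 7 by norm_num] at e1
    refine (norm_sub_le_of_le e1 e2).trans ?_
    have e3 := i.rpow_le (show (6 / 7 : ℝ) ≤ 8 / 7 by norm_num)
    rw [← add_mul, ← mul_assoc]
    refine mul_le_mul_of_nonneg_right ?_ (norm_nonneg _)
    nlinarith [mul_nonneg hC (i.rpow_pos (8 / 7)).le]
  refine (le_interpolate (norm_nonneg _) b1 b2 h0 (by linarith)).trans (le_of_eq ?_)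
  rw [mul_rpow hK (i.rpow_pos _).le, mul_rpow hK (by have := i.rpow_pos (8 / 7); positivity),
    mul_rpow (i.rpow_pos _).le (norm_nonneg _), ← rpow_mul i.pos.le, ← rpow_mul i.pos.le]
  have e1 : (2 * C + 6) ^ (1 - θ) * (2 * C + 6) ^ θ = 2 * C + 6 := by
    rw [← rpow_add (by linarith)]; simp
  have e2 : i.lam ^ (-(4 / 21) * (1 - θ)) * i.lam ^ (8 / 7 * θ) = i.lam ^ (4 / 3 * θ - 4 / 21) := by
    rw [i.rpow_mul_rpow]; ring_nf
  calc _ = ((2 * C + 6) ^ (1 - θ) * (2 * C + 6) ^ θ) *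
        (i.lam ^ (-(4 / 21) * (1 - θ)) * i.lam ^ (8 / 7 * θ)) * ‖x - y‖ ^ θ := by ring
    _ = _ := by rw [e1, e2]; ring

lemma holder_start (i : Data) {θ : ℝ} (h0 : 0 ≤ θ) (h1 : θ ≤ 1) (x y : Pt) :
    ‖(vel i.ψ).1 x - (vel i.ψ).1 y‖ ≤
      2 ^ (1 - θ) * (3 * i.lam ^ (6 / 7 : ℝ)) ^ θ * ‖x - y‖ ^ θ := by
  have b1 := norm_sub_le_of_le (i.U0_sup x) (i.U0_sup y)
  have b2 := lipschitz (fun v z => (i.good.der_U v).sup z) x y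
  have := le_interpolate (norm_nonneg _) (b1.trans (by norm_num : (1 : ℝ) + 1 ≤ 2)) b2 h0 h1
  rwa [mul_rpow (by have := i.rpow_pos (6 / 7); positivity) (norm_nonneg _), ← mul_assoc] at this

/-- A continuous solution of the planar Euler equations which emerges from rest, presented as a
limit of approximate solutions. -/
structure IsLimit (U Pl : Pt → ℂ) (ψ P R : ℕ → B) : Prop where
  real_ψ : ∀ q, cj (ψ q) = ψ q
  real_P : ∀ q, cj (P q) = P q
  eqn : ∀ q, D 0 (vel (ψ q)) + dz (vel (ψ q) ^ 2 + R q) + (2 : ℂ) • db (P q) = 0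
  lim_U : TendstoUniformly (fun q => (vel (ψ q)).1) U atTop
  lim_P : TendstoUniformly (fun q => (P q).1) Pl atTop
  lim_R : TendstoUniformly (fun q => (R q).1) 0 atTop

theorem exists_limit : ∃ U Pl ψ P R, IsLimit U Pl ψ P R ∧
    (∀ θ : ℝ, 0 ≤ θ → θ < 1 / 7 → ∃ M, ∀ x y, ‖U x - U y‖ ≤ M * ‖x - y‖ ^ θ) ∧
    (∃ t1, ∀ x : Pt, x 0 < t1 → U x = 0) ∧ ∃ x, U x ≠ 0 := by
  obtain ⟨C, L, hC, hseq⟩ := exists_sequence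
  set r : ℝ := 2 ^ (-(4 / 21) : ℝ) with hr
  have hr1 : r < 1 := rpow_lt_one_of_one_lt_of_neg (by norm_num) (by norm_num)
  obtain ⟨l, hl1, hl2, hl3, ψ0, P0, R0, hg0, hU0⟩ := ((eventually_ge_atTop L).and
    ((eventually_ge_atTop ((300 : ℝ) ^ (300 : ℝ))).and
    ((eventually_rpow_le (5 * (C / (1 - r))) (show (-(4 / 21) : ℝ) < 0 by norm_num)).and
      exists_start))).exists
  rw [rpow_zero] at hl3
  obtain ⟨s, hs0, hs⟩ := hseq ⟨l, _, ψ0, P0, R0, hg0, hl2⟩ hl1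
  choose hlam ht0 hU hP using hs
  have bU : ∀ q x, ‖(vel (s (q + 1)).ψ).1 x - (vel (s q).ψ).1 x‖ ≤
      (C * (s 0).lam ^ (-(4 / 21) : ℝ)) * r ^ q := fun q x => by
    rw [mul_assoc]
    exact (hU q x).trans (mul_le_mul_of_nonneg_left (decay hlam (by norm_num) q) hC)
  have bP : ∀ q x, ‖(s (q + 1)).P.1 x - (s q).P.1 x‖ ≤
      (C * (s 0).lam ^ (-(1 / 300) : ℝ)) * (2 ^ (-(1 / 300) : ℝ)) ^ q := fun q x => by
    rw [mul_assoc]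
    exact (hP q x).trans (mul_le_mul_of_nonneg_left (decay hlam (by norm_num) q) hC)
  obtain ⟨U, limU, hUd⟩ := exists_uniform_limit (f := fun q => (vel (s q).ψ).1)
    (rpow_nonneg (by norm_num) _) hr1 bU
  obtain ⟨Pl, limP, -⟩ := exists_uniform_limit (f := fun q => (s q).P.1)
    (rpow_nonneg (by norm_num) _) (rpow_lt_one_of_one_lt_of_neg (by norm_num) (by norm_num)) bP
  refine ⟨U, Pl, fun q => (s q).ψ, fun q => (s q).P, fun q => (s q).R,
    ⟨fun q => (s q).good.real_ψ, fun q => (s q).good.real_P, fun q => (s q).good.eqn, limU, limP,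
      ?_⟩, fun θ h0 h1 => ?_, ⟨(s 0).t0 - 4, fun x hx => ?_⟩, ![0, π / 2, 0], fun h => ?_⟩
  · rw [Metric.tendstoUniformly_iff]
    intro ε hε
    have hz : Tendsto (fun q => (s 0).lam ^ (-(8 / 21) : ℝ) * (2 ^ (-(8 / 21) : ℝ)) ^ q) atTop
        (nhds 0) := by
      simpa using (tendsto_pow_atTop_nhds_zero_of_lt_one (rpow_nonneg (by norm_num) _)
        (rpow_lt_one_of_one_lt_of_neg (by norm_num) (by norm_num))).const_mul
          ((s 0).lam ^ (-(8 / 21) : ℝ))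
    filter_upwards [hz.eventually_lt_const hε] with q hq x
    rw [Pi.zero_apply, dist_zero_left]
    exact (((s q).good.sup_R x).trans (decay hlam (by norm_num) q)).trans_lt hq
  · set r' : ℝ := 2 ^ (4 / 3 * θ - 4 / 21) with hr'
    have h2 : 4 / 3 * θ - 4 / 21 < 0 := by linarith
    have hr2 : r' < 1 := rpow_lt_one_of_one_lt_of_neg (by norm_num) h2
    refine ⟨2 ^ (1 - θ) * (3 * (s 0).lam ^ (6 / 7 : ℝ)) ^ θ +
      (2 * C + 6) * (s 0).lam ^ (4 / 3 * θ - 4 / 21) / (1 - r'), fun x y => ?_⟩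
    have hlim : Tendsto (fun q => (vel (s q).ψ).1 x - (vel (s q).ψ).1 y) atTop
        (nhds (U x - U y)) := (limU.tendsto_at x).sub (limU.tendsto_at y)
    have h3 := dist_le_of_le_geometric_of_tendsto₀ r'
      ((2 * C + 6) * ‖x - y‖ ^ θ * (s 0).lam ^ (4 / 3 * θ - 4 / 21)) hr2 (fun q => by
        rw [dist_comm, dist_eq_norm, mul_assoc]
        refine (holder_increment hC (hlam q) (hU q) h0 h1 x y).trans
          (mul_le_mul_of_nonneg_left (decay hlam h2.le q) ?_)
        have := rpow_nonneg (norm_nonneg (x - y)) θ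
        positivity) hlim
    have h4 := holder_start (s 0) h0 (by linarith) x y
    rw [dist_comm, dist_eq_norm] at h3
    have h5 := norm_le_norm_add_norm_sub' (U x - U y) ((vel (s 0).ψ).1 x - (vel (s 0).ψ).1 y)
    rw [add_mul]
    refine h5.trans (add_le_add h4 (h3.trans (le_of_eq ?_)))
    ring
  · have ht : ∀ q, (s 0).t0 - 4 + 4 * (1 / 2) ^ q ≤ (s q).t0 := fun q => by
      induction q with
      | zero => simp
      | succ q ih =>
        rw [ht0]
        have h1 : (2 : ℝ) / (s q).lam ≤ 2 * (1 / 2) ^ q := by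
          rw [div_le_iff₀ (s q).pos]
          have h2 := growth hlam q
          have h3 := (s 0).one_le
          have h4 : (1 / 2 : ℝ) ^ q * 2 ^ q = 1 := by rw [← mul_pow]; norm_num
          have h5 : (2 : ℝ) ^ q ≤ (s q).lam :=
            (le_mul_of_one_le_right (by positivity) h3).trans h2
          nlinarith [mul_le_mul_of_nonneg_left h5 (show (0 : ℝ) ≤ (1 / 2) ^ q by positivity)]
        rw [pow_succ]
        linarith
    refine tendsto_nhds_unique (limU.tendsto_at x) (tendsto_const_nhds.congr fun q => ?_)
    have h1 := ht q
    have h2 : (0 : ℝ) < (1 / 2) ^ q := by positivity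
    exact ((csmul_mem_Z _ (db_mem_Z (s q).good.supp_ψ)) x (by linarith)).symm
  · have h1 := hUd ![0, π / 2, 0]
    rw [h, sub_zero, hs0, hU0] at h1
    have h2 : C * l ^ (-(4 / 21) : ℝ) / (1 - r) = C / (1 - r) * l ^ (-(4 / 21) : ℝ) := by ring
    rw [h2] at h1
    linarith

/-! ### Integration over space-time -/

/-- The box `(-π, π]³`, up to its boundary. -/
lemma box3_ae : Box3 =ᵐ[volume] Set.Icc (fun _ => -π) (fun _ => π : Pt) :=
  Measure.univ_pi_Ioc_ae_eq_Icc

lemma box3_subset : Box3 ⊆ Set.Icc (fun _ => -π) (fun _ => π : Pt) := fun _ hx =>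
  ⟨fun i => (hx i trivial).1.le, fun i => (hx i trivial).2⟩

lemma integrableOn_cylinder (T : ℝ) (F : C(ℝ × Pt, ℂ)) :
    IntegrableOn F (Set.Ioo 0 T ×ˢ Box3) :=
  (F.continuous.continuousOn.integrableOn_compact (isCompact_Icc.prod isCompact_Icc)).mono_set
    (Set.prod_mono Set.Ioo_subset_Icc_self box3_subset)

/-- Integration over `(0, T) × 𝕋³`. -/
def integ (T : ℝ) : C(ℝ × Pt, ℂ) →ₗ[ℂ] ℂ where
  toFun F := ∫ z in Set.Ioo 0 T ×ˢ Box3, F z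
  map_add' F G := integral_add (integrableOn_cylinder T F) (integrableOn_cylinder T G)
  map_smul' c _ := integral_const_mul c _

lemma integ_apply (T : ℝ) (F : C(ℝ × Pt, ℂ)) :
    integ T F = ∫ t in Set.Ioo 0 T, ∫ x in Box3, F (t, x) :=
  setIntegral_prod _ (integrableOn_cylinder T F)

lemma integ_symm (T : ℝ) (F : C(ℝ × Pt, ℂ)) :
    integ T F = ∫ x in Box3, ∫ t in Set.Ioo 0 T, F (t, x) := by
  have h : IntegrableOn (fun z : Pt × ℝ => F z.swap) (Box3 ×ˢ Set.Ioo 0 T) :=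
    ((F.continuous.comp continuous_swap).continuousOn.integrableOn_compact
      (isCompact_Icc.prod isCompact_Icc)).mono_set
      (Set.prod_mono box3_subset Set.Ioo_subset_Icc_self)
  exact (setIntegral_prod_swap (Set.Ioo 0 T) Box3 (fun z : ℝ × Pt => F z)).symm.trans
    (setIntegral_prod (fun z : Pt × ℝ => F z.swap) h)

lemma integ_tendsto (T : ℝ) {F : ℕ → C(ℝ × Pt, ℂ)} {G : C(ℝ × Pt, ℂ)}
    (h : Tendsto F atTop (nhds G)) : Tendsto (fun q => integ T (F q)) atTop (nhds (integ T G)) := by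
  have h1 := (ContinuousMap.tendsto_iff_forall_isCompact_tendstoUniformlyOn.1 h)
    (Set.Icc 0 T ×ˢ Set.Icc (fun _ => -π) (fun _ => π : Pt)) (isCompact_Icc.prod isCompact_Icc)
  have hsub := Set.prod_mono (Set.Ioo_subset_Icc_self (a := 0) (b := T)) box3_subset
  have hfin : volume (Set.Ioo 0 T ×ˢ Box3) < ⊤ :=
    (measure_mono hsub).trans_lt (isCompact_Icc.prod isCompact_Icc).measure_lt_top
  set V := volume.real (Set.Ioo 0 T ×ˢ Box3) with hV
  have hV0 : 0 ≤ V := measureReal_nonneg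
  rw [Metric.tendsto_atTop]
  intro ε hε
  rw [Metric.tendstoUniformlyOn_iff] at h1
  obtain ⟨N, hN⟩ := eventually_atTop.1 (h1 (ε / (V + 1)) (by positivity))
  refine ⟨N, fun q hq => ?_⟩
  rw [dist_comm, dist_eq_norm, ← map_sub]
  refine (norm_setIntegral_le_of_norm_le_const hfin fun z hz => ?_).trans_lt
    (show ε / (V + 1) * V < ε from ?_)
  · have := hN q hq z (hsub hz)
    rw [dist_eq_norm] at this
    exact this.le
  · rw [div_mul_eq_mul_div, div_lt_iff₀ (by positivity)]
    nlinarith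

lemma integral_pd_eq_zero (i : Fin 3) {f : Pt → ℂ} (hf : ContDiff ℝ 1 f)
    (hp : ∀ (l : Fin 3 → ℤ) (x : Pt), f (x + fun j => 2 * π * (l j : ℝ)) = f x) :
    ∫ x in Box3, fderiv ℝ f x (Pi.single i 1) = 0 := by
  rw [setIntegral_congr_set box3_ae]
  have hd : ∀ x, HasFDerivAt f (fderiv ℝ f x) x := fun x =>
    (hf.differentiable one_ne_zero x).hasFDerivAt
  have hc : Continuous fun x => fderiv ℝ f x (Pi.single i 1) :=
    (hf.continuous_fderiv one_ne_zero).clm_apply continuous_const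
  have hsum : ∀ x, ∑ j, (if j = i then fderiv ℝ f x else 0) (Pi.single j 1) =
      fderiv ℝ f x (Pi.single i 1) := fun x => by
    rw [Finset.sum_eq_single i (fun j _ hj => by simp [hj]) (by simp)]
    simp
  have h := integral_divergence_of_hasFDerivAt_off_countable' (n := 2) (fun _ => -π) (fun _ => π)
    (fun _ => by linarith [pi_pos]) (fun j => if j = i then f else 0)
    (fun j x => if j = i then fderiv ℝ f x else 0) ∅ Set.countable_empty
    (fun j => by split_ifs; exacts [hf.continuous.continuousOn, continuousOn_const])
    (fun x _ j => by split_ifs; exacts [hd x, hasFDerivAt_const _ _])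
    (by simp only [hsum]; exact hc.continuousOn.integrableOn_compact isCompact_Icc)
  simp only [hsum] at h
  rw [h]
  refine Finset.sum_eq_zero fun j _ => ?_
  rw [sub_eq_zero]
  congr 1
  ext y
  split_ifs
  · rw [← hp (Pi.single j 1) (Fin.insertNth j (-π) y)]
    congr 1
    ext k
    refine Fin.succAboveCases j ?_ (fun k => ?_) k
    · simp
      ring
    · simp
  · rfl

/-- Directions in which one can integrate by parts. -/
def IsDir (w : ℝ × Pt) : Prop := w = (1, 0) ∨ ∃ i, w = (0, Pi.single i 1)

lemma integ_fderiv {T : ℝ} (hT : 0 < T) {f : ℝ × Pt → ℂ} (hf : ContDiff ℝ 1 f)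
    (hp : ∀ (t : ℝ) (l : Fin 3 → ℤ) (x : Pt), f (t, x + fun j => 2 * π * (l j : ℝ)) = f (t, x))
    (h0 : ∀ x, f (0, x) = 0) (h1 : ∀ x, f (T, x) = 0) {w : ℝ × Pt} (hw : IsDir w)
    (F : C(ℝ × Pt, ℂ)) (hF : ∀ z, F z = fderiv ℝ f z w) : integ T F = 0 := by
  have hd : ∀ z, HasFDerivAt f (fderiv ℝ f z) z := fun z =>
    (hf.differentiable one_ne_zero z).hasFDerivAt
  rcases hw with rfl | ⟨i, rfl⟩
  · rw [integ_symm]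
    refine integral_eq_zero_of_ae (Eventually.of_forall fun x => ?_)
    simp only [hF, Pi.zero_apply]
    rw [← integral_Ioc_eq_integral_Ioo, ← intervalIntegral.integral_of_le hT.le]
    have e : ∀ t, HasDerivAt (fun t => f (t, x)) (fderiv ℝ f (t, x) (1, 0)) t := fun t =>
      (hd (t, x)).comp_hasDerivAt t ((hasDerivAt_id t).prodMk (hasDerivAt_const t x))
    rw [intervalIntegral.integral_eq_sub_of_hasDerivAt (fun t _ => e t), h0, h1, sub_zero]
    refine Continuous.intervalIntegrable ?_ _ _
    exact ((hf.continuous_fderiv one_ne_zero).comp (by fun_prop)).clm_apply continuous_const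
  · rw [integ_apply]
    refine integral_eq_zero_of_ae (Eventually.of_forall fun t => ?_)
    simp only [hF, Pi.zero_apply]
    have e : ∀ x, fderiv ℝ f (t, x) (0, Pi.single i 1) =
        fderiv ℝ (fun x => f (t, x)) x (Pi.single i 1) := fun x => by
      have h' : HasFDerivAt (fun x => f (t, x)) ((fderiv ℝ f (t, x)).comp
          ((0 : Pt →L[ℝ] ℝ).prod (ContinuousLinearMap.id ℝ Pt))) x :=
        (hd (t, x)).comp x ((hasFDerivAt_const t x).prodMk (hasFDerivAt_id x))
      rw [h'.fderiv]
      rfl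
    simp only [e]
    exact integral_pd_eq_zero i (hf.comp (contDiff_const.prodMk contDiff_id)) (hp t)

/-! ### Test functions and planar fields -/

/-- The derivative of a complexified test function. -/
def testD {T : ℝ} {g : ℝ → Pt → ℝ} (hg : TestFun T g) (w : ℝ × Pt) : C(ℝ × Pt, ℂ) :=
  ⟨fun z => Complex.ofReal (fderiv ℝ (Function.uncurry g) z w), Complex.continuous_ofReal.comp
    (((hg.1 1).continuous_fderiv one_ne_zero).clm_apply continuous_const)⟩

/-- A complexified test function. -/
def test {T : ℝ} {g : ℝ → Pt → ℝ} (hg : TestFun T g) : C(ℝ × Pt, ℂ) :=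
  ⟨fun z => ((g z.1 z.2 : ℝ) : ℂ), Complex.continuous_ofReal.comp (hg.1 0).continuous⟩

lemma testD_time {T : ℝ} {g : ℝ → Pt → ℝ} (hg : TestFun T g) (t : ℝ) (x : Pt) :
    testD hg (1, 0) (t, x) = tD g t x := by
  have h := ((hg.1 1).differentiable one_ne_zero (t, x)).hasFDerivAt.comp_hasDerivAt t
    ((hasDerivAt_id t).prodMk (hasDerivAt_const t x))
  exact congrArg Complex.ofReal (h.deriv).symm

lemma testD_space {T : ℝ} {g : ℝ → Pt → ℝ} (hg : TestFun T g) (i : Fin 3) (t : ℝ) (x : Pt) :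
    testD hg (0, Pi.single i 1) (t, x) = pd i (g t) x := by
  have h := ((hg.1 1).differentiable one_ne_zero (t, x)).hasFDerivAt.comp x
    ((hasFDerivAt_const t x).prodMk (hasFDerivAt_id x))
  have h2 : pd i (g t) x = fderiv ℝ (Function.uncurry g) (t, x) (0, Pi.single i 1) := by
    rw [pd, (show HasFDerivAt (g t) _ x from h).fderiv]
    simp
  rw [h2]
  rfl

/-- The linear part of `place`. -/
def placeL : (ℝ × Pt) →L[ℝ] Pt :=
  ContinuousLinearMap.pi ![ContinuousLinearMap.fst ℝ ℝ Pt,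
    (ContinuousLinearMap.proj 0).comp (ContinuousLinearMap.snd ℝ ℝ Pt),
    (ContinuousLinearMap.proj 1).comp (ContinuousLinearMap.snd ℝ ℝ Pt)]

/-- Forgetting the third space coordinate and shifting time by `s`. -/
def place (s : ℝ) (z : ℝ × Pt) : Pt := placeL z + ![s, 0, 0]

lemma placeL_apply (z : ℝ × Pt) : placeL z = ![z.1, z.2 0, z.2 1] := by
  ext i
  fin_cases i <;> rfl

lemma continuous_place (s : ℝ) : Continuous (place s) := placeL.continuous.add continuous_const

lemma place_add (s t : ℝ) (l : Fin 3 → ℤ) (x : Pt) :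
    place s (t, x + fun j => 2 * π * (l j : ℝ)) =
      place s (t, x) + l 0 • ((2 * π) • ev 1) + l 1 • ((2 * π) • ev 2) := by
  ext i
  fin_cases i
  · change t + s = t + s + l 0 • ((2 * π) * (Pi.single 1 1 : Pt) 0) +
      l 1 • ((2 * π) * (Pi.single 2 1 : Pt) 0)
    simp
  · change x 0 + 2 * π * l 0 + 0 = x 0 + 0 + l 0 • ((2 * π) * (Pi.single 1 1 : Pt) 1) +
      l 1 • ((2 * π) * (Pi.single 2 1 : Pt) 1)
    simp
    ring
  · change x 1 + 2 * π * l 1 + 0 = x 1 + 0 + l 0 • ((2 * π) * (Pi.single 1 1 : Pt) 2) +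
      l 1 • ((2 * π) * (Pi.single 2 1 : Pt) 2)
    simp
    ring

lemma B.periodic_place (f : B) (s t : ℝ) (l : Fin 3 → ℤ) (x : Pt) :
    f.1 (place s (t, x + fun j => 2 * π * (l j : ℝ))) = f.1 (place s (t, x)) := by
  have h1 : Function.Periodic f.1 ((2 * π) • ev 1) := B.periodic f (by decide)
  have h2 : Function.Periodic f.1 ((2 * π) • ev 2) := B.periodic f (by decide)
  rw [place_add, h2.zsmul, h1.zsmul]

/-- Planar fields as fields in space. -/
def lift (s : ℝ) : B →ₐ[ℂ] C(ℝ × Pt, ℂ) where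
  toFun f := ⟨fun z => f.1 (place s z), (B.continuous f).comp (continuous_place s)⟩
  map_one' := rfl
  map_mul' _ _ := rfl
  map_zero' := rfl
  map_add' _ _ := rfl
  commutes' _ := rfl

lemma lift_apply (s : ℝ) (f : B) (z : ℝ × Pt) : lift s f z = f.1 (place s z) := rfl

lemma B.contDiff_one (f : B) : ContDiff ℝ 1 f.1 :=
  contDiff_one_iff_fderiv.2 ⟨B.differentiable f, (B.differentiable_fderiv f).continuous⟩

lemma fderiv_lift (s : ℝ) (f : B) (z w : ℝ × Pt) :
    fderiv ℝ (fun z => f.1 (place s z)) z w =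
      w.1 * (lift s (D 0 f)) z + w.2 0 * (lift s (D 1 f)) z + w.2 1 * (lift s (D 2 f)) z := by
  have h1 : HasFDerivAt (place s) placeL z := placeL.hasFDerivAt.add_const _
  have h := (B.differentiable f (place s z)).hasFDerivAt.comp z h1
  rw [(show HasFDerivAt (fun z => f.1 (place s z)) _ z from h).fderiv,
    ContinuousLinearMap.comp_apply, fderiv_apply, placeL_apply, Fin.sum_univ_three]
  rfl

lemma integ_parts {T : ℝ} (hT : 0 < T) (s : ℝ) {g : ℝ → Pt → ℝ} (hg : TestFun T g) {w : ℝ × Pt}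
    (hw : IsDir w) (f f' : B)
    (hf : ∀ z, fderiv ℝ (fun z => f.1 (place s z)) z w = lift s f' z) :
    integ T (lift s f * testD hg w) = -integ T (lift s f' * test hg) := by
  rw [eq_neg_iff_add_eq_zero, ← map_add]
  obtain ⟨a, b, ha, hab, hb, h0⟩ := hg.2.2
  have c1 : ContDiff ℝ 1 fun z => f.1 (place s z) :=
    (B.contDiff_one f).comp (placeL.contDiff.add contDiff_const)
  have c2 : ContDiff ℝ 1 fun z : ℝ × Pt => ((g z.1 z.2 : ℝ) : ℂ) :=
    Complex.ofRealCLM.contDiff.comp (hg.1 1)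
  refine integ_fderiv hT (f := fun z => f.1 (place s z) * ((g z.1 z.2 : ℝ) : ℂ))
    (c1.mul c2) (fun t l x => ?_) (fun x => ?_) (fun x => ?_) hw _ fun z => ?_
  · rw [B.periodic_place]
    congr 2
    exact hg.2.1 t l x
  · have : g 0 x = 0 := h0 0 (fun h => by linarith [h.1]) x
    simp [this]
  · have : g T x = 0 := h0 T (fun h => by linarith [h.2]) x
    simp [this]
  · have d2 : HasFDerivAt (fun z : ℝ × Pt => ((g z.1 z.2 : ℝ) : ℂ)) _ z :=
      Complex.ofRealCLM.hasFDerivAt.comp z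
        ((hg.1 1).differentiable one_ne_zero z).hasFDerivAt
    rw [fderiv_fun_mul (c1.differentiable one_ne_zero z) (c2.differentiable one_ne_zero z), d2.fderiv]
    simp only [_root_.add_apply, _root_.smul_apply, hf]
    simp [test, testD, lift_apply]
    ring

lemma parts_time {T : ℝ} (hT : 0 < T) (s : ℝ) {g : ℝ → Pt → ℝ} (hg : TestFun T g) (f : B) :
    integ T (lift s f * testD hg (1, 0)) = -integ T (lift s (D 0 f) * test hg) :=
  integ_parts hT s hg (Or.inl rfl) _ _ fun z => by rw [fderiv_lift]; simp

lemma parts_zero {T : ℝ} (hT : 0 < T) (s : ℝ) {g : ℝ → Pt → ℝ} (hg : TestFun T g) (f : B) :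
    integ T (lift s f * testD hg (0, Pi.single 0 1)) = -integ T (lift s (D 1 f) * test hg) :=
  integ_parts hT s hg (Or.inr ⟨0, rfl⟩) _ _ fun z => by rw [fderiv_lift]; simp

lemma parts_one {T : ℝ} (hT : 0 < T) (s : ℝ) {g : ℝ → Pt → ℝ} (hg : TestFun T g) (f : B) :
    integ T (lift s f * testD hg (0, Pi.single 1 1)) = -integ T (lift s (D 2 f) * test hg) :=
  integ_parts hT s hg (Or.inr ⟨1, rfl⟩) _ _ fun z => by rw [fderiv_lift]; simp

lemma parts_two {T : ℝ} (hT : 0 < T) (s : ℝ) {g : ℝ → Pt → ℝ} (hg : TestFun T g) (f : B) :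
    integ T (lift s f * testD hg (0, Pi.single 2 1)) = 0 := by
  rw [integ_parts hT s hg (Or.inr ⟨2, rfl⟩) f 0 fun z => by rw [fderiv_lift]; simp]
  simp

/-! ### Weak formulation -/

lemma conj_integ (T : ℝ) (F : C(ℝ × Pt, ℂ)) : star (integ T F) = integ T (star F) :=
  integral_conj.symm

lemma exists_lift_limit {f : ℕ → B} {F : Pt → ℂ}
    (h : TendstoUniformly (fun q => (f q).1) F atTop) (s : ℝ) :
    ∃ G : C(ℝ × Pt, ℂ), (∀ z, G z = F (place s z)) ∧
      Tendsto (fun q => lift s (f q)) atTop (nhds G) := by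
  have hc : Continuous F := h.continuous (Frequently.of_forall fun q => B.continuous (f q))
  refine ⟨⟨fun z => F (place s z), hc.comp (continuous_place s)⟩, fun z => rfl, ?_⟩
  exact ContinuousMap.tendsto_of_tendstoLocallyUniformly
    (h.comp (place s)).tendstoLocallyUniformly

section Equations

variable {T : ℝ}

lemma integ_eqn (hT : 0 < T) (s : ℝ) {g : ℝ → Pt → ℝ} (hg : TestFun T g) {U P X : B}
    (h : D 0 U + dz X + (2 : ℂ) • db P = 0) :
    integ T (lift s U * testD hg (1, 0)) +
      1 / 2 * (integ T (lift s X * testD hg (0, Pi.single 0 1)) -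
        Complex.I * integ T (lift s X * testD hg (0, Pi.single 1 1))) +
      (integ T (lift s P * testD hg (0, Pi.single 0 1)) +
        Complex.I * integ T (lift s P * testD hg (0, Pi.single 1 1))) = 0 := by
  have e : integ T (lift s (D 0 U + dz X + (2 : ℂ) • db P) * test hg) = 0 := by
    rw [h]
    simp
  rw [dz_apply, db_apply] at e
  simp only [map_add, map_sub, map_smul, add_mul, sub_mul, smul_mul_assoc, smul_eq_mul] at e
  simp only [parts_time hT, parts_zero hT, parts_one hT]
  linear_combination -e

lemma integ_div (hT : 0 < T) (s : ℝ) {g : ℝ → Pt → ℝ} (hg : TestFun T g) {ψ : B}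
    (h : cj ψ = ψ) :
    (integ T (lift s (vel ψ) * testD hg (0, Pi.single 0 1)) -
        Complex.I * integ T (lift s (vel ψ) * testD hg (0, Pi.single 1 1))).re = 0 := by
  have hc : cj (dz (vel ψ)) = -dz (vel ψ) := by
    rw [vel, Derivation.map_smul, cj_smul, cj_dz, cj_db, h, ← dz_db]
    ext x
    simp
  have hs : star (lift s (dz (vel ψ)) * test hg) = -(lift s (dz (vel ψ)) * test hg) := by
    ext z
    have hz := congrArg (fun f : B => f.1 (place s z)) hc
    simp only [cj_val, B.neg_val, RCLike.star_def] at hz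
    simp [test, lift_apply, hz]
  have e : integ T (lift s (dz (vel ψ)) * test hg) = 1 / 2 *
      (integ T (lift s (D 1 (vel ψ)) * test hg) -
        Complex.I * integ T (lift s (D 2 (vel ψ)) * test hg)) := by
    rw [dz_apply]
    simp only [map_sub, map_smul, sub_mul, smul_mul_assoc, smul_eq_mul]
  have h1 := conj_integ T (lift s (dz (vel ψ)) * test hg)
  rw [hs, map_neg] at h1
  have h2 := congrArg Complex.re h1
  simp only [RCLike.star_def, Complex.conj_re, Complex.neg_re] at h2
  have h3 : (integ T (lift s (vel ψ) * testD hg (0, Pi.single 0 1)) -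
        Complex.I * integ T (lift s (vel ψ) * testD hg (0, Pi.single 1 1))) =
      ((-2 : ℝ) : ℂ) * integ T (lift s (dz (vel ψ)) * test hg) := by
    rw [e, parts_zero hT, parts_one hT]
    push_cast
    ring
  rw [h3, Complex.re_ofReal_mul]
  linarith

lemma integ_testD_time (hT : 0 < T) {g : ℝ → Pt → ℝ} (hg : TestFun T g) :
    integ T (testD hg (1, 0)) = 0 := by
  have h := parts_time hT 0 hg 1
  rwa [map_one, one_mul, Derivation.map_one_eq_zero, map_zero, zero_mul, map_zero, neg_zero] at h

end Equations

/-- Weak solutions of the planar equations: `W` is the velocity, `Q - |W|² / 2` the pressure. -/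
structure IsWeak (T : ℝ) (W Q : C(ℝ × Pt, ℂ)) : Prop where
  real : ∀ z, (Q z).im = 0
  eqn : ∀ (g : ℝ → Pt → ℝ) (hg : TestFun T g), integ T (W * testD hg (1, 0)) +
      1 / 2 * (integ T (W ^ 2 * testD hg (0, Pi.single 0 1)) -
        Complex.I * integ T (W ^ 2 * testD hg (0, Pi.single 1 1))) +
      (integ T (Q * testD hg (0, Pi.single 0 1)) +
        Complex.I * integ T (Q * testD hg (0, Pi.single 1 1))) = 0
  div : ∀ (g : ℝ → Pt → ℝ) (hg : TestFun T g), (integ T (W * testD hg (0, Pi.single 0 1)) -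
        Complex.I * integ T (W * testD hg (0, Pi.single 1 1))).re = 0
  vert_sq : ∀ (g : ℝ → Pt → ℝ) (hg : TestFun T g),
    integ T (W * star W * testD hg (0, Pi.single 2 1)) = 0
  vert : ∀ (g : ℝ → Pt → ℝ) (hg : TestFun T g), integ T (Q * testD hg (0, Pi.single 2 1)) = 0

lemma IsLimit.exists_isWeak {U Pl : Pt → ℂ} {ψ P R : ℕ → B} (h : IsLimit U Pl ψ P R) {T : ℝ}
    (hT : 0 < T) (s : ℝ) : ∃ W Q : C(ℝ × Pt, ℂ), IsWeak T W Q ∧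
      (∀ z, W z = U (place s z)) ∧ ∀ z, Q z = Pl (place s z) := by
  obtain ⟨W, hW, hWl⟩ := exists_lift_limit h.lim_U s
  obtain ⟨Q, hQ, hQl⟩ := exists_lift_limit h.lim_P s
  obtain ⟨Z, hZ, hZl⟩ := exists_lift_limit h.lim_R s
  have hZ0 : Z = 0 := by
    ext z
    exact hZ z
  subst hZ0
  have mulc : ∀ {F : ℕ → C(ℝ × Pt, ℂ)} {G : C(ℝ × Pt, ℂ)} (K : C(ℝ × Pt, ℂ)),
      Tendsto F atTop (nhds G) →
      Tendsto (fun q => integ T (F q * K)) atTop (nhds (integ T (G * K))) :=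
    fun K hF => integ_tendsto T (hF.mul_const K)
  refine ⟨W, Q, ⟨fun z => ?_, fun g hg => ?_, fun g hg => ?_, fun g hg => ?_, fun g hg => ?_⟩,
    hW, hQ⟩
  · have h1 := (Complex.continuous_im.tendsto _).comp (h.lim_P.tendsto_at (place s z))
    rw [hQ]
    refine tendsto_nhds_unique h1 (tendsto_const_nhds.congr fun q => ?_)
    have h2 := congrArg (fun f : B => (f.1 (place s z)).im) (h.real_P q)
    simp only [cj_val, RCLike.star_def, Complex.conj_im] at h2
    simp only [Function.comp_apply]
    linarith
  · have hX : Tendsto (fun q => lift s (vel (ψ q) ^ 2 + R q)) atTop (nhds (W ^ 2)) := by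
      simpa only [map_add, map_pow, add_zero] using (hWl.pow 2).add hZl
    have hl := ((mulc (testD hg (1, 0)) hWl).add
      (((mulc (testD hg (0, Pi.single 0 1)) hX).sub
        ((mulc (testD hg (0, Pi.single 1 1)) hX).const_mul Complex.I)).const_mul (1 / 2))).add
      ((mulc (testD hg (0, Pi.single 0 1)) hQl).add
        ((mulc (testD hg (0, Pi.single 1 1)) hQl).const_mul Complex.I))
    refine tendsto_nhds_unique hl (tendsto_const_nhds.congr fun q => ?_)
    exact (integ_eqn hT s hg (h.eqn q)).symm
  · have hl := (Complex.continuous_re.tendsto _).comp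
      ((mulc (testD hg (0, Pi.single 0 1)) hWl).sub
        ((mulc (testD hg (0, Pi.single 1 1)) hWl).const_mul Complex.I))
    refine tendsto_nhds_unique hl (tendsto_const_nhds.congr fun q => ?_)
    exact (integ_div hT s hg (h.real_ψ q)).symm
  · have hs : Tendsto (fun q => star (lift s (vel (ψ q)))) atTop (nhds (star W)) :=
      ((ContinuousMap.continuous_postcomp ⟨star, continuous_star⟩).tendsto W).comp hWl
    have hl := mulc (testD hg (0, Pi.single 2 1)) (hWl.mul hs)
    refine tendsto_nhds_unique hl (tendsto_const_nhds.congr fun q => ?_)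
    exact (parts_two hT s hg (vel (ψ q) * cj (vel (ψ q)))).symm
  · have hl := mulc (testD hg (0, Pi.single 2 1)) hQl
    exact tendsto_nhds_unique hl (tendsto_const_nhds.congr fun q =>
      (parts_two hT s hg (P q)).symm)

lemma integral_eq_re (T : ℝ) (F : C(ℝ × Pt, ℂ)) {a : ℝ → Pt → ℝ}
    (h : ∀ t x, a t x = (F (t, x)).re) :
    ∫ t in Set.Ioo 0 T, ∫ x in Box3, a t x = (integ T F).re := by
  have h1 := integrableOn_cylinder T F
  have h2 : (integ T F).re = ∫ z in Set.Ioo 0 T ×ˢ Box3, (F z).re :=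
    (integral_re (𝕜 := ℂ) h1).symm
  rw [h2]
  simp only [h]
  exact (setIntegral_prod (fun z => (F z).re) h1.re).symm

/-- The planar velocity `W` as a vector field. -/
def toVec (w : ℂ) : Vec := ![w.re, w.im, 0]

section Weak

variable {T : ℝ} {W Q : C(ℝ × Pt, ℂ)}

lemma IsWeak.incompressible (h : IsWeak T W Q) {φ : ℝ → Pt → ℝ} (hφ : TestFun T φ) :
    ∫ t in Set.Ioo 0 T, ∫ x in Box3, ∑ i, toVec (W (t, x)) i * pd i (φ t) x = 0 := by
  rw [integral_eq_re T (W * testD hφ (0, Pi.single 0 1) -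
    Complex.I • (W * testD hφ (0, Pi.single 1 1))) fun t x => ?_]
  · rw [map_sub, map_smul]
    exact h.div φ hφ
  · simp only [ContinuousMap.sub_apply, ContinuousMap.smul_apply, ContinuousMap.mul_apply,
      testD_space, Fin.sum_univ_three]
    simp [toVec]

lemma IsWeak.mass (h : IsWeak T W Q) (hT : 0 < T) {φ : ℝ → Pt → ℝ} (hφ : TestFun T φ) :
    ∫ t in Set.Ioo 0 T, ∫ x in Box3,
      (1 * tD φ t x + 1 * ∑ i, toVec (W (t, x)) i * pd i (φ t) x) = 0 := by
  rw [integral_eq_re T (testD hφ (1, 0) + (W * testD hφ (0, Pi.single 0 1) -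
    Complex.I • (W * testD hφ (0, Pi.single 1 1)))) fun t x => ?_]
  · rw [map_add, map_sub, map_smul, integ_testD_time hT, zero_add]
    exact h.div φ hφ
  · simp only [ContinuousMap.add_apply, ContinuousMap.sub_apply, ContinuousMap.smul_apply,
      ContinuousMap.mul_apply, testD_space, testD_time, Fin.sum_univ_three]
    simp [toVec]

lemma TestFun.component {Ψ : ℝ → Pt → Vec} (h : TestFun T Ψ) (i : Fin 3) :
    TestFun T fun t x => Ψ t x i := by
  obtain ⟨h1, h2, a, b, h3, h4, h5, h6⟩ := h
  exact ⟨fun n => contDiff_pi.1 (h1 n) i, fun t l x => congrFun (h2 t l x) i, a, b, h3, h4, h5,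
    fun t ht x => congrFun (h6 t ht x) i⟩

lemma tD_component {Ψ : ℝ → Pt → Vec} (h : TestFun T Ψ) (i : Fin 3) (t : ℝ) (x : Pt) :
    tD Ψ t x i = tD (fun t x => Ψ t x i) t x := by
  have hd : DifferentiableAt ℝ (fun t => Ψ t x) t :=
    DifferentiableAt.comp (g := Function.uncurry Ψ) (f := fun t : ℝ => (t, x)) t
      ((h.1 1).differentiable one_ne_zero (t, x))
      (differentiableAt_id.prodMk (differentiableAt_const x))
  exact (hasDerivAt_pi.1 hd.hasDerivAt i).deriv.symm

lemma IsWeak.momentum (h : IsWeak T W Q) {Ψ : ℝ → Pt → Vec} (hΨ : TestFun T Ψ) :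
    ∫ t in Set.Ioo 0 T, ∫ x in Box3,
      ((∑ i, 1 * toVec (W (t, x)) i * tD Ψ t x i) +
        (∑ i, ∑ i', 1 * toVec (W (t, x)) i * toVec (W (t, x)) i' *
          pd i' (fun y => Ψ t y i) x) +
        ((Q (t, x)).re - 1 / 2 * Complex.normSq (W (t, x))) *
          ∑ i, pd i (fun y => Ψ t y i) x) = 0 := by
  have c := TestFun.component hΨ
  let E : Fin 3 → C(ℝ × Pt, ℂ) := fun i => W * testD (c i) (1, 0) +
    (1 / 2 : ℂ) • (W ^ 2 * testD (c i) (0, Pi.single 0 1) -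
      Complex.I • (W ^ 2 * testD (c i) (0, Pi.single 1 1))) +
    (Q * testD (c i) (0, Pi.single 0 1) + Complex.I • (Q * testD (c i) (0, Pi.single 1 1)))
  have hE : ∀ i, integ T (E i) = 0 := fun i => by
    simp only [E, map_add, map_sub, map_smul, smul_eq_mul]
    exact h.eqn _ (c i)
  rw [integral_eq_re T (E 0 - Complex.I • E 1 + (Q * testD (c 2) (0, Pi.single 2 1) -
    (1 / 2 : ℂ) • (W * star W * testD (c 2) (0, Pi.single 2 1)))) fun t x => ?_]
  · simp only [map_add, map_sub, map_smul, hE, h.vert, h.vert_sq]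
    simp
  · have hQ := h.real (t, x)
    have t0 := testD_time (c 0) t x
    have t1 := testD_time (c 1) t x
    have s00 := testD_space (c 0) 0 t x
    have s01 := testD_space (c 0) 1 t x
    have s10 := testD_space (c 1) 0 t x
    have s11 := testD_space (c 1) 1 t x
    have s22 := testD_space (c 2) 2 t x
    simp only [E, ContinuousMap.add_apply, ContinuousMap.sub_apply, ContinuousMap.smul_apply,
      ContinuousMap.mul_apply, ContinuousMap.pow_apply, ContinuousMap.star_apply, t0, t1, s00, s01,
      s10, s11, s22, Fin.sum_univ_three, tD_component hΨ]
    generalize W (t, x) = w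
    generalize Q (t, x) = k at hQ ⊢
    simp [toVec, pow_two, Complex.normSq_apply, hQ]
    ring

end Weak

/-! ### A family of solutions with the same initial data -/

lemma periodic_limit {f : ℕ → B} {F : Pt → ℂ}
    (h : TendstoUniformly (fun q => (f q).1) F atTop) (s t : ℝ) (l : Fin 3 → ℤ) (x : Pt) :
    F (place s (t, x + fun j => 2 * π * (l j : ℝ))) = F (place s (t, x)) :=
  tendsto_nhds_unique (h.tendsto_at _)
    ((h.tendsto_at _).congr fun q => (B.periodic_place (f q) s t l x).symm)

lemma place_time (s t : ℝ) (x : Pt) : place s (t, x) 0 = t + s := rfl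

lemma place_section (s : ℝ) (z : Pt) : place s (z 0 - s, ![z 1, z 2, 0]) = z := by
  ext i
  fin_cases i
  · change z 0 - s + s = z 0
    ring
  · change z 1 + 0 = z 1
    ring
  · change z 2 + 0 = z 2
    ring

lemma norm_place_sub_le (s t t' : ℝ) (x y : Pt) :
    ‖place s (t, x) - place s (t', y)‖ ≤ |t - t'| + ‖x - y‖ := by
  have h1 := norm_le_pi_norm (x - y) 0
  have h2 := norm_le_pi_norm (x - y) 1
  have h3 := abs_nonneg (t - t')
  have h4 := norm_nonneg (x - y)
  rw [place, place, add_sub_add_right_eq_sub, ← map_sub, placeL_apply]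
  refine (pi_norm_le_iff_of_nonneg (by positivity)).2 fun i => ?_
  fin_cases i
  · change |t - t'| ≤ _
    linarith
  · change ‖(x - y) 0‖ ≤ _
    linarith
  · change ‖(x - y) 1‖ ≤ _
    linarith

lemma norm_toVec_sub_le (a b : ℂ) : ‖toVec a - toVec b‖ ≤ ‖a - b‖ := by
  refine (pi_norm_le_iff_of_nonneg (norm_nonneg _)).2 fun i => ?_
  fin_cases i
  · exact Complex.abs_re_le_norm (a - b)
  · exact Complex.abs_im_le_norm (a - b)
  · change ‖(0 : ℝ) - 0‖ ≤ _
    simp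

lemma integral_box3_pos {f : Pt → ℝ} (hc : Continuous f)
    (hp : ∀ (l : Fin 3 → ℤ) (x : Pt), f (x + fun j => 2 * π * (l j : ℝ)) = f x)
    (h0 : ∀ x, 0 ≤ f x) {x : Pt} (hx : f x ≠ 0) : 0 < ∫ x in Box3, f x := by
  have h2π : 0 < 2 * π := by positivity
  set y : Pt := x + fun j => 2 * π * ((-toIocDiv h2π (-π) (x j) : ℤ) : ℝ) with hy
  have hfy : f y ≠ 0 := by rwa [hy, hp fun j => -toIocDiv h2π (-π) (x j)]
  have hyB : y ∈ Set.univ.pi fun _ : Fin 3 => Set.Icc (-π) π := fun i _ => by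
    have h := toIocMod_mem_Ioc h2π (-π) (x i)
    have e : y i = toIocMod h2π (-π) (x i) := by
      rw [hy, toIocMod, zsmul_eq_mul]
      simp only [Pi.add_apply]
      push_cast
      ring
    rw [e]
    exact ⟨h.1.le, h.2.trans (by linarith)⟩
  have hcl : closure (Set.univ.pi fun _ : Fin 3 => Set.Ioo (-π) π) =
      Set.univ.pi fun _ : Fin 3 => Set.Icc (-π) π := by
    rw [closure_pi_set]
    simp only [closure_Ioo (show (-π : ℝ) ≠ π by linarith [pi_pos])]
  have hs : IsOpen (Function.support f) := isOpen_ne_fun hc continuous_const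
  have hb : IsOpen (Set.univ.pi fun _ : Fin 3 => Set.Ioo (-π) π) :=
    isOpen_set_pi Set.finite_univ fun _ _ => isOpen_Ioo
  rw [← hcl] at hyB
  have hne := mem_closure_iff.1 hyB _ hs hfy
  have hi : IntegrableOn f Box3 :=
    (hc.continuousOn.integrableOn_compact isCompact_Icc).mono_set box3_subset
  rw [setIntegral_pos_iff_support_of_nonneg_ae (Eventually.of_forall h0) hi]
  exact ((hs.inter hb).measure_pos volume hne).trans_le (measure_mono
    (Set.inter_subset_inter_right _ (Set.pi_mono fun _ _ => Set.Ioo_subset_Ioc_self)))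

lemma exists_onset {U : Pt → ℂ} (h1 : ∃ t1, ∀ x : Pt, x 0 < t1 → U x = 0) (h2 : ∃ x, U x ≠ 0) :
    ∃ τ : ℝ, (∀ x : Pt, x 0 < τ → U x = 0) ∧ ∀ ε > 0, ∃ x : Pt, x 0 < τ + ε ∧ U x ≠ 0 := by
  obtain ⟨x0, hx0⟩ := h2
  have hb : BddAbove {τ : ℝ | ∀ x : Pt, x 0 < τ → U x = 0} :=
    ⟨x0 0, fun τ hτ => not_lt.1 fun h => hx0 (hτ x0 h)⟩
  refine ⟨sSup {τ : ℝ | ∀ x : Pt, x 0 < τ → U x = 0}, fun x hx => ?_, fun ε hε => ?_⟩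
  · obtain ⟨τ, hτ, hlt⟩ := exists_lt_of_lt_csSup h1 hx
    exact hτ x hlt
  · by_contra! h
    have := le_csSup hb h
    linarith

lemma sum_sq_toVec_sub_pos {W V : C(ℝ × Pt, ℂ)} {t : ℝ}
    (hW : ∀ (l : Fin 3 → ℤ) (x : Pt), W (t, x + fun j => 2 * π * (l j : ℝ)) = W (t, x))
    (hV : ∀ x, V (t, x) = 0) {x : Pt} (hx : W (t, x) ≠ 0) :
    0 < ∫ x in Box3, ∑ i, (toVec (W (t, x)) i - toVec (V (t, x)) i) ^ 2 := by
  have e : ∀ x, ∑ i, (toVec (W (t, x)) i - toVec (V (t, x)) i) ^ 2 =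
      Complex.normSq (W (t, x)) := fun x => by
    rw [hV, Fin.sum_univ_three, Complex.normSq_apply]
    simp [toVec]
    ring
  simp only [e]
  exact integral_box3_pos (Complex.continuous_normSq.comp (W.continuous.comp (by fun_prop)))
    (fun l x => by rw [hW]) (fun x => Complex.normSq_nonneg _) (by simpa using hx)

end Euler2D

open Euler2D

/-- Non-uniqueness of Hölder continuous weak solutions to the inhomogeneous
incompressible Euler equations: for any `T > 0` and `0 ≤ α < 1/7` there are infinitely many
pairwise distinct pairs `(ρ_j, u_j) ∈ C^α([0,T]×𝕋³) × C^α([0,T]×𝕋³)` with positive density,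
each a weak solution, all sharing the same initial data. -/
theorem nonuniqueness_inhomogeneous_euler
    (T : ℝ) (hT : 0 < T) (α : ℝ) (hα0 : 0 ≤ α) (hα1 : α < 1 / 7) :
    ∃ (ρ : ℕ → ℝ → Pt → ℝ) (u : ℕ → ℝ → Pt → Vec),
      (∀ j, SpacePeriodic (ρ j) ∧ SpacePeriodic (u j)) ∧
      -- ρ_j, u_j ∈ C^α([0,T] × 𝕋³)
      (∀ j, ∃ C : ℝ, ∀ t ∈ Set.Icc (0 : ℝ) T, ∀ s ∈ Set.Icc (0 : ℝ) T, ∀ x y : Pt,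
        |ρ j t x - ρ j s y| ≤ C * (|t - s| + ‖x - y‖) ^ α ∧
        ‖u j t x - u j s y‖ ≤ C * (|t - s| + ‖x - y‖) ^ α) ∧
      -- (i) positivity of the density
      (∀ j, ∀ t ∈ Set.Icc (0 : ℝ) T, ∀ x : Pt, 0 < ρ j t x) ∧
      -- (ii) each (ρ_j, u_j) is a weak solution of the inhomogeneous incompressible Euler
      -- equations with some continuous pressure p_j
      (∀ j, ∃ p : ℝ → Pt → ℝ,
        ContinuousOn (Function.uncurry p) (Set.Icc (0 : ℝ) T ×ˢ (Set.univ : Set Pt)) ∧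
        SpacePeriodic p ∧
        -- mass equation: ∫∫ (ρ ∂_t φ + ρ u · ∇φ) = 0
        (∀ φ : ℝ → Pt → ℝ, TestFun T φ →
          (∫ t in Set.Ioo (0 : ℝ) T, ∫ x in Box3,
            (ρ j t x * tD φ t x + ρ j t x * ∑ i, u j t x i * pd i (φ t) x)) = 0) ∧
        -- momentum equation: ∫∫ (ρ u · ∂_t Ψ + (ρ u ⊗ u) : ∇Ψ + p ∇·Ψ) = 0
        (∀ Ψ : ℝ → Pt → Vec, TestFun T Ψ →
          (∫ t in Set.Ioo (0 : ℝ) T, ∫ x in Box3,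
            ((∑ i, ρ j t x * u j t x i * tD Ψ t x i)
              + (∑ i, ∑ i', ρ j t x * u j t x i * u j t x i' * pd i' (fun y => Ψ t y i) x)
              + p t x * ∑ i, pd i (fun y => Ψ t y i) x)) = 0) ∧
        -- incompressibility: ∫∫ u · ∇φ = 0
        (∀ φ : ℝ → Pt → ℝ, TestFun T φ →
          (∫ t in Set.Ioo (0 : ℝ) T, ∫ x in Box3,
            (∑ i, u j t x i * pd i (φ t) x)) = 0)) ∧
      -- (iii) all solutions share the same initial data
      (∀ j k, ρ j 0 = ρ k 0 ∧ u j 0 = u k 0) ∧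
      -- (iv) distinct indices give genuinely different solutions:
      -- sup_{t ∈ [0,T]} ‖u_j(t,·) − u_k(t,·)‖_{L²(𝕋³)} > 0
      (∀ j k, j ≠ k → ∃ t ∈ Set.Icc (0 : ℝ) T,
        0 < ∫ x in Box3, ∑ i, (u j t x i - u k t x i) ^ 2) := by
  obtain ⟨U, Pl, ψ, P, R, hlim, hU, h1, h2⟩ := exists_limit
  obtain ⟨τ, hτ, hτ'⟩ := exists_onset h1 h2
  obtain ⟨M, hM⟩ := hU α hα0 hα1
  choose W Q hw hW hQ using fun j : ℕ => hlim.exists_isWeak hT (τ - T / (j + 2))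
  have hWp : ∀ j t (l : Fin 3 → ℤ) (x : Pt),
      W j (t, x + fun i => 2 * π * (l i : ℝ)) = W j (t, x) := fun j t l x => by
    rw [hW, hW, periodic_limit hlim.lim_U]
  have hQp : ∀ j t (l : Fin 3 → ℤ) (x : Pt),
      Q j (t, x + fun i => 2 * π * (l i : ℝ)) = Q j (t, x) := fun j t l x => by
    rw [hQ, hQ, periodic_limit hlim.lim_P]
  have hW0 : ∀ (j : ℕ) (t : ℝ) (x : Pt), t < T / (j + 2) → W j (t, x) = 0 := fun j t x ht => by
    rw [hW]
    refine hτ _ ?_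
    rw [place_time]
    linarith
  have hpos : ∀ j : ℕ, 0 < T / ((j : ℝ) + 2) := fun j => by positivity
  have hle : ∀ j : ℕ, T / ((j : ℝ) + 2) ≤ T := fun j =>
    div_le_self hT.le (by linarith [(Nat.cast_nonneg j : (0 : ℝ) ≤ j)])
  have hdist : ∀ j k : ℕ, k < j → ∃ t ∈ Set.Icc (0 : ℝ) T,
      0 < ∫ x in Box3, ∑ i, (toVec (W j (t, x)) i - toVec (W k (t, x)) i) ^ 2 := by
    intro j k hkj
    have hlt : T / ((j : ℝ) + 2) < T / ((k : ℝ) + 2) := by gcongr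
    obtain ⟨z, hz, hUz⟩ := hτ' _ (sub_pos.2 hlt)
    have hz0 : τ ≤ z 0 := not_lt.1 fun h => hUz (hτ z h)
    have p1 := hpos j
    have p2 := hle k
    refine ⟨z 0 - (τ - T / (j + 2)), ⟨by linarith, by linarith⟩, ?_⟩
    refine sum_sq_toVec_sub_pos (hWp j _) (fun x => hW0 k _ x (by linarith))
      (x := ![z 1, z 2, 0]) ?_
    rwa [hW, place_section]
  refine ⟨fun _ _ _ => 1, fun j t x => toVec (W j (t, x)), fun j => ⟨fun _ _ _ => rfl,
    fun t l x => congrArg toVec (hWp j t l x)⟩, fun j => ⟨|M|, fun t _ s _ x y => ⟨?_, ?_⟩⟩,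
    fun _ _ _ _ => one_pos, fun j => ⟨fun t x => (Q j (t, x)).re - 1 / 2 *
      Complex.normSq (W j (t, x)), ?_, fun t l x => ?_, fun φ hφ => (hw j).mass hT hφ,
      fun Ψ hΨ => (hw j).momentum hΨ, fun φ hφ => (hw j).incompressible hφ⟩,
    fun j k => ⟨rfl, ?_⟩, fun j k hjk => ?_⟩
  · rw [sub_self, abs_zero]
    positivity
  · refine (norm_toVec_sub_le _ _).trans ?_
    rw [hW, hW]
    exact (hM _ _).trans (mul_le_mul (le_abs_self M) (rpow_le_rpow (norm_nonneg _)
      (norm_place_sub_le _ _ _ _ _) hα0) (rpow_nonneg (norm_nonneg _) _) (abs_nonneg _))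
  · exact ((Complex.continuous_re.comp (Q j).continuous).sub
      (continuous_const.mul (Complex.continuous_normSq.comp (W j).continuous))).continuousOn
  · simp only [hWp, hQp]
  · funext x
    simp only [hW0 _ 0 _ (hpos _)]
  · rcases hjk.lt_or_gt with h | h
    · obtain ⟨t, ht, h3⟩ := hdist k j h
      refine ⟨t, ht, h3.trans_eq ?_⟩
      simp only [sub_sq_comm]
    · exact hdist j k h
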